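/- Let A be a function on ℝ with A' ∈ BMO(ℝ) and ‖A'‖_{BMO(ℝ)} = 1. (1) For q_1,…,q_{m+1}, q ∈ (1,∞) with 1/q = 1/q_1 + ⋯ + 1/q_{m+1}, one has ‖C_{m+1,A}(a_1,…,a_m; f)‖_{L^{q,∞}(ℝ)} ≤ C ∏_{j=1}^m ‖a_j‖_{L^{q_j}(ℝ)} ‖f‖_{L^{q_{m+1}}(ℝ)}. (2) More generally, for r_1 ∈ [1,q_1),…, r_m ∈ [1,q_m), q_{m+1} ∈ (1,∞) and 1/r = 1/r_1 + ⋯ + 1/r_m + 1/q_{m+1}, C_{m+1,A} is bounded from L^{r_1}(ℝ) × ⋯ × L^{r_m}(ℝ) × L^{q_{m+1}}(ℝ) to L^{r,∞}(ℝ). -/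

import Mathlib

open MeasureTheory Filter Set
open scoped ENNReal BigOperators

noncomputable section

/-- `Adiff g x y = ∫_y^x g`, i.e. `G x - G y` for an antiderivative `G` of `g`. -/
def Adiff (g : ℝ → ℝ) (x y : ℝ) : ℝ := ∫ t in y..x, g t

/-- `P₂(A; x, y) = A x - A y - A' y * (x - y)`. -/
def P2 (A A' : ℝ → ℝ) (x y : ℝ) : ℝ := A x - A y - A' y * (x - y)

/-- The generalized Calderón commutator `𝒞_{m+1,A}(a₁,…,a_m; f)`, defined as a
principal value. -/
def CcommA (m : ℕ) (A A' : ℝ → ℝ) (a : Fin m → ℝ → ℝ) (f : ℝ → ℝ) (x : ℝ) : ℝ :=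
  limUnder (nhdsWithin 0 (Ioi 0)) fun ε : ℝ =>
    ∫ y in {y : ℝ | ε < |x - y|},
      (P2 A A' x y * ∏ j, Adiff (a j) x y) / (x - y) ^ (m + 2) * f y

/-- The `(m+1)`-th order Calderón commutator `𝒞_{m+1}(a₁,…,a_m; f)`. -/
def Ccomm (m : ℕ) (a : Fin m → ℝ → ℝ) (f : ℝ → ℝ) (x : ℝ) : ℝ :=
  limUnder (nhdsWithin 0 (Ioi 0)) fun ε : ℝ =>
    ∫ y in {y : ℝ | ε < |x - y|},
      (∏ j, Adiff (a j) x y) / (x - y) ^ (m + 1) * f y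

/-- The BMO norm of `g` over intervals in `ℝ`. -/
def bmoNorm (g : ℝ → ℝ) : ℝ :=
  sSup {c : ℝ | ∃ u v : ℝ, u < v ∧
    c = (v - u)⁻¹ * ∫ y in Ioc u v, |g y - (v - u)⁻¹ * ∫ z in Ioc u v, g z|}

/-- Average (in `ℝ≥0∞`) of a nonnegative function over an interval. -/
def avgE (g : ℝ → ℝ) (u v : ℝ) : ℝ≥0∞ :=
  (ENNReal.ofReal (v - u))⁻¹ * ∫⁻ y in Ioc u v, ENNReal.ofReal (g y)

/-- Weighted `L^p` norm `(∫ |g|^p w)^{1/p}`. -/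
def wLpNorm (p : ℝ) (w g : ℝ → ℝ) : ℝ≥0∞ :=
  (∫⁻ x, ENNReal.ofReal (|g x| ^ p * w x)) ^ (1 / p)

/-- `L^p` norm. -/
def LpNorm (p : ℝ) (g : ℝ → ℝ) : ℝ≥0∞ :=
  (∫⁻ x, ENNReal.ofReal (|g x| ^ p)) ^ (1 / p)

/-- Weak `L^p` quasinorm. -/
def wkNorm (p : ℝ) (g : ℝ → ℝ) : ℝ≥0∞ :=
  ⨆ (t : ℝ) (_ : 0 < t), ENNReal.ofReal t * (volume {x : ℝ | t < |g x|}) ^ (1 / p)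

/-- The multiple weight `ν_{→w} = ∏ w_i^{p/p_i}`. -/
def nuW (k : ℕ) (ptot : ℝ) (p : Fin k → ℝ) (w : Fin k → ℝ → ℝ) : ℝ → ℝ :=
  fun x => ∏ i, w i x ^ (ptot / p i)

/-- The multilinear Muckenhoupt `A_{→P}` constant (for exponents `p i > 1`). -/
def APconst (k : ℕ) (ptot : ℝ) (p : Fin k → ℝ) (w : Fin k → ℝ → ℝ) : ℝ≥0∞ :=
  ⨆ (u : ℝ) (v : ℝ) (_ : u < v),
    avgE (nuW k ptot p w) u v *
      ∏ i, (avgE (fun y => w i y ^ (-(1 / (p i - 1)))) u v) ^ (ptot * (1 - 1 / p i))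

/-- Hardy–Littlewood maximal operator on `ℝ` (over intervals). -/
def Mop1 (g : ℝ → ℝ) (x : ℝ) : ℝ≥0∞ :=
  ⨆ (u : ℝ) (v : ℝ) (_ : u < v) (_ : x ∈ Ioc u v), avgE (fun y => |g y|) u v

/-- The Fujii–Wilson `A_∞` constant of a weight `u` on `ℝ`. -/
def AinfConst (u : ℝ → ℝ) : ℝ≥0∞ :=
  ⨆ (c : ℝ) (d : ℝ) (_ : c < d),
    (∫⁻ y in Ioc c d, ENNReal.ofReal (u y))⁻¹ *
      ∫⁻ x in Ioc c d, Mop1 (Set.indicator (Ioc c d) u) x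

/-- The `A_{(1,…,1)}` constant of a vector weight. -/
def A11const (k : ℕ) (w : Fin k → ℝ → ℝ) : ℝ≥0∞ :=
  ⨆ (u : ℝ) (v : ℝ) (_ : u < v),
    avgE (fun x => ∏ i, w i x ^ ((1 : ℝ) / k)) u v *
      ∏ i, ((ENNReal.ofReal (essInf (w i) (volume.restrict (Ioc u v))))⁻¹) ^ ((1 : ℝ) / k)

/-- Luxemburg norm `‖f‖_{L(log L)^γ, (u,v)}` over the interval `(u, v]`. -/
def luxNormI (γ : ℝ) (u v : ℝ) (f : ℝ → ℝ) : ℝ :=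
  sInf {t : ℝ | 0 < t ∧
    ∫⁻ y in Ioc u v, ENNReal.ofReal (|f y| / t * Real.log (Real.exp 1 + |f y| / t) ^ γ)
      ≤ ENNReal.ofReal (v - u)}

/-- The interval with the same center as `(u,v]` and `lam` times its length. -/
def scaleI (lam u v : ℝ) : ℝ × ℝ :=
  ((u + v) / 2 - lam * (v - u) / 2, (u + v) / 2 + lam * (v - u) / 2)

/-- Maximal operator `M_{L log L}` on `ℝ`. -/
def MLlogL (f : ℝ → ℝ) (x : ℝ) : ℝ≥0∞ :=
  ⨆ (u : ℝ) (v : ℝ) (_ : u < v) (_ : x ∈ Ioc u v), ENNReal.ofReal (luxNormI 1 u v f)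

/-- John–Strömberg sharp maximal operator `M^♯_{0,s}` on `ℝ`. -/
def Msharp1 (s : ℝ) (g : ℝ → ℝ) (x : ℝ) : ℝ≥0∞ :=
  ⨆ (u : ℝ) (v : ℝ) (_ : u < v) (_ : x ∈ Ioc u v),
    ⨅ (b : ℝ), ⨅ (t : ℝ) (_ : 0 < t)
      (_ : volume {y ∈ Ioc u v | t < |g y - b|} < ENNReal.ofReal s * volume (Ioc u v)),
      ENNReal.ofReal t

/-- Membership in BMO(ℝ). -/
def MemBMO (g : ℝ → ℝ) : Prop :=
  ∃ M : ℝ, ∀ u v : ℝ, u < v →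
    (v - u)⁻¹ * (∫ y in Ioc u v, |g y - (v - u)⁻¹ * ∫ z in Ioc u v, g z|) ≤ M

end

/-! ### Symmetrization for antisymmetric bounded kernels -/

noncomputable def TT (μ : Measure ℝ) (k : ℝ → ℝ → ℝ) (f : ℝ → ℝ) (x : ℝ) : ℝ := ∫ y, k x y * f y ∂μ

def SS (k : ℝ → ℝ → ℝ) (x y z : ℝ) : ℝ := k x y * k x z + k y x * k y z + k z x * k z y

lemma int_bdd {α : Type*} [MeasurableSpace α] {μ : Measure α} [IsFiniteMeasure μ] {g : α → ℝ}
    (hg : Measurable g) {C : ℝ} (hC : ∀ x, |g x| ≤ C) : Integrable g μ :=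
  Integrable.of_bound hg.aestronglyMeasurable C (Eventually.of_forall fun x => by
    simpa [Real.norm_eq_abs] using hC x)

lemma TT_meas {μ : Measure ℝ} [IsFiniteMeasure μ] {k : ℝ → ℝ → ℝ} (hk : Measurable (Function.uncurry k))
    {f : ℝ → ℝ} (hf : Measurable f) : Measurable (TT μ k f) := by
  have : StronglyMeasurable (Function.uncurry fun x y => k x y * f y) :=
    (hk.mul (hf.comp measurable_snd)).stronglyMeasurable
  exact this.integral_prod_right.measurable

lemma TT_bdd {μ : Measure ℝ} [IsFiniteMeasure μ] {k : ℝ → ℝ → ℝ} {f : ℝ → ℝ} {B F : ℝ}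
    (hkb : ∀ x y, |k x y| ≤ B) (hfb : ∀ x, |f x| ≤ F) (x : ℝ) :
    |TT μ k f x| ≤ B * F * μ.real univ := by
  have hB : 0 ≤ B := (abs_nonneg _).trans (hkb 0 0)
  have := norm_integral_le_of_norm_le_const (μ := μ) (f := fun y => k x y * f y) (C := B * F)
    (Eventually.of_forall fun y => by
      rw [Real.norm_eq_abs, abs_mul]
      exact mul_le_mul (hkb _ _) (hfb _) (abs_nonneg _) hB)
  exact this

lemma hk_comp {α : Type*} [MeasurableSpace α] {k : ℝ → ℝ → ℝ} (hk : Measurable (Function.uncurry k))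
    {u v : α → ℝ} (hu : Measurable u) (hv : Measurable v) : Measurable fun a => k (u a) (v a) :=
  hk.comp (hu.prodMk hv)

lemma SS_meas {k : ℝ → ℝ → ℝ} (hk : Measurable (Function.uncurry k)) {α : Type*} [MeasurableSpace α]
    {u v w : α → ℝ} (hu : Measurable u) (hv : Measurable v) (hw : Measurable w) :
    Measurable fun a => SS k (u a) (v a) (w a) := by
  unfold SS
  exact (((hk_comp hk hu hv).mul (hk_comp hk hu hw)).add
    ((hk_comp hk hv hu).mul (hk_comp hk hv hw))).add ((hk_comp hk hw hu).mul (hk_comp hk hw hv))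

lemma abs_mul_le_of {a b A B : ℝ} (ha : |a| ≤ A) (hb : |b| ≤ B) : |a * b| ≤ A * B := by
  rw [abs_mul]; exact mul_le_mul ha hb (abs_nonneg _) ((abs_nonneg _).trans ha)

lemma SS_bdd {k : ℝ → ℝ → ℝ} {B : ℝ} (hkb : ∀ x y, |k x y| ≤ B) (x y z : ℝ) : |SS k x y z| ≤ 3 * (B * B) := by
  unfold SS
  have h1 := abs_mul_le_of (hkb x y) (hkb x z)
  have h2 := abs_mul_le_of (hkb y x) (hkb y z)
  have h3 := abs_mul_le_of (hkb z x) (hkb z y)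
  have := abs_add_three (k x y * k x z) (k y x * k y z) (k z x * k z y)
  linarith

lemma sym_identity {μ : Measure ℝ} [IsFiniteMeasure μ] {k : ℝ → ℝ → ℝ} {B : ℝ}
    (hk : Measurable (Function.uncurry k)) (hkb : ∀ x y, |k x y| ≤ B)
    {f : ℝ → ℝ} {F : ℝ} (hf : Measurable f) (hfb : ∀ x, |f x| ≤ F) :
    ∫ x, ∫ y, ∫ z, f x * f y * SS k x y z ∂μ ∂μ ∂μ
      = (∫ x, (TT μ k f x) ^ 2 ∂μ) + 2 * ∫ x, f x * TT μ k f x * TT μ k (fun _ => 1) x ∂μ := by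
  have h1f : ∀ x : ℝ, |(fun _ : ℝ => (1:ℝ)) x| ≤ 1 := by simp
  have mT := TT_meas (μ := μ) hk hf
  have bT := TT_bdd (μ := μ) hkb hfb
  have m1 := TT_meas (μ := μ) hk (measurable_const (a := (1:ℝ)))
  have b1 := TT_bdd (μ := μ) hkb h1f
  set P := B * F * μ.real univ
  set Q := B * 1 * μ.real univ
  set T := TT μ k f with hT
  set T1 := TT μ k (fun _ => 1) with hT1
  -- inner z integral
  have e1 : ∀ x y, ∫ z, f x * f y * SS k x y z ∂μ
      = f x * f y * k x y * T1 x + (f x * f y * k y x * T1 y + ∫ z, f x * f y * (k z x * k z y) ∂μ) := by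
    intro x y
    have i1 : Integrable (fun z => f x * f y * k x y * (k x z * 1)) μ :=
      int_bdd (C := F * F * B * (B * 1)) ((hk_comp hk measurable_const measurable_id).mul_const 1 |>.const_mul _)
        (fun z => abs_mul_le_of (abs_mul_le_of (abs_mul_le_of (hfb x) (hfb y)) (hkb x y))
          (abs_mul_le_of (hkb x z) (by simp)))
    have i2 : Integrable (fun z => f x * f y * k y x * (k y z * 1)) μ :=
      int_bdd (C := F * F * B * (B * 1)) ((hk_comp hk measurable_const measurable_id).mul_const 1 |>.const_mul _)
        (fun z => abs_mul_le_of (abs_mul_le_of (abs_mul_le_of (hfb x) (hfb y)) (hkb y x))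
          (abs_mul_le_of (hkb y z) (by simp)))
    have i3 : Integrable (fun z => f x * f y * (k z x * k z y)) μ :=
      int_bdd (C := F * F * (B * B)) (((hk_comp hk measurable_id measurable_const).mul
        (hk_comp hk measurable_id measurable_const)).const_mul _)
        (fun z => abs_mul_le_of (abs_mul_le_of (hfb x) (hfb y)) (abs_mul_le_of (hkb z x) (hkb z y)))
    have : ∀ z, f x * f y * SS k x y z = f x * f y * k x y * (k x z * 1) +
        (f x * f y * k y x * (k y z * 1) + f x * f y * (k z x * k z y)) := by
      intro z; unfold SS; ring
    simp_rw [this]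
    rw [integral_add i1 (i2.fun_add i3), integral_add i2 i3, integral_const_mul, integral_const_mul]
    rfl
  have mz : Measurable fun p : ℝ × ℝ => ∫ z, f p.1 * f p.2 * (k z p.1 * k z p.2) ∂μ := by
    have : StronglyMeasurable (Function.uncurry fun (p : ℝ × ℝ) z => f p.1 * f p.2 * (k z p.1 * k z p.2)) := by
      apply Measurable.stronglyMeasurable
      apply Measurable.mul
      · exact (hf.comp (measurable_fst.comp measurable_fst)).mul (hf.comp (measurable_snd.comp measurable_fst))
      · exact (hk_comp hk measurable_snd (measurable_fst.comp measurable_fst)).mul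
          (hk_comp hk measurable_snd (measurable_snd.comp measurable_fst))
    exact this.integral_prod_right.measurable
  have bz : ∀ x y, |∫ z, f x * f y * (k z x * k z y) ∂μ| ≤ F * F * (B * B) * μ.real univ := by
    intro x y
    have := norm_integral_le_of_norm_le_const (μ := μ) (f := fun z => f x * f y * (k z x * k z y))
      (C := F * F * (B * B)) (Eventually.of_forall fun z => by
        rw [Real.norm_eq_abs]
        exact abs_mul_le_of (abs_mul_le_of (hfb x) (hfb y)) (abs_mul_le_of (hkb z x) (hkb z y)))
    exact this
  have e2 : ∀ x, ∫ y, ∫ z, f x * f y * SS k x y z ∂μ ∂μ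
      = f x * T x * T1 x + ((∫ y, f x * f y * k y x * T1 y ∂μ) + ∫ z, f x * k z x * T z ∂μ) := by
    intro x
    simp_rw [e1]
    have i1 : Integrable (fun y => f x * f y * k x y * T1 x) μ :=
      int_bdd (C := F * F * B * Q) (((hf.const_mul _).mul (hk_comp hk measurable_const measurable_id)).mul_const _)
        (fun y => abs_mul_le_of (abs_mul_le_of (abs_mul_le_of (hfb x) (hfb y)) (hkb x y)) (b1 x))
    have i2 : Integrable (fun y => f x * f y * k y x * T1 y) μ :=
      int_bdd (C := F * F * B * Q) (((hf.const_mul _).mul (hk_comp hk measurable_id measurable_const)).mul m1)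
        (fun y => abs_mul_le_of (abs_mul_le_of (abs_mul_le_of (hfb x) (hfb y)) (hkb y x)) (b1 y))
    have i3 : Integrable (fun y => ∫ z, f x * f y * (k z x * k z y) ∂μ) μ :=
      int_bdd (mz.comp (measurable_const.prodMk measurable_id)) (fun y => bz x y)
    rw [integral_add i1 (i2.fun_add i3), integral_add i2 i3]
    congr 1
    · have : ∀ y, f x * f y * k x y * T1 x = (f x * T1 x) * (k x y * f y) := fun y => by ring
      simp_rw [this]; rw [integral_const_mul]
      change f x * T1 x * T x = _; ring
    · congr 1
      rw [integral_integral_swap]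
      · congr 1; ext z
        have : ∀ y, f x * f y * (k z x * k z y) = (f x * k z x) * (k z y * f y) := fun y => by ring
        simp_rw [this]; rw [integral_const_mul]; rfl
      · apply int_bdd (C := F * F * (B * B))
        · exact ((hf.comp measurable_fst).const_mul _).mul ((hk_comp hk measurable_snd measurable_const).mul
            (hk_comp hk measurable_snd measurable_fst))
        · rintro ⟨y, z⟩
          exact abs_mul_le_of (abs_mul_le_of (hfb x) (hfb y)) (abs_mul_le_of (hkb z x) (hkb z y))
  simp_rw [e2]
  have mj1 : Measurable (Function.uncurry fun x y => f x * f y * k y x * T1 y) :=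
    (((hf.comp measurable_fst).mul (hf.comp measurable_snd)).mul
      (hk_comp hk measurable_snd measurable_fst)).mul (m1.comp measurable_snd)
  have bj1 : ∀ x y, |f x * f y * k y x * T1 y| ≤ F * F * B * Q := fun x y =>
    abs_mul_le_of (abs_mul_le_of (abs_mul_le_of (hfb x) (hfb y)) (hkb y x)) (b1 y)
  have mj2 : Measurable (Function.uncurry fun x z => f x * k z x * T z) :=
    ((hf.comp measurable_fst).mul (hk_comp hk measurable_snd measurable_fst)).mul (mT.comp measurable_snd)
  have bj2 : ∀ x z, |f x * k z x * T z| ≤ F * B * P := fun x z =>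
    abs_mul_le_of (abs_mul_le_of (hfb x) (hkb z x)) (bT z)
  have i1 : Integrable (fun x => f x * T x * T1 x) μ :=
    int_bdd (C := F * P * Q) ((hf.mul mT).mul m1) (fun x => abs_mul_le_of (abs_mul_le_of (hfb x) (bT x)) (b1 x))
  have j1 : Integrable (Function.uncurry fun x y => f x * f y * k y x * T1 y) (μ.prod μ) :=
    int_bdd mj1 (fun p => bj1 p.1 p.2)
  have j2 : Integrable (Function.uncurry fun x z => f x * k z x * T z) (μ.prod μ) :=
    int_bdd mj2 (fun p => bj2 p.1 p.2)
  have l1 : Integrable (fun x => ∫ y, f x * f y * k y x * T1 y ∂μ) μ := j1.integral_prod_left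
  have l2 : Integrable (fun x => ∫ z, f x * k z x * T z ∂μ) μ := j2.integral_prod_left
  rw [integral_add i1 (l1.fun_add l2), integral_add l1 l2]
  rw [integral_integral_swap j1, integral_integral_swap j2]
  have k1 : ∀ y, ∫ x, f x * f y * k y x * T1 y ∂μ = f y * T y * T1 y := by
    intro y
    have : ∀ x, f x * f y * k y x * T1 y = (f y * T1 y) * (k y x * f x) := fun x => by ring
    simp_rw [this]; rw [integral_const_mul]
    change f y * T1 y * T y = _; ring
  have k2 : ∀ z, ∫ x, f x * k z x * T z ∂μ = T z ^ 2 := by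
    intro z
    have : ∀ x, f x * k z x * T z = T z * (k z x * f x) := fun x => by ring
    simp_rw [this]; rw [integral_const_mul]
    change T z * T z = _; ring
  simp_rw [k1, k2]
  ring

noncomputable def cS (μ : Measure ℝ) (k : ℝ → ℝ → ℝ) (x : ℝ) : ℝ := ∫ y, ∫ z, |SS k x y z| ∂μ ∂μ

lemma SS_symm (k : ℝ → ℝ → ℝ) (x y z : ℝ) : SS k y x z = SS k x y z := by unfold SS; ring

lemma gS_meas {μ : Measure ℝ} [IsFiniteMeasure μ] {k : ℝ → ℝ → ℝ} (hk : Measurable (Function.uncurry k)) :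
    Measurable (Function.uncurry fun x y => ∫ z, |SS k x y z| ∂μ) := by
  have : StronglyMeasurable (Function.uncurry fun (p : ℝ × ℝ) z => |SS k p.1 p.2 z|) := by
    apply Measurable.stronglyMeasurable
    exact (SS_meas hk (measurable_fst.comp measurable_fst) (measurable_snd.comp measurable_fst) measurable_snd).abs
  exact this.integral_prod_right.measurable

lemma gS_bdd {μ : Measure ℝ} [IsFiniteMeasure μ] {k : ℝ → ℝ → ℝ} {B : ℝ} (hkb : ∀ x y, |k x y| ≤ B) (x y : ℝ) :
    |∫ z, |SS k x y z| ∂μ| ≤ 3 * (B * B) * μ.real univ := by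
  have := norm_integral_le_of_norm_le_const (μ := μ) (f := fun z => |SS k x y z|) (C := 3 * (B * B))
    (Eventually.of_forall fun z => by simpa using SS_bdd hkb x y z)
  exact this

lemma cS_meas {μ : Measure ℝ} [IsFiniteMeasure μ] {k : ℝ → ℝ → ℝ} (hk : Measurable (Function.uncurry k)) :
    Measurable (cS μ k) := (gS_meas (μ := μ) hk).stronglyMeasurable.integral_prod_right.measurable

lemma cS_nonneg {μ : Measure ℝ} {k : ℝ → ℝ → ℝ} (x : ℝ) : 0 ≤ cS μ k x :=
  integral_nonneg fun _ => integral_nonneg fun _ => abs_nonneg _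

lemma cS_bdd {μ : Measure ℝ} [IsFiniteMeasure μ] {k : ℝ → ℝ → ℝ} {B : ℝ} (hkb : ∀ x y, |k x y| ≤ B) (x : ℝ) :
    |cS μ k x| ≤ 3 * (B * B) * μ.real univ * μ.real univ := by
  have := norm_integral_le_of_norm_le_const (μ := μ) (f := fun y => ∫ z, |SS k x y z| ∂μ)
    (Eventually.of_forall fun z => gS_bdd hkb x z)
  exact this

lemma sym_abs {μ : Measure ℝ} [IsFiniteMeasure μ] {k : ℝ → ℝ → ℝ} {B : ℝ}
    (hk : Measurable (Function.uncurry k)) (hkb : ∀ x y, |k x y| ≤ B)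
    {f : ℝ → ℝ} {F : ℝ} (hf : Measurable f) (hfb : ∀ x, |f x| ≤ F) :
    |∫ x, ∫ y, ∫ z, f x * f y * SS k x y z ∂μ ∂μ ∂μ| ≤ ∫ x, f x ^ 2 * cS μ k x ∂μ := by
  set G : ℝ → ℝ → ℝ := fun x y => ∫ z, |SS k x y z| ∂μ with hG
  have mG : Measurable (Function.uncurry G) := gS_meas hk
  have bG : ∀ x y, |G x y| ≤ 3 * (B * B) * μ.real univ := gS_bdd hkb
  have nG : ∀ x y, 0 ≤ G x y := fun x y => integral_nonneg fun _ => abs_nonneg _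
  have sG : ∀ x y, G y x = G x y := fun x y => by simp only [hG, SS_symm]
  have hf2 : ∀ x, |f x ^ 2| ≤ F * F := fun x => by rw [pow_two]; exact abs_mul_le_of (hfb x) (hfb x)
  have p1 : ∀ x y, |∫ z, f x * f y * SS k x y z ∂μ| ≤ (1/2) * (f x ^ 2 * G x y) + (1/2) * (f y ^ 2 * G x y) := by
    intro x y
    calc |∫ z, f x * f y * SS k x y z ∂μ| ≤ ∫ z, |f x * f y * SS k x y z| ∂μ := abs_integral_le_integral_abs
      _ = |f x * f y| * G x y := by simp_rw [abs_mul (f x * f y)]; rw [integral_const_mul]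
      _ ≤ ((1/2) * f x ^ 2 + (1/2) * f y ^ 2) * G x y := by
        apply mul_le_mul_of_nonneg_right _ (nG x y)
        rw [abs_mul, ← sq_abs (f x), ← sq_abs (f y)]
        nlinarith [sq_nonneg (|f x| - |f y|)]
      _ = _ := by ring
  have j1 : Integrable (Function.uncurry fun x y => (1/2 : ℝ) * (f x ^ 2 * G x y)) (μ.prod μ) :=
    (int_bdd (g := fun p : ℝ × ℝ => f p.1 ^ 2 * G p.1 p.2) (((hf.comp measurable_fst).pow_const 2).mul mG) (fun p => abs_mul_le_of (hf2 p.1) (bG p.1 p.2))).const_mul _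
  have j2 : Integrable (Function.uncurry fun x y => (1/2 : ℝ) * (f y ^ 2 * G x y)) (μ.prod μ) :=
    (int_bdd (g := fun p : ℝ × ℝ => f p.2 ^ 2 * G p.1 p.2) (((hf.comp measurable_snd).pow_const 2).mul mG) (fun p => abs_mul_le_of (hf2 p.2) (bG p.1 p.2))).const_mul _
  have l1 : Integrable (fun x => ∫ y, (1/2 : ℝ) * (f x ^ 2 * G x y) ∂μ) μ := j1.integral_prod_left
  have l2 : Integrable (fun x => ∫ y, (1/2 : ℝ) * (f y ^ 2 * G x y) ∂μ) μ := j2.integral_prod_left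
  have p2 : ∀ x, |∫ y, ∫ z, f x * f y * SS k x y z ∂μ ∂μ| ≤
      (∫ y, (1/2 : ℝ) * (f x ^ 2 * G x y) ∂μ) + ∫ y, (1/2 : ℝ) * (f y ^ 2 * G x y) ∂μ := by
    intro x
    have a1 : Integrable (fun y => (1/2 : ℝ) * (f x ^ 2 * G x y)) μ :=
      (int_bdd (g := fun y => f x ^ 2 * G x y) ((hk_comp mG measurable_const measurable_id).const_mul _)
        (fun y => abs_mul_le_of (hf2 x) (bG x y))).const_mul _
    have a2 : Integrable (fun y => (1/2 : ℝ) * (f y ^ 2 * G x y)) μ :=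
      (int_bdd (g := fun y => f y ^ 2 * G x y) ((hf.pow_const 2).mul (hk_comp mG measurable_const measurable_id))
        (fun y => abs_mul_le_of (hf2 y) (bG x y))).const_mul _
    rw [← integral_add a1 a2]
    have := norm_integral_le_of_norm_le (a1.fun_add a2) (f := fun y => ∫ z, f x * f y * SS k x y z ∂μ)
      (Eventually.of_forall fun y => p1 x y)
    exact this
  have := norm_integral_le_of_norm_le (l1.fun_add l2) (f := fun x => ∫ y, ∫ z, f x * f y * SS k x y z ∂μ ∂μ)
      (Eventually.of_forall fun x => p2 x)
  refine this.trans (le_of_eq ?_)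
  rw [integral_add l1 l2]
  rw [integral_integral_swap j2]
  have q1 : ∀ x, ∫ y, (1/2 : ℝ) * (f x ^ 2 * G x y) ∂μ = (1/2) * (f x ^ 2 * cS μ k x) := by
    intro x; rw [integral_const_mul, integral_const_mul]; rfl
  have q2 : ∀ y, ∫ x, (1/2 : ℝ) * (f y ^ 2 * G x y) ∂μ = (1/2) * (f y ^ 2 * cS μ k y) := by
    intro y; simp_rw [← sG _ y]; exact q1 y
  simp_rw [q1, q2]
  rw [integral_const_mul]; ring

/-- weighted L2 bound -/
lemma sym_bound {μ : Measure ℝ} [IsFiniteMeasure μ] {k : ℝ → ℝ → ℝ} {B : ℝ}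
    (hk : Measurable (Function.uncurry k)) (hkb : ∀ x y, |k x y| ≤ B)
    {f : ℝ → ℝ} {F : ℝ} (hf : Measurable f) (hfb : ∀ x, |f x| ≤ F) :
    ∫ x, (TT μ k f x) ^ 2 ∂μ ≤ ∫ x, f x ^ 2 * (4 * (TT μ k (fun _ => 1) x) ^ 2 + 2 * cS μ k x) ∂μ := by
  have h1f : ∀ x : ℝ, |(fun _ : ℝ => (1:ℝ)) x| ≤ 1 := by simp
  have mT := TT_meas (μ := μ) hk hf
  have bT := TT_bdd (μ := μ) hkb hfb
  have m1 := TT_meas (μ := μ) hk (measurable_const (a := (1:ℝ)))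
  have b1 := TT_bdd (μ := μ) hkb h1f
  have hid := sym_identity (μ := μ) hk hkb hf hfb
  have hab := sym_abs (μ := μ) hk hkb hf hfb
  set P := B * F * μ.real univ
  set Q := B * 1 * μ.real univ
  set T := TT μ k f with hT
  set T1 := TT μ k (fun _ => 1) with hT1
  have mc := cS_meas (μ := μ) hk
  have bc := cS_bdd (μ := μ) hkb
  have hf2 : ∀ x, |f x ^ 2| ≤ F * F := fun x => by rw [pow_two]; exact abs_mul_le_of (hfb x) (hfb x)
  have iT : Integrable (fun x => T x ^ 2) μ := int_bdd (C := P * P) (mT.pow_const 2)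
    (fun x => by rw [pow_two]; exact abs_mul_le_of (bT x) (bT x))
  have iF : Integrable (fun x => f x ^ 2 * T1 x ^ 2) μ := int_bdd (C := F * F * (Q * Q)) ((hf.pow_const 2).mul (m1.pow_const 2))
    (fun x => by rw [pow_two (T1 x)]; exact abs_mul_le_of (hf2 x) (abs_mul_le_of (b1 x) (b1 x)))
  have ic : Integrable (fun x => f x ^ 2 * cS μ k x) μ := int_bdd ((hf.pow_const 2).mul mc)
    (fun x => abs_mul_le_of (hf2 x) (bc x))
  have iX : Integrable (fun x => f x * T x * T1 x) μ :=
    int_bdd (C := F * P * Q) ((hf.mul mT).mul m1) (fun x => abs_mul_le_of (abs_mul_le_of (hfb x) (bT x)) (b1 x))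
  have key : -(2 * ∫ x, f x * T x * T1 x ∂μ) ≤ (1/2) * (∫ x, T x ^ 2 ∂μ) + 2 * ∫ x, f x ^ 2 * T1 x ^ 2 ∂μ := by
    rw [← integral_const_mul, ← integral_const_mul, ← integral_const_mul, ← integral_neg,
      ← integral_add (iT.const_mul _) (iF.const_mul _)]
    refine integral_mono (iX.const_mul _).neg ((iT.const_mul _).add (iF.const_mul _)) fun x => ?_
    simp only [Pi.add_apply, Pi.neg_apply]
    nlinarith [sq_nonneg (T x + 2 * f x * T1 x)]
  have hr : ∫ x, f x ^ 2 * (4 * T1 x ^ 2 + 2 * cS μ k x) ∂μ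
      = 4 * (∫ x, f x ^ 2 * T1 x ^ 2 ∂μ) + 2 * ∫ x, f x ^ 2 * cS μ k x ∂μ := by
    rw [← integral_const_mul, ← integral_const_mul, ← integral_add (iF.const_mul _) (ic.const_mul _)]
    congr 1; ext x; ring
  rw [hr]
  have := (abs_le.mp hab).2
  linarith

lemma sym_one {μ : Measure ℝ} [IsFiniteMeasure μ] {k : ℝ → ℝ → ℝ} {B : ℝ}
    (hk : Measurable (Function.uncurry k)) (hkb : ∀ x y, |k x y| ≤ B) :
    ∫ x, ∫ y, ∫ z, SS k x y z ∂μ ∂μ ∂μ = 3 * ∫ x, (TT μ k (fun _ => 1) x) ^ 2 ∂μ := by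
  have := sym_identity (μ := μ) hk hkb (measurable_const (a := (1:ℝ))) (F := 1) (by simp)
  simp only [one_mul] at this
  rw [this]
  simp_rw [← pow_two]; ring

lemma sym_one_le {μ : Measure ℝ} [IsFiniteMeasure μ] {k : ℝ → ℝ → ℝ} {B : ℝ}
    (hk : Measurable (Function.uncurry k)) (hkb : ∀ x y, |k x y| ≤ B) :
    3 * ∫ x, (TT μ k (fun _ => 1) x) ^ 2 ∂μ ≤ ∫ x, cS μ k x ∂μ := by
  rw [← sym_one hk hkb]
  have := sym_abs (μ := μ) hk hkb (measurable_const (a := (1:ℝ))) (F := 1) (by simp)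
  simp only [one_mul, one_pow] at this
  exact (abs_le.mp this).2

/-- Duality: good set. -/
lemma sym_good {μ : Measure ℝ} [IsFiniteMeasure μ] {k : ℝ → ℝ → ℝ} {B : ℝ}
    (hk : Measurable (Function.uncurry k)) (hkb : ∀ x y, |k x y| ≤ B) (hanti : ∀ x y, k y x = - k x y)
    {C : ℝ} (hC : ∫ x, cS μ k x ∂μ ≤ C) {W : ℝ} (hW : 0 < W) :
    ∃ G : Set ℝ, MeasurableSet G ∧ μ.real Gᶜ ≤ 4 * C / W ∧
      ∀ (f : ℝ → ℝ) (F : ℝ), Measurable f → (∀ x, |f x| ≤ F) →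
        ∫ x in G, (TT μ k f x) ^ 2 ∂μ ≤ W * ∫ x, f x ^ 2 ∂μ := by
  have h1f : ∀ x : ℝ, |(fun _ : ℝ => (1:ℝ)) x| ≤ 1 := by simp
  have m1 := TT_meas (μ := μ) hk (measurable_const (a := (1:ℝ)))
  have b1 := TT_bdd (μ := μ) hkb h1f
  have mc := cS_meas (μ := μ) hk
  have bc := cS_bdd (μ := μ) hkb
  set w : ℝ → ℝ := fun x => 4 * (TT μ k (fun _ => 1) x) ^ 2 + 2 * cS μ k x with hw
  have mw : Measurable w := ((m1.pow_const 2).const_mul 4).add (mc.const_mul 2)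
  have nw : ∀ x, 0 ≤ w x := fun x => by have := cS_nonneg (μ := μ) (k := k) x; positivity
  have iT : Integrable (fun x => TT μ k (fun _ => 1) x ^ 2) μ := int_bdd (m1.pow_const 2)
    (fun x => by rw [pow_two]; exact abs_mul_le_of (b1 x) (b1 x))
  have ic : Integrable (cS μ k) μ := int_bdd mc bc
  have iw : Integrable w μ := (iT.const_mul 4).add (ic.const_mul 2)
  have hwC : ∫ x, w x ∂μ ≤ 4 * C := by
    have : ∫ x, w x ∂μ = 4 * (∫ x, TT μ k (fun _ => 1) x ^ 2 ∂μ) + 2 * ∫ x, cS μ k x ∂μ := by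
      rw [← integral_const_mul, ← integral_const_mul, ← integral_add (iT.const_mul 4) (ic.const_mul 2)]
    rw [this]
    have h3 := sym_one_le (μ := μ) hk hkb
    have : 0 ≤ ∫ x, cS μ k x ∂μ := integral_nonneg fun x => cS_nonneg x
    linarith
  refine ⟨{x | w x ≤ W}, mw measurableSet_Iic, ?_, ?_⟩
  · have h := mul_meas_ge_le_integral_of_nonneg (Eventually.of_forall nw) iw W
    have hs : μ.real {x | w x ≤ W}ᶜ ≤ μ.real {x | W ≤ w x} := by
      apply measureReal_mono _ (measure_ne_top _ _)
      intro x hx; simp only [mem_compl_iff, Set.mem_ofPred_eq, not_le] at hx ⊢; exact hx.le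
    rw [le_div_iff₀ hW]
    nlinarith
  · intro f F hf hfb
    set G := {x | w x ≤ W} with hGd
    have hGm : MeasurableSet G := mw measurableSet_Iic
    have mT := TT_meas (μ := μ) hk hf
    have bT := TT_bdd (μ := μ) hkb hfb
    set P := B * F * μ.real univ
    set T := TT μ k f with hT
    set h : ℝ → ℝ := G.indicator T with hh
    have mh : Measurable h := mT.indicator hGm
    have hP : 0 ≤ P := (abs_nonneg _).trans (bT 0)
    have bh : ∀ x, |h x| ≤ P := by
      intro x; by_cases hx : x ∈ G <;> simp [hh, hx, bT x, hP]
    have hN : ∫ x in G, T x ^ 2 ∂μ = ∫ x, h x ^ 2 ∂μ := by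
      rw [← integral_indicator hGm]; congr 1; ext x
      by_cases hx : x ∈ G <;> simp [hh, hx]
    have hsb := sym_bound (μ := μ) hk hkb mh bh
    have ih2 : Integrable (fun x => h x ^ 2) μ := int_bdd (mh.pow_const 2)
      (fun x => by rw [pow_two]; exact abs_mul_le_of (bh x) (bh x))
    have mTh := TT_meas (μ := μ) hk mh
    have bTh := TT_bdd (μ := μ) hkb bh
    have hTh : ∫ x, (TT μ k h x) ^ 2 ∂μ ≤ W * ∫ x, h x ^ 2 ∂μ := by
      refine hsb.trans ?_
      rw [← integral_const_mul]
      apply integral_mono_of_nonneg (Eventually.of_forall fun x => mul_nonneg (sq_nonneg _) (nw x)) (ih2.const_mul W)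
      refine Eventually.of_forall fun x => ?_
      by_cases hx : x ∈ G
      · have : w x ≤ W := hx
        have := mul_le_mul_of_nonneg_left this (sq_nonneg (h x))
        simp only; linarith
      · simp [hh, hx]
    have dual : ∫ x, h x ^ 2 ∂μ = - ∫ y, f y * TT μ k h y ∂μ := by
      have s1 : ∀ x, h x ^ 2 = ∫ y, h x * (k x y * f y) ∂μ := by
        intro x; rw [integral_const_mul]
        change h x ^ 2 = h x * T x
        by_cases hx : x ∈ G <;> simp [hh, hx, pow_two]
      simp_rw [s1]
      rw [integral_integral_swap]
      · rw [← integral_neg]; congr 1; ext y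
        unfold TT
        rw [← integral_const_mul, ← integral_neg]; congr 1; ext x
        rw [hanti x y]; ring
      · exact int_bdd (C := P * (B * F)) ((mh.comp measurable_fst).mul ((hk_comp hk measurable_fst measurable_snd).mul
          (hf.comp measurable_snd))) (fun p => abs_mul_le_of (bh p.1) (abs_mul_le_of (hkb _ _) (hfb _)))
    have if2 : Integrable (fun x => f x ^ 2) μ := int_bdd (hf.pow_const 2)
      (fun x => by rw [pow_two]; exact abs_mul_le_of (hfb x) (hfb x))
    have iTh2 : Integrable (fun x => TT μ k h x ^ 2) μ := int_bdd (mTh.pow_const 2)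
      (fun x => by rw [pow_two]; exact abs_mul_le_of (bTh x) (bTh x))
    have iX : Integrable (fun x => f x * TT μ k h x) μ := int_bdd (hf.mul mTh)
      (fun x => abs_mul_le_of (hfb x) (bTh x))
    have cs : - ∫ y, f y * TT μ k h y ∂μ ≤ (W/2) * (∫ x, f x ^ 2 ∂μ) + (1/(2*W)) * ∫ x, TT μ k h x ^ 2 ∂μ := by
      rw [← integral_const_mul, ← integral_const_mul, ← integral_neg,
        ← integral_add (if2.const_mul _) (iTh2.const_mul _)]
      refine integral_mono iX.neg ((if2.const_mul _).add (iTh2.const_mul _)) fun x => ?_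
      simp only [Pi.add_apply, Pi.neg_apply]
      have e : W / 2 * f x ^ 2 + 1 / (2 * W) * TT μ k h x ^ 2 + f x * TT μ k h x
        = 1 / (2 * W) * (W * f x + TT μ k h x) ^ 2 := by field_simp; ring
      have : 0 ≤ 1 / (2 * W) * (W * f x + TT μ k h x) ^ 2 := by positivity
      linarith
    have fin : (1/(2*W)) * ∫ x, TT μ k h x ^ 2 ∂μ ≤ (1/2) * ∫ x, h x ^ 2 ∂μ := by
      calc (1/(2*W)) * ∫ x, TT μ k h x ^ 2 ∂μ ≤ (1/(2*W)) * (W * ∫ x, h x ^ 2 ∂μ) :=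
            mul_le_mul_of_nonneg_left hTh (by positivity)
        _ = _ := by field_simp
    rw [hN]
    linarith

/-! ### Product lemma and pointwise symmetrization bounds -/

def Gd (x y z u v w k : ℝ) : Prop :=
  0 ≤ k ∧ |u| ≤ 1 ∧ |v| ≤ 1 ∧ |w| ≤ 1 ∧ |u - w| ≤ |x - z| * k ∧ |u - v| ≤ |y - z| * k ∧ |v - w| ≤ |x - y| * k ∧
    |(u - w) * (y - z) - (u - v) * (x - z)| ≤ k ^ 2 * (|x - y| * |y - z| * |x - z|)

lemma Gd_one (x y z : ℝ) : Gd x y z 1 1 1 0 := by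
  unfold Gd; simp

lemma Gd_mul {x y z u v w k u' v' w' k' : ℝ} (h : Gd x y z u v w k) (h' : Gd x y z u' v' w' k') :
    Gd x y z (u * u') (v * v') (w * w') (k + k') := by
  obtain ⟨k0, hu, hv, hw, h1, h2, h3, h4⟩ := h
  obtain ⟨k0', hu', hv', hw', h1', h2', h3', h4'⟩ := h'
  have tri : ∀ {a b a' b' d : ℝ}, 0 ≤ d → |a'| ≤ 1 → |b| ≤ 1 → |a - b| ≤ d * k → |a' - b'| ≤ d * k' →
      |a * a' - b * b'| ≤ d * (k + k') := by
    intro a b a' b' d hd ha' hb hab hab'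
    have e : a * a' - b * b' = (a - b) * a' + b * (a' - b') := by ring
    rw [e]
    have s1 := abs_mul_le_of hab ha'
    have s2 := abs_mul_le_of hb hab'
    have := abs_add_le ((a - b) * a') (b * (a' - b'))
    linarith
  refine ⟨by linarith, ?_, ?_, ?_, tri (abs_nonneg _) hu' hw h1 h1', tri (abs_nonneg _) hu' hv h2 h2',
    tri (abs_nonneg _) hv' hw h3 h3', ?_⟩
  · simpa using abs_mul_le_of hu hu'
  · simpa using abs_mul_le_of hv hv'
  · simpa using abs_mul_le_of hw hw'
  · have e : (u * u' - w * w') * (y - z) - (u * u' - v * v') * (x - z) =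
        u' * ((u - w) * (y - z) - (u - v) * (x - z)) + w * ((u' - w') * (y - z) - (u' - v') * (x - z))
        + (w - v) * (u' - v') * (x - z) := by ring
    rw [e]
    have s1 := abs_mul_le_of hu' h4
    have s2 := abs_mul_le_of hw h4'
    rw [abs_sub_comm] at h3
    have s3 := abs_mul_le_of (abs_mul_le_of h3 h2') (le_refl |x - z|)
    have := abs_add_three (u' * ((u - w) * (y - z) - (u - v) * (x - z)))
      (w * ((u' - w') * (y - z) - (u' - v') * (x - z))) ((w - v) * (u' - v') * (x - z))
    have hP : 0 ≤ |x - y| * |y - z| * |x - z| := by positivity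
    have : 0 ≤ k * k' * (|x - y| * |y - z| * |x - z|) := by positivity
    nlinarith

noncomputable def kap (A : ℝ → ℝ) (x y z : ℝ) : ℝ := ((A x - A y) / (x - y) - (A x - A z) / (x - z)) / (y - z)

lemma kap1 (A : ℝ → ℝ) {x y z : ℝ} (hxy : x ≠ y) (hxz : x ≠ z) (hyz : y ≠ z) :
    (A x - A y) / (x - y) - (A x - A z) / (x - z) = (y - z) * kap A x y z := by
  unfold kap
  have := sub_ne_zero.mpr hyz
  field_simp

lemma kap2 (A : ℝ → ℝ) {x y z : ℝ} (hxy : x ≠ y) (hxz : x ≠ z) (hyz : y ≠ z) :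
    (A x - A y) / (x - y) - (A y - A z) / (y - z) = (x - z) * kap A x y z := by
  unfold kap
  have := sub_ne_zero.mpr hyz
  have := sub_ne_zero.mpr hxy
  have := sub_ne_zero.mpr hxz
  field_simp; ring

lemma kap3 (A : ℝ → ℝ) {x y z : ℝ} (hxy : x ≠ y) (hxz : x ≠ z) (hyz : y ≠ z) :
    (A x - A z) / (x - z) - (A y - A z) / (y - z) = (x - y) * kap A x y z := by
  unfold kap
  have := sub_ne_zero.mpr hyz
  have := sub_ne_zero.mpr hxy
  have := sub_ne_zero.mpr hxz
  field_simp; ring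

def Lip1 (M : ℝ) (A : ℝ → ℝ) : Prop := ∀ x y, |A x - A y| ≤ M * |x - y|

lemma slope_le {M : ℝ} (hM : 0 ≤ M) {A : ℝ → ℝ} (hA : Lip1 M A) (x y : ℝ) : |(A x - A y) / (x - y)| ≤ M := by
  rw [abs_div]; exact div_le_of_le_mul₀ (abs_nonneg _) hM (hA x y)

lemma Gd_single {A : ℝ → ℝ} (hA : Lip1 1 A) {x y z : ℝ} (hxy : x ≠ y) (hxz : x ≠ z) (hyz : y ≠ z) :
    Gd x y z ((A x - A y) / (x - y)) ((A x - A z) / (x - z)) ((A y - A z) / (y - z)) |kap A x y z| := by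
  refine ⟨abs_nonneg _, slope_le zero_le_one hA _ _, slope_le zero_le_one hA _ _, slope_le zero_le_one hA _ _, ?_, ?_, ?_, ?_⟩
  · rw [kap2 A hxy hxz hyz, abs_mul]
  · rw [kap1 A hxy hxz hyz, abs_mul]
  · rw [kap3 A hxy hxz hyz, abs_mul]
  · rw [kap1 A hxy hxz hyz, kap2 A hxy hxz hyz]
    have : (x - z) * kap A x y z * (y - z) - (y - z) * kap A x y z * (x - z) = 0 := by ring
    rw [this]; simp only [abs_zero]; positivity

lemma Gd_prod {ι : Type*} (s : Finset ι) {A : ι → ℝ → ℝ} (hA : ∀ j, Lip1 1 (A j)) {x y z : ℝ}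
    (hxy : x ≠ y) (hxz : x ≠ z) (hyz : y ≠ z) :
    Gd x y z (∏ j ∈ s, (A j x - A j y) / (x - y)) (∏ j ∈ s, (A j x - A j z) / (x - z))
      (∏ j ∈ s, (A j y - A j z) / (y - z)) (∑ j ∈ s, |kap (A j) x y z|) := by
  classical
  induction s using Finset.induction_on with
  | empty => simpa using Gd_one x y z
  | insert a s ha ih =>
    rw [Finset.prod_insert ha, Finset.prod_insert ha, Finset.prod_insert ha, Finset.sum_insert ha]
    exact Gd_mul (Gd_single (hA a) hxy hxz hyz) ih

lemma sym_alg {x y z u v w : ℝ} (hxy : x ≠ y) (hxz : x ≠ z) (hyz : y ≠ z) :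
    u / (x - y) * (v / (x - z)) + u / (y - x) * (w / (y - z)) + v / (z - x) * (w / (z - y))
     = ((v - w) * (u - w) * (y - z) + w * ((u - w) * (y - z) - (u - v) * (x - z))) / ((x - y) * (x - z) * (y - z)) := by
  have := sub_ne_zero.mpr hyz
  have := sub_ne_zero.mpr hxy
  have := sub_ne_zero.mpr hxz
  rw [← neg_sub x y, ← neg_sub x z, ← neg_sub y z]
  field_simp; ring

lemma sym_Gd_le {x y z u v w k : ℝ} (hxy : x ≠ y) (hxz : x ≠ z) (hyz : y ≠ z) (h : Gd x y z u v w k) :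
    |u / (x - y) * (v / (x - z)) + u / (y - x) * (w / (y - z)) + v / (z - x) * (w / (z - y))| ≤ 2 * k ^ 2 := by
  rw [sym_alg hxy hxz hyz, abs_div]
  have h1 := abs_pos.mpr (sub_ne_zero.mpr hyz)
  have h2 := abs_pos.mpr (sub_ne_zero.mpr hxy)
  have h3 := abs_pos.mpr (sub_ne_zero.mpr hxz)
  obtain ⟨k0, hu, hv, hw, g1, g2, g3, g4⟩ := h
  rw [abs_mul, abs_mul, div_le_iff₀ (by positivity)]
  have s1 := abs_mul_le_of (abs_mul_le_of g3 g1) (le_refl |y - z|)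
  have s2 := abs_mul_le_of hw g4
  have := abs_add_le ((v - w) * (u - w) * (y - z)) (w * ((u - w) * (y - z) - (u - v) * (x - z)))
  nlinarith

/-- core kernel (product of slopes over x - y), truncated -/
noncomputable def kE (ε : ℝ) {n : ℕ} (A : Fin n → ℝ → ℝ) (x y : ℝ) : ℝ :=
  if ε < |x - y| then (∏ j, (A j x - A j y) / (x - y)) / (x - y) else 0

noncomputable def nnE (ε x y : ℝ) : ℝ := if ε < |x - y| then 1 / (x - y) ^ 2 else 0
noncomputable def ccE (ε x y : ℝ) : ℝ := if |x - y| ≤ ε then 1 else 0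
noncomputable def eE (ε x y z : ℝ) : ℝ := 2 * (ccE ε y z * nnE ε x y + ccE ε x z * nnE ε x y + ccE ε x y * nnE ε x z)
noncomputable def KKE (ε : ℝ) (A : ℝ → ℝ) (x y z : ℝ) : ℝ :=
  if ε < |x - y| ∧ ε < |x - z| ∧ ε < |y - z| then kap A x y z ^ 2 else 0

lemma nnE_nonneg (ε x y : ℝ) : 0 ≤ nnE ε x y := by unfold nnE; split_ifs <;> positivity
lemma ccE_nonneg (ε x y : ℝ) : 0 ≤ ccE ε x y := by unfold ccE; split_ifs <;> norm_num
lemma eE_nonneg (ε x y z : ℝ) : 0 ≤ eE ε x y z := by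
  have := nnE_nonneg ε x y; have := nnE_nonneg ε x z
  have := ccE_nonneg ε x y; have := ccE_nonneg ε x z; have := ccE_nonneg ε y z
  unfold eE; positivity
lemma KKE_nonneg (ε : ℝ) (A : ℝ → ℝ) (x y z : ℝ) : 0 ≤ KKE ε A x y z := by unfold KKE; split_ifs <;> positivity

lemma kE_anti (ε : ℝ) {n : ℕ} (A : Fin n → ℝ → ℝ) (x y : ℝ) : kE ε A y x = - kE ε A x y := by
  unfold kE
  rw [abs_sub_comm y x]
  have : ∀ j, (A j y - A j x) / (y - x) = (A j x - A j y) / (x - y) := fun j => by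
    rw [← neg_sub (A j x), ← neg_sub x, neg_div_neg_eq]
  simp_rw [this]
  split_ifs
  · rw [← neg_sub x y, div_neg]
  · simp

lemma prod_slope_le {n : ℕ} {A : Fin n → ℝ → ℝ} (hA : ∀ j, Lip1 1 (A j)) (x y : ℝ) :
    |∏ j, (A j x - A j y) / (x - y)| ≤ 1 := by
  rw [Finset.abs_prod]
  exact Finset.prod_le_one (fun _ _ => abs_nonneg _) fun j _ => slope_le zero_le_one (hA j) x y

lemma kE_bdd {ε : ℝ} (hε : 0 < ε) {n : ℕ} {A : Fin n → ℝ → ℝ} (hA : ∀ j, Lip1 1 (A j)) (x y : ℝ) :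
    |kE ε A x y| ≤ 1 / ε := by
  unfold kE
  split_ifs with h
  · rw [abs_div]
    exact div_le_div₀ zero_le_one (prod_slope_le hA x y) hε h.le
  · simp [hε.le]

lemma kE_le {ε : ℝ} (hε : 0 < ε) {n : ℕ} {A : Fin n → ℝ → ℝ} (hA : ∀ j, Lip1 1 (A j)) {x y : ℝ}
    (h : ε < |x - y|) : |kE ε A x y| ≤ 1 / |x - y| := by
  unfold kE
  rw [if_pos h, abs_div]
  exact div_le_div₀ zero_le_one (prod_slope_le hA x y) (hε.trans h) le_rfl

/-- product of two kernel values when the two far endpoints are close -/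
lemma kE_close {ε : ℝ} (hε : 0 < ε) {n : ℕ} {A : Fin n → ℝ → ℝ} (hA : ∀ j, Lip1 1 (A j)) {x y z : ℝ}
    (h : |y - z| ≤ ε) : |kE ε A x y * kE ε A x z| ≤ 2 * nnE ε x y := by
  by_cases h1 : ε < |x - y|
  · by_cases h2 : ε < |x - z|
    · rw [abs_mul]
      have a1 := kE_le hε hA h1
      have a2 := kE_le hε hA h2
      have hp : 0 < |x - y| := hε.trans h1
      have hp2 : 0 < |x - z| := hε.trans h2
      have hle : |x - y| ≤ 2 * |x - z| := by
        have := abs_add_le (x - z) (z - y)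
        rw [show x - z + (z - y) = x - y by ring, abs_sub_comm z y] at this
        linarith
      calc |kE ε A x y| * |kE ε A x z| ≤ 1 / |x - y| * (1 / |x - z|) :=
            mul_le_mul a1 a2 (abs_nonneg _) (by positivity)
        _ ≤ 1 / |x - y| * (2 / |x - y|) := by
            apply mul_le_mul_of_nonneg_left _ (by positivity)
            rw [div_le_div_iff₀ hp2 hp]; linarith
        _ = 2 * nnE ε x y := by
            unfold nnE; rw [if_pos h1, ← sq_abs (x - y)]; field_simp
    · have : kE ε A x z = 0 := by unfold kE; rw [if_neg h2]
      rw [this]; simp only [mul_zero, abs_zero]; have := nnE_nonneg ε x y; positivity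
  · have : kE ε A x y = 0 := by unfold kE; rw [if_neg h1]
    rw [this]; simp only [zero_mul, abs_zero]; have := nnE_nonneg ε x y; positivity

lemma SS_close {ε : ℝ} (hε : 0 < ε) {n : ℕ} {A : Fin n → ℝ → ℝ} (hA : ∀ j, Lip1 1 (A j)) {x y z : ℝ}
    (h : ¬ (ε < |x - y| ∧ ε < |x - z| ∧ ε < |y - z|)) : |SS (kE ε A) x y z| ≤ eE ε x y z := by
  have kz : ∀ {u v}, ¬ (ε < |u - v|) → kE ε A u v = 0 := fun h => by unfold kE; rw [if_neg h]
  have kz' : ∀ {u v}, ¬ (ε < |u - v|) → kE ε A v u = 0 := fun h => by rw [kE_anti, kz h, neg_zero]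
  have n1 := nnE_nonneg ε x y; have n2 := nnE_nonneg ε x z
  have c1 := ccE_nonneg ε x y; have c2 := ccE_nonneg ε x z; have c3 := ccE_nonneg ε y z
  have nsymm : nnE ε y x = nnE ε x y := by unfold nnE; rw [abs_sub_comm, ← neg_sub x y, neg_sq]
  have nsymm2 : nnE ε z x = nnE ε x z := by unfold nnE; rw [abs_sub_comm, ← neg_sub x z, neg_sq]
  by_cases hyz : ε < |y - z|
  · by_cases hxz : ε < |x - z|
    · have hxy : ¬ (ε < |x - y|) := fun h' => h ⟨h', hxz, hyz⟩
      have e : SS (kE ε A) x y z = kE ε A z x * kE ε A z y := by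
        unfold SS; rw [kz hxy, kz' hxy]; ring
      rw [e]
      have := kE_close hε hA (x := z) (y := x) (z := y) (not_lt.mp hxy)
      rw [nsymm2] at this
      have cc1 : ccE ε x y = 1 := by unfold ccE; rw [if_pos (not_lt.mp hxy)]
      unfold eE; rw [cc1]; nlinarith [mul_nonneg c3 n1, mul_nonneg c2 n1]
    · have e : SS (kE ε A) x y z = kE ε A y x * kE ε A y z := by
        unfold SS; rw [kz hxz, kz' hxz]; ring
      rw [e]
      have := kE_close hε hA (x := y) (y := x) (z := z) (not_lt.mp hxz)
      rw [nsymm] at this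
      have cc1 : ccE ε x z = 1 := by unfold ccE; rw [if_pos (not_lt.mp hxz)]
      unfold eE; rw [cc1]; nlinarith [mul_nonneg c3 n1, mul_nonneg c1 n2]
  · have e : SS (kE ε A) x y z = kE ε A x y * kE ε A x z := by
      unfold SS; rw [kz hyz, kz' hyz]; ring
    rw [e]
    have := kE_close hε hA (x := x) (y := y) (z := z) (not_lt.mp hyz)
    have cc1 : ccE ε y z = 1 := by unfold ccE; rw [if_pos (not_lt.mp hyz)]
    unfold eE; rw [cc1]; nlinarith [mul_nonneg c2 n1, mul_nonneg c1 n2]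

lemma SS_far_eq {ε : ℝ} {n : ℕ} {A : Fin n → ℝ → ℝ} {x y z : ℝ}
    (h : ε < |x - y| ∧ ε < |x - z| ∧ ε < |y - z|) : SS (kE ε A) x y z =
      (∏ j, (A j x - A j y) / (x - y)) / (x - y) * ((∏ j, (A j x - A j z) / (x - z)) / (x - z)) +
      (∏ j, (A j x - A j y) / (x - y)) / (y - x) * ((∏ j, (A j y - A j z) / (y - z)) / (y - z)) +
      (∏ j, (A j x - A j z) / (x - z)) / (z - x) * ((∏ j, (A j y - A j z) / (y - z)) / (z - y)) := by
  unfold SS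
  rw [kE_anti ε A x y, kE_anti ε A x z, kE_anti ε A y z]
  unfold kE
  rw [if_pos h.1, if_pos h.2.1, if_pos h.2.2, ← neg_sub x y, ← neg_sub x z, ← neg_sub y z, div_neg, div_neg, div_neg]

lemma SS_le {ε : ℝ} (hε : 0 < ε) {n : ℕ} {A : Fin n → ℝ → ℝ} (hA : ∀ j, Lip1 1 (A j)) (x y z : ℝ) :
    |SS (kE ε A) x y z| ≤ 2 * n * (∑ j, KKE ε (A j) x y z) + eE ε x y z := by
  by_cases h : ε < |x - y| ∧ ε < |x - z| ∧ ε < |y - z|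
  · have ne : ∀ {u v : ℝ}, ε < |u - v| → u ≠ v := fun h e => by rw [e] at h; simp at h; linarith
    rw [SS_far_eq h]
    have := sym_Gd_le (ne h.1) (ne h.2.1) (ne h.2.2) (Gd_prod Finset.univ hA (ne h.1) (ne h.2.1) (ne h.2.2))
    refine this.trans ?_
    have hs : (∑ j, |kap (A j) x y z|) ^ 2 ≤ n * ∑ j, |kap (A j) x y z| ^ 2 := by
      simpa using sq_sum_le_card_mul_sum_sq (s := Finset.univ) (f := fun j => |kap (A j) x y z|)
    have hk : ∀ j, KKE ε (A j) x y z = |kap (A j) x y z| ^ 2 := fun j => by unfold KKE; rw [if_pos h, sq_abs]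
    simp_rw [hk]
    have := eE_nonneg ε x y z
    linarith
  · have := SS_close hε hA h
    have : 0 ≤ ∑ j, KKE ε (A j) x y z := Finset.sum_nonneg fun j _ => KKE_nonneg _ _ _ _ _
    have : 0 ≤ 2 * n * ∑ j, KKE ε (A j) x y z := by positivity
    linarith

lemma KKE_le_SS {ε : ℝ} (hε : 0 < ε) {A : ℝ → ℝ} (hA : Lip1 1 A) (x y z : ℝ) :
    KKE ε A x y z ≤ SS (kE ε (fun _ : Fin 1 => A)) x y z + eE ε x y z := by
  by_cases h : ε < |x - y| ∧ ε < |x - z| ∧ ε < |y - z|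
  · have ne : ∀ {u v : ℝ}, ε < |u - v| → u ≠ v := fun h e => by rw [e] at h; simp at h; linarith
    have hxy := ne h.1
    have hxz := ne h.2.1
    have hyz := ne h.2.2
    rw [SS_far_eq h]
    have e0 := eE_nonneg ε x y z
    simp only [Finset.univ_unique, Finset.prod_singleton]
    rw [sym_alg hxy hxz hyz, kap1 A hxy hxz hyz, kap2 A hxy hxz hyz, kap3 A hxy hxz hyz]
    unfold KKE; rw [if_pos h]
    have := sub_ne_zero.mpr hyz
    have := sub_ne_zero.mpr hxy
    have := sub_ne_zero.mpr hxz
    have e1 : ((x - y) * kap A x y z * ((x - z) * kap A x y z) * (y - z) + (A y - A z) / (y - z) *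
      ((x - z) * kap A x y z * (y - z) - (y - z) * kap A x y z * (x - z))) / ((x - y) * (x - z) * (y - z))
       = kap A x y z ^ 2 := by
      have e2 : (x - z) * kap A x y z * (y - z) - (y - z) * kap A x y z * (x - z) = 0 := by ring
      rw [e2]; field_simp; ring
    rw [e1]; linarith
  · have := SS_close hε (A := fun _ : Fin 1 => A) (fun _ => hA) h
    unfold KKE; rw [if_neg h]
    have := (abs_le.mp this).1
    linarith

/-! ### Integral bounds for the symmetrization -/

lemma nnE_lint {ε : ℝ} (hε : 0 < ε) (x : ℝ) : ∫⁻ y, ENNReal.ofReal (nnE ε x y) ≤ ENNReal.ofReal (2 / ε) := by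
  set g : ℝ → ℝ≥0∞ := (Ioi ε).indicator fun t => ENNReal.ofReal (t ^ (-2 : ℝ)) with hg
  have hgm : Measurable g := by
    apply Measurable.indicator _ measurableSet_Ioi
    exact (measurable_id.pow_const _).ennreal_ofReal
  have h1 : ∀ y, ENNReal.ofReal (nnE ε x y) ≤ g (x - y) + g (-(x - y)) := by
    intro y
    unfold nnE
    split_ifs with h
    · rcases le_or_gt 0 (x - y) with h0 | h0
      · rw [abs_of_nonneg h0] at h
        have : g (x - y) = ENNReal.ofReal (1 / (x - y) ^ 2) := by
          simp only [hg]; rw [indicator_of_mem (mem_Ioi.mpr h), Real.rpow_neg h0]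
          norm_num
        rw [this]; exact le_self_add
      · rw [abs_of_neg h0] at h
        have : g (-(x - y)) = ENNReal.ofReal (1 / (x - y) ^ 2) := by
          simp only [hg]; rw [indicator_of_mem (mem_Ioi.mpr h), Real.rpow_neg (by linarith)]
          rw [Real.rpow_two, neg_sq, one_div]
        rw [this]; exact le_add_self
    · simp
  have h2 : ∫⁻ t, g t = ENNReal.ofReal (1 / ε) := by
    simp only [hg]
    rw [lintegral_indicator measurableSet_Ioi, ← ofReal_integral_eq_lintegral_ofReal
      (integrableOn_Ioi_rpow_of_lt (by norm_num) hε), integral_Ioi_rpow_of_lt (by norm_num) hε]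
    · congr 1; norm_num; rw [Real.rpow_neg_one]
    · refine (ae_restrict_iff' measurableSet_Ioi).mpr (Eventually.of_forall fun t ht => ?_)
      have : 0 < t := hε.trans ht
      exact Real.rpow_nonneg this.le _
  calc ∫⁻ y, ENNReal.ofReal (nnE ε x y) ≤ ∫⁻ y, (g (x - y) + g (-(x - y))) := lintegral_mono h1
    _ = (∫⁻ y, g (x - y)) + ∫⁻ y, g (-(x - y)) := lintegral_add_left (hgm.comp (measurable_const.sub measurable_id)) _
    _ = ENNReal.ofReal (1 / ε) + ENNReal.ofReal (1 / ε) := by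
      rw [lintegral_sub_left_eq_self g x, lintegral_sub_left_eq_self (fun t => g (-t)) x, lintegral_neg_eq_self g, h2]
    _ = ENNReal.ofReal (2 / ε) := by
      rw [← ENNReal.ofReal_add (by positivity) (by positivity)]; congr 1; ring

lemma dist_meas_set (ε : ℝ) : MeasurableSet {p : ℝ × ℝ | ε < |p.1 - p.2|} :=
  measurableSet_lt measurable_const (measurable_fst.sub measurable_snd).abs

lemma nnE_meas (ε : ℝ) : Measurable (Function.uncurry (nnE ε)) :=
  Measurable.ite (dist_meas_set ε) (measurable_const.div ((measurable_fst.sub measurable_snd).pow_const 2)) measurable_const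

lemma ccE_meas (ε : ℝ) : Measurable (Function.uncurry (ccE ε)) :=
  Measurable.ite (measurableSet_le (measurable_fst.sub measurable_snd).abs measurable_const) measurable_const measurable_const

lemma nnE_bdd {ε : ℝ} (hε : 0 < ε) (x y : ℝ) : |nnE ε x y| ≤ 1 / ε ^ 2 := by
  unfold nnE; split_ifs with h
  · rw [← sq_abs (x - y), abs_of_nonneg (by positivity)]
    apply div_le_div_of_nonneg_left zero_le_one (by positivity)
    exact pow_le_pow_left₀ hε.le h.le 2
  · simp; positivity

lemma ccE_bdd (ε x y : ℝ) : |ccE ε x y| ≤ 1 := by unfold ccE; split_ifs <;> simp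

lemma nnE_int {ε : ℝ} (hε : 0 < ε) (x : ℝ) (s : Set ℝ) : ∫ y in s, nnE ε x y ≤ 2 / ε := by
  rw [integral_eq_lintegral_of_nonneg_ae (Eventually.of_forall fun y => nnE_nonneg ε x y)
    (hk_comp (nnE_meas ε) measurable_const measurable_id).aestronglyMeasurable]
  apply ENNReal.toReal_le_of_le_ofReal (by positivity)
  exact (lintegral_mono' Measure.restrict_le_self le_rfl).trans (nnE_lint hε x)

lemma ccE_int {ε : ℝ} (hε : 0 < ε) (x : ℝ) (s : Set ℝ) : ∫ y in s, ccE ε x y ≤ 2 * ε := by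
  rw [integral_eq_lintegral_of_nonneg_ae (Eventually.of_forall fun y => ccE_nonneg ε x y)
    (hk_comp (ccE_meas ε) measurable_const measurable_id).aestronglyMeasurable]
  apply ENNReal.toReal_le_of_le_ofReal (by positivity)
  calc ∫⁻ y in s, ENNReal.ofReal (ccE ε x y) ≤ ∫⁻ y, ENNReal.ofReal (ccE ε x y) :=
        lintegral_mono' Measure.restrict_le_self le_rfl
    _ ≤ ∫⁻ y, (Icc (x - ε) (x + ε)).indicator (fun _ => 1) y := by
      apply lintegral_mono; intro y
      simp only [ccE]
      split_ifs with h
      · rw [abs_le] at h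
        rw [indicator_of_mem (by constructor <;> linarith [h.1, h.2])]; simp
      · simp
    _ = ENNReal.ofReal (2 * ε) := by
      rw [lintegral_indicator measurableSet_Icc, setLIntegral_one, Real.volume_Icc]; congr 1; ring

lemma eE_meas3 {α : Type*} [MeasurableSpace α] (ε : ℝ) {u v w : α → ℝ} (hu : Measurable u) (hv : Measurable v)
    (hw : Measurable w) : Measurable fun a => eE ε (u a) (v a) (w a) := by
  unfold eE
  exact ((((hk_comp (ccE_meas ε) hv hw).mul (hk_comp (nnE_meas ε) hu hv)).add
    ((hk_comp (ccE_meas ε) hu hw).mul (hk_comp (nnE_meas ε) hu hv))).add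
    ((hk_comp (ccE_meas ε) hu hv).mul (hk_comp (nnE_meas ε) hu hw))).const_mul 2

lemma eE_bdd {ε : ℝ} (hε : 0 < ε) (x y z : ℝ) : |eE ε x y z| ≤ 6 / ε ^ 2 := by
  unfold eE
  rw [abs_mul, abs_two]
  have h1 := abs_mul_le_of (ccE_bdd ε y z) (nnE_bdd hε x y)
  have h2 := abs_mul_le_of (ccE_bdd ε x z) (nnE_bdd hε x y)
  have h3 := abs_mul_le_of (ccE_bdd ε x y) (nnE_bdd hε x z)
  have := abs_add_three (ccE ε y z * nnE ε x y) (ccE ε x z * nnE ε x y) (ccE ε x y * nnE ε x z)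
  have e : 6 / ε ^ 2 = 2 * (1 * (1 / ε ^ 2) + 1 * (1 / ε ^ 2) + 1 * (1 / ε ^ 2)) := by ring
  rw [e]; linarith

lemma eE_dbl {s : Set ℝ} [hs : IsFiniteMeasure (volume.restrict s)] {ε : ℝ} (hε : 0 < ε) (x : ℝ) :
    ∫ y in s, ∫ z in s, eE ε x y z ≤ 24 := by
  have hcm : ∀ u : ℝ, Measurable (ccE ε u) := fun u => hk_comp (ccE_meas ε) measurable_const measurable_id
  have hnm : ∀ u : ℝ, Measurable (nnE ε u) := fun u => hk_comp (nnE_meas ε) measurable_const measurable_id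
  have ic : ∀ u : ℝ, Integrable (ccE ε u) (volume.restrict s) := fun u => int_bdd (hcm u) (ccE_bdd ε u)
  have inn : ∀ u : ℝ, Integrable (nnE ε u) (volume.restrict s) := fun u => int_bdd (hnm u) (nnE_bdd hε u)
  have h1 : ∀ y, ∫ z in s, eE ε x y z ≤ 8 * ε * nnE ε x y + (4 / ε) * ccE ε x y := by
    intro y
    have e : ∀ z, eE ε x y z = 2 * nnE ε x y * ccE ε y z + (2 * nnE ε x y * ccE ε x z + 2 * ccE ε x y * nnE ε x z) := by
      intro z; unfold eE; ring
    simp_rw [e]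
    rw [integral_add ((ic y).const_mul _) (((ic x).const_mul _).fun_add ((inn x).const_mul _)),
      integral_add ((ic x).const_mul _) ((inn x).const_mul _), integral_const_mul, integral_const_mul, integral_const_mul]
    have n := nnE_nonneg ε x y
    have c := ccE_nonneg ε x y
    have a1 := mul_le_mul_of_nonneg_left (ccE_int hε y s) n
    have a2 := mul_le_mul_of_nonneg_left (ccE_int hε x s) n
    have a3 := mul_le_mul_of_nonneg_left (nnE_int hε x s) c
    have : ccE ε x y * (2 / ε) = (4 / ε) * ccE ε x y / 2 := by ring
    nlinarith
  calc ∫ y in s, ∫ z in s, eE ε x y z ≤ ∫ y in s, (8 * ε * nnE ε x y + (4 / ε) * ccE ε x y) := by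
        apply integral_mono_of_nonneg (Eventually.of_forall fun y => integral_nonneg fun z => eE_nonneg _ _ _ _)
          (((inn x).const_mul _).add ((ic x).const_mul _)) (Eventually.of_forall h1)
    _ = 8 * ε * (∫ y in s, nnE ε x y) + (4 / ε) * ∫ y in s, ccE ε x y := by
      rw [integral_add ((inn x).const_mul _) ((ic x).const_mul _), integral_const_mul, integral_const_mul]
    _ ≤ 8 * ε * (2 / ε) + (4 / ε) * (2 * ε) := by
      have := nnE_int hε x s
      have := ccE_int hε x s
      gcongr
    _ = 24 := by field_simp; norm_num

lemma Lip1.cont {M : ℝ} {A : ℝ → ℝ} (hA : Lip1 M A) : Continuous A := by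
  have : LipschitzWith (Real.toNNReal M) A := LipschitzWith.of_dist_le_mul fun x y => by
    rw [Real.dist_eq, Real.dist_eq]
    exact (hA x y).trans (mul_le_mul_of_nonneg_right (Real.le_coe_toNNReal M) (abs_nonneg _))
  exact this.continuous

lemma Lip1.lip {M : ℝ} {A : ℝ → ℝ} (hA : Lip1 M A) : LipschitzWith (Real.toNNReal M) A :=
  LipschitzWith.of_dist_le_mul fun x y => by
    rw [Real.dist_eq, Real.dist_eq]
    exact (hA x y).trans (mul_le_mul_of_nonneg_right (Real.le_coe_toNNReal M) (abs_nonneg _))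

lemma Lip1.ac {M : ℝ} {A : ℝ → ℝ} (hA : Lip1 M A) (u v : ℝ) : AbsolutelyContinuousOnInterval A u v :=
  hA.lip.lipschitzOnWith.absolutelyContinuousOnInterval

lemma Lip1.deriv_le {M : ℝ} (hM : 0 ≤ M) {A : ℝ → ℝ} (hA : Lip1 M A) (x : ℝ) : |deriv A x| ≤ M := by
  have := norm_deriv_le_of_lipschitz (x₀ := x) hA.lip
  rwa [Real.norm_eq_abs, Real.coe_toNNReal _ hM] at this

lemma kE_meas (ε : ℝ) {n : ℕ} {A : Fin n → ℝ → ℝ} (hA : ∀ j, Measurable (A j)) : Measurable (Function.uncurry (kE ε A)) := by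
  refine Measurable.ite (dist_meas_set ε) (Measurable.div ?_ (measurable_fst.sub measurable_snd)) measurable_const
  exact Finset.measurable_prod _ fun j _ => (((hA j).comp measurable_fst).sub ((hA j).comp measurable_snd)).div
    (measurable_fst.sub measurable_snd)

/-- Hilbert transform of the indicator of a large interval, at the middle. -/
lemma H_one {ε c r x : ℝ} (hε : 0 < ε) (hr : 0 < r) (hx : |x - c| ≤ r) (A : Fin 0 → ℝ → ℝ) :
    |TT (volume.restrict (Icc (c - 3 * r) (c + 3 * r))) (kE ε A) (fun _ => 1) x| ≤ 1 := by
  unfold TT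
  simp only [mul_one]
  have hA : ∀ j, Lip1 1 (A j) := fun j => j.elim0
  have hm : Measurable fun y => kE ε A x y := hk_comp (kE_meas ε fun j => j.elim0) measurable_const measurable_id
  obtain ⟨h1, h2⟩ := abs_le.mp hx
  have hsub : Ioc (x - 2 * r) (x + 2 * r) ⊆ Icc (c - 3 * r) (c + 3 * r) := fun y hy => by
    constructor <;> linarith [hy.1, hy.2]
  have hi : ∀ s : Set ℝ, volume s ≠ ∞ → IntegrableOn (fun y => kE ε A x y) s := fun s h => by
    haveI : IsFiniteMeasure (volume.restrict s) := ⟨by simpa using h.lt_top⟩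
    exact int_bdd hm (kE_bdd hε hA x)
  rw [← integral_inter_add_sdiff (s := Icc (c - 3 * r) (c + 3 * r)) (t := Ioc (x - 2 * r) (x + 2 * r))
    measurableSet_Ioc (hi _ (by simp))]
  rw [inter_eq_self_of_subset_right hsub]
  have z : ∫ y in Ioc (x - 2 * r) (x + 2 * r), kE ε A x y = 0 := by
    rw [← intervalIntegral.integral_of_le (by linarith)]
    have := intervalIntegral.integral_comp_sub_left (a := x - 2 * r) (b := x + 2 * r) (fun y => kE ε A x y) (2 * x)
    rw [show 2 * x - (x + 2 * r) = x - 2 * r by ring, show 2 * x - (x - 2 * r) = x + 2 * r by ring] at this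
    have e : ∀ y, kE ε A x (2 * x - y) = - kE ε A x y := by
      intro y; unfold kE
      rw [show x - (2 * x - y) = - (x - y) by ring, abs_neg]
      split_ifs
      · simp only [Finset.univ_eq_empty, Finset.prod_empty, div_neg]
      · simp
    simp_rw [e] at this
    rw [intervalIntegral.integral_neg] at this
    linarith
  rw [z, zero_add]
  have hle : ∀ y ∈ Icc (c - 3 * r) (c + 3 * r) \ Ioc (x - 2 * r) (x + 2 * r), ‖kE ε A x y‖ ≤ 1 / (2 * r) := by
    intro y hy
    have hd : 2 * r ≤ |x - y| := by
      by_contra hlt; rw [not_le, abs_lt] at hlt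
      exact hy.2 ⟨by linarith [hlt.2], by linarith [hlt.1]⟩
    rw [Real.norm_eq_abs]
    by_cases h : ε < |x - y|
    · exact (kE_le hε hA h).trans (div_le_div_of_nonneg_left zero_le_one (by positivity) hd)
    · unfold kE; rw [if_neg h]; simp; positivity
  have := norm_setIntegral_le_of_norm_le_const (C := 1 / (2 * r))
    (lt_of_le_of_lt (measure_mono sdiff_subset) (by simp) : volume (Icc (c - 3 * r) (c + 3 * r) \ Ioc (x - 2 * r) (x + 2 * r)) < ∞)
    hle
  refine this.trans ?_
  rw [measureReal_sdiff hsub measurableSet_Ioc (by simp)]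
  rw [Real.volume_real_Icc_of_le (by linarith), Real.volume_real_Ioc_of_le (by linarith)]
  rw [div_mul_eq_mul_div, div_le_one (by positivity)]
  linarith

/-! ### Local L² bound for Lipschitz commutators -/

lemma dbl_mono {μ : Measure ℝ} [IsFiniteMeasure μ] {p q : ℝ → ℝ → ℝ} {C : ℝ} (h0 : ∀ y z, 0 ≤ p y z)
    (hle : ∀ y z, p y z ≤ q y z) (hq : Measurable (Function.uncurry q)) (hqb : ∀ y z, |q y z| ≤ C) :
    ∫ y, ∫ z, p y z ∂μ ∂μ ≤ ∫ y, ∫ z, q y z ∂μ ∂μ := by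
  have h1 : ∀ y, ∫ z, p y z ∂μ ≤ ∫ z, q y z ∂μ := fun y =>
    integral_mono_of_nonneg (Eventually.of_forall (h0 y)) (int_bdd (hk_comp hq measurable_const measurable_id) (hqb y))
      (Eventually.of_forall (hle y))
  refine integral_mono_of_nonneg (Eventually.of_forall fun y => integral_nonneg (h0 y)) ?_ (Eventually.of_forall h1)
  refine int_bdd (C := C * μ.real univ) hq.stronglyMeasurable.integral_prod_right.measurable fun y => ?_
  exact norm_integral_le_of_norm_le_const (f := fun z => q y z) (Eventually.of_forall fun z => hqb y z)

lemma trunc_split {ε u v x : ℝ} (hε : 0 < ε) (hu : u ≤ x) (hv : x ≤ v) (g : ℝ → ℝ)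
    (hg : IntegrableOn g (Icc u v ∩ {y | ε < |x - y|})) :
    ∫ y in Icc u v, (if ε < |x - y| then g y else 0) =
      (∫ y in u..max u (x - ε), g y) + ∫ y in (min v (x + ε))..v, g y := by
  have hms : MeasurableSet {y : ℝ | ε < |x - y|} := measurableSet_lt measurable_const (measurable_const.sub measurable_id).abs
  have e1 : (fun y => if ε < |x - y| then g y else 0) = {y : ℝ | ε < |x - y|}.indicator g := by
    ext y; simp [indicator]
  rw [e1, setIntegral_indicator hms]
  have e2 : Icc u v ∩ {y : ℝ | ε < |x - y|} = Ico u (max u (x - ε)) ∪ Ioc (min v (x + ε)) v := by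
    ext y
    simp only [mem_inter_iff, mem_Icc, mem_setOf_eq, mem_union, mem_Ico, mem_Ioc, lt_max_iff, min_lt_iff, lt_abs]
    constructor
    · rintro ⟨⟨h1, h2⟩, h | h⟩
      · left; exact ⟨h1, Or.inr (by linarith)⟩
      · right; exact ⟨Or.inr (by linarith), h2⟩
    · rintro (⟨h1, h | h⟩ | ⟨h | h, h1⟩)
      · linarith
      · exact ⟨⟨h1, by linarith⟩, Or.inl (by linarith)⟩
      · linarith
      · exact ⟨⟨by linarith, h1⟩, Or.inr (by linarith)⟩
  rw [e2] at hg ⊢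
  have hd : Disjoint (Ico u (max u (x - ε))) (Ioc (min v (x + ε)) v) := by
    rw [Set.disjoint_left]; rintro y ⟨h1, h2⟩ ⟨h3, h4⟩
    rw [lt_max_iff] at h2; rw [min_lt_iff] at h3
    rcases h2 with h2 | h2 <;> rcases h3 with h3 | h3 <;> linarith
  rw [setIntegral_union hd measurableSet_Ioc hg.left_of_union hg.right_of_union, integral_Ico_eq_integral_Ioc,
    ← intervalIntegral.integral_of_le (le_max_left _ _), ← intervalIntegral.integral_of_le (min_le_left _ _)]

lemma inv_ac {x p q : ℝ} (h : x ∉ uIcc p q) : AbsolutelyContinuousOnInterval (fun y => (x - y)⁻¹) p q := by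
  apply ContDiffOn.absolutelyContinuousOnInterval
  apply ContDiffOn.inv
  · fun_prop
  · intro y hy h0; exact h (by rwa [show x = y by linarith])

/-- integration by parts of the first commutator of one on one side -/
lemma T1_side {A : ℝ → ℝ} (hA : Lip1 1 A) {x p q : ℝ} (h : x ∉ uIcc p q) :
    |(∫ y in p..q, (A x - A y) / (x - y) / (x - y)) - ∫ y in p..q, 1 / (x - y) * deriv A y| ≤ 2 := by
  have hac := inv_ac h
  have hac2 : AbsolutelyContinuousOnInterval (fun y => A x - A y) p q := by
    have : Lip1 1 (fun y => A x - A y) := fun y z => by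
      have := hA z y
      rw [abs_sub_comm z y] at this
      simpa using this
    exact this.ac p q
  have key := hac2.integral_mul_deriv_eq_deriv_mul hac
  have d1 : ∀ y ∈ uIcc p q, deriv (fun y => (x - y)⁻¹) y = 1 / (x - y) / (x - y) := by
    intro y hy
    have h0 : x - y ≠ 0 := fun h0 => h (by rwa [show x = y by linarith])
    have : HasDerivAt (fun y => (x - y)⁻¹) (-(-1) / (x - y) ^ 2) y := ((hasDerivAt_id y).const_sub x).inv h0
    rw [this.deriv]; field_simp
  have e1 : ∫ y in p..q, (A x - A y) / (x - y) / (x - y) = ∫ y in p..q, (A x - A y) * deriv (fun y => (x - y)⁻¹) y := by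
    apply intervalIntegral.integral_congr; intro y hy
    simp only [d1 y hy]; ring
  have e2 : ∫ y in p..q, deriv (fun y => A x - A y) y * (x - y)⁻¹ = - ∫ y in p..q, 1 / (x - y) * deriv A y := by
    rw [← intervalIntegral.integral_neg]
    apply intervalIntegral.integral_congr; intro y hy
    simp only [deriv_const_sub]; ring
  rw [e1, key, e2]
  have b1 := slope_le zero_le_one hA x p
  have b2 := slope_le zero_le_one hA x q
  rw [div_eq_mul_inv] at b1 b2
  have := abs_sub ((A x - A q) * (x - q)⁻¹) ((A x - A p) * (x - p)⁻¹)
  ring_nf at this b1 b2 ⊢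
  linarith

lemma T1_side' {A : ℝ → ℝ} (hA : Lip1 1 A) {x p q : ℝ} (h : p = q ∨ x ∉ uIcc p q) :
    |(∫ y in p..q, (A x - A y) / (x - y) / (x - y)) - ∫ y in p..q, 1 / (x - y) * deriv A y| ≤ 2 := by
  rcases h with h | h
  · subst h; simp
  · exact T1_side hA h

lemma T1_parts {A : ℝ → ℝ} (hA : Lip1 1 A) {ε u v x : ℝ} (hε : 0 < ε) (hu : u ≤ x) (hv : x ≤ v) (A0 : Fin 0 → ℝ → ℝ) :
    |TT (volume.restrict (Icc u v)) (kE ε (fun _ : Fin 1 => A)) (fun _ => 1) x -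
      TT (volume.restrict (Icc u v)) (kE ε A0) (deriv A) x| ≤ 4 := by
  have hms : MeasurableSet {y : ℝ | ε < |x - y|} := measurableSet_lt measurable_const (measurable_const.sub measurable_id).abs
  have e1 : TT (volume.restrict (Icc u v)) (kE ε (fun _ : Fin 1 => A)) (fun _ => 1) x =
      ∫ y in Icc u v, (if ε < |x - y| then (A x - A y) / (x - y) / (x - y) else 0) := by
    unfold TT kE; simp
  have e2 : TT (volume.restrict (Icc u v)) (kE ε A0) (deriv A) x =
      ∫ y in Icc u v, (if ε < |x - y| then 1 / (x - y) * deriv A y else 0) := by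
    unfold TT kE; simp
  have hfin : volume (Icc u v ∩ {y | ε < |x - y|}) < ∞ := lt_of_le_of_lt (measure_mono inter_subset_left) (by simp)
  have i1 : IntegrableOn (fun y => (A x - A y) / (x - y) / (x - y)) (Icc u v ∩ {y | ε < |x - y|}) := by
    refine IntegrableOn.of_bound hfin ?_ (1 / ε) ?_
    · exact (((measurable_const.sub hA.cont.measurable).div (measurable_const.sub measurable_id)).div (measurable_const.sub measurable_id)).aestronglyMeasurable
    · refine (ae_restrict_iff' (measurableSet_Icc.inter hms)).mpr (Eventually.of_forall fun y hy => ?_)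
      rw [Real.norm_eq_abs, abs_div]
      have := slope_le zero_le_one hA x y
      exact div_le_div₀ zero_le_one this hε (le_of_lt hy.2)
  have i2 : IntegrableOn (fun y => 1 / (x - y) * deriv A y) (Icc u v ∩ {y | ε < |x - y|}) := by
    refine IntegrableOn.of_bound hfin ?_ (1 / ε) ?_
    · exact ((measurable_const.div (measurable_const.sub measurable_id)).mul (measurable_deriv A)).aestronglyMeasurable
    · refine (ae_restrict_iff' (measurableSet_Icc.inter hms)).mpr (Eventually.of_forall fun y hy => ?_)
      rw [Real.norm_eq_abs, abs_mul, abs_div, abs_one]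
      have h1 := hA.deriv_le zero_le_one y
      have h2 : 1 / |x - y| ≤ 1 / ε := div_le_div_of_nonneg_left zero_le_one hε (le_of_lt hy.2)
      calc _ ≤ 1 / ε * 1 := mul_le_mul h2 h1 (abs_nonneg _) (by positivity)
        _ = _ := mul_one _
  rw [e1, e2, trunc_split hε hu hv _ i1, trunc_split hε hu hv _ i2]
  have s1 := T1_side' hA (x := x) (p := u) (q := max u (x - ε)) (by
    rcases le_or_gt (x - ε) u with h | h
    · left; rw [max_eq_left h]
    · right; rw [max_eq_right h.le, uIcc_of_le h.le]; intro hh; linarith [hh.2])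
  have s2 := T1_side' hA (x := x) (p := min v (x + ε)) (q := v) (by
    rcases le_or_gt v (x + ε) with h | h
    · left; rw [min_eq_left h]
    · right; rw [min_eq_right h.le, uIcc_of_le h.le]; intro hh; linarith [hh.1])
  rw [abs_le] at *
  constructor <;> linarith [s1.1, s1.2, s2.1, s2.2]

lemma cS_zero {s : Set ℝ} [IsFiniteMeasure (volume.restrict s)] {ε : ℝ} (hε : 0 < ε) (A0 : Fin 0 → ℝ → ℝ) (x : ℝ) :
    cS (volume.restrict s) (kE ε A0) x ≤ 24 := by
  refine le_trans (dbl_mono (q := fun y z => eE ε x y z) (fun _ _ => abs_nonneg _) (fun y z => ?_)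
    (eE_meas3 ε measurable_const measurable_fst measurable_snd) (fun y z => eE_bdd hε x y z)) (eE_dbl hε x)
  have := SS_le hε (A := A0) (fun j => j.elim0) x y z
  simpa using this

lemma TT_indicator {s t : Set ℝ} (hs : MeasurableSet s) (hst : s ⊆ t) (k : ℝ → ℝ → ℝ) (f : ℝ → ℝ) (x : ℝ) :
    TT (volume.restrict t) k (s.indicator f) x = TT (volume.restrict s) k f x := by
  unfold TT
  have : (fun y => k x y * s.indicator f y) = s.indicator fun y => k x y * f y := by
    ext y; by_cases h : y ∈ s <;> simp [h]
  rw [this, setIntegral_indicator hs, inter_eq_self_of_subset_right hst]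

lemma H_L2 {ε c r : ℝ} (hε : 0 < ε) (hr : 0 < r) (A0 : Fin 0 → ℝ → ℝ) {f : ℝ → ℝ} {F : ℝ} (hf : Measurable f)
    (hF : ∀ x, |f x| ≤ F) :
    ∫ x in Icc (c - r) (c + r), (TT (volume.restrict (Icc (c - r) (c + r))) (kE ε A0) f x) ^ 2 ≤
      52 * ∫ x in Icc (c - r) (c + r), f x ^ 2 := by
  set I := Icc (c - r) (c + r) with hI
  set J := Icc (c - 3 * r) (c + 3 * r) with hJ
  have hIJ : I ⊆ J := Icc_subset_Icc (by linarith) (by linarith)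
  have hkm := kE_meas ε (A := A0) (fun j => j.elim0)
  have hkb := kE_bdd (A := A0) hε (fun j => j.elim0)
  have hfm : Measurable (I.indicator f) := hf.indicator measurableSet_Icc
  have hF0 : 0 ≤ F := (abs_nonneg _).trans (hF 0)
  have hfb : ∀ x, |I.indicator f x| ≤ F := fun x => by
    by_cases h : x ∈ I <;> simp [h, hF, hF0]
  have h1 := sym_bound (μ := volume.restrict J) hkm hkb hfm hfb
  have hTm := TT_meas (μ := volume.restrict J) hkm hfm
  have hTb := TT_bdd (μ := volume.restrict J) hkb hfb
  have h2 : ∫ x in I, (TT (volume.restrict I) (kE ε A0) f x) ^ 2 ≤ ∫ x in J, (TT (volume.restrict J) (kE ε A0) (I.indicator f) x) ^ 2 := by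
    simp_rw [TT_indicator (s := I) (t := J) measurableSet_Icc hIJ]
    refine setIntegral_mono_set ?_ (Eventually.of_forall fun x => sq_nonneg _) hIJ.eventuallyLE
    have : Integrable (fun x => (TT (volume.restrict J) (kE ε A0) (I.indicator f) x) ^ 2) (volume.restrict J) := by
      refine int_bdd (C := (1 / ε * F * (volume.restrict J).real univ) ^ 2) (hTm.pow_const 2) fun x => ?_
      rw [abs_pow]; exact pow_le_pow_left₀ (abs_nonneg _) (hTb x) 2
    simp_rw [TT_indicator (s := I) (t := J) measurableSet_Icc hIJ] at this
    exact this
  refine h2.trans (h1.trans ?_)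
  have e : ∀ x, I.indicator f x ^ 2 * (4 * (TT (volume.restrict J) (kE ε A0) (fun _ => 1) x) ^ 2 + 2 * cS (volume.restrict J) (kE ε A0) x)
     ≤ I.indicator (fun x => 52 * f x ^ 2) x := by
    intro x
    by_cases h : x ∈ I
    · simp only [indicator_of_mem h]
      have t1 := H_one hε hr (x := x) (c := c) (by rw [abs_le]; constructor <;> linarith [h.1, h.2]) A0
      have t2 := cS_zero (s := J) hε A0 x
      have t3 := (sq_le_one_iff_abs_le_one _).mpr t1
      rw [mul_comm 52]
      exact mul_le_mul_of_nonneg_left (by linarith) (sq_nonneg _)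
    · simp [h]
  have e2 : ∫ x in J, I.indicator (fun x => 52 * f x ^ 2) x = 52 * ∫ x in I, f x ^ 2 := by
    rw [setIntegral_indicator measurableSet_Icc, inter_eq_self_of_subset_right hIJ, integral_const_mul]
  rw [← e2]
  refine integral_mono_of_nonneg (Eventually.of_forall fun x => mul_nonneg (sq_nonneg _)
    (add_nonneg (by positivity) (mul_nonneg two_pos.le (cS_nonneg x)))) ?_ (Eventually.of_forall e)
  refine int_bdd (C := 52 * F ^ 2) (((hf.pow_const 2).const_mul 52).indicator measurableSet_Icc) fun x => ?_
  by_cases h : x ∈ I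
  · simp only [indicator_of_mem h]
    rw [abs_mul, abs_pow, abs_of_pos (by norm_num : (0:ℝ) < 52)]
    have := pow_le_pow_left₀ (abs_nonneg _) (hF x) 2
    linarith
  · simp [h]; positivity

lemma KKE_meas3 {α : Type*} [MeasurableSpace α] (ε : ℝ) {A : ℝ → ℝ} (hA : Measurable A) {u v w : α → ℝ} (hu : Measurable u) (hv : Measurable v)
    (hw : Measurable w) : Measurable fun a => KKE ε A (u a) (v a) (w a) := by
  unfold KKE kap
  refine Measurable.ite ?_ ?_ measurable_const
  · exact (measurableSet_lt measurable_const (hu.sub hv).abs).inter ((measurableSet_lt measurable_const (hu.sub hw).abs).inter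
      (measurableSet_lt measurable_const (hv.sub hw).abs))
  · exact ((((((hA.comp hu).sub (hA.comp hv)).div (hu.sub hv)).sub (((hA.comp hu).sub (hA.comp hw)).div (hu.sub hw)))).div
      (hv.sub hw)).pow_const 2

lemma KKE_bdd {ε : ℝ} (hε : 0 < ε) {A : ℝ → ℝ} (hA : Lip1 1 A) (x y z : ℝ) : |KKE ε A x y z| ≤ (2 / ε) ^ 2 := by
  unfold KKE; split_ifs with h
  · rw [abs_pow]
    apply pow_le_pow_left₀ (abs_nonneg _)
    unfold kap
    rw [abs_div]
    have h1 := slope_le zero_le_one hA x y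
    have h2 := slope_le zero_le_one hA x z
    exact div_le_div₀ two_pos.le ((abs_sub _ _).trans (by linarith)) hε h.2.2.le
  · simp; positivity

lemma tri_int {μ : Measure ℝ} [IsFiniteMeasure μ] {q : ℝ → ℝ → ℝ → ℝ} {C : ℝ}
    (hq : Measurable fun p : (ℝ × ℝ) × ℝ => q p.1.1 p.1.2 p.2) (hqb : ∀ x y z, |q x y z| ≤ C) :
    (∀ x y, Integrable (fun z => q x y z) μ) ∧ (∀ x, Integrable (fun y => ∫ z, q x y z ∂μ) μ) ∧
    Integrable (fun x => ∫ y, ∫ z, q x y z ∂μ ∂μ) μ := by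
  have m1 : Measurable fun p : ℝ × ℝ => ∫ z, q p.1 p.2 z ∂μ := hq.stronglyMeasurable.integral_prod_right.measurable
  have m2 : Measurable fun x : ℝ => ∫ y, ∫ z, q x y z ∂μ ∂μ := m1.stronglyMeasurable.integral_prod_right.measurable
  have b1 : ∀ x y, |∫ z, q x y z ∂μ| ≤ C * μ.real univ := fun x y =>
    norm_integral_le_of_norm_le_const (f := fun z => q x y z) (Eventually.of_forall fun z => hqb x y z)
  have b2 : ∀ x, |∫ y, ∫ z, q x y z ∂μ ∂μ| ≤ C * μ.real univ * μ.real univ := fun x =>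
    norm_integral_le_of_norm_le_const (f := fun y => ∫ z, q x y z ∂μ) (Eventually.of_forall fun z => b1 x z)
  refine ⟨fun x y => int_bdd (hq.comp ((measurable_const.prodMk measurable_const).prodMk measurable_id)) (hqb x y),
    fun x => int_bdd (m1.comp (measurable_const.prodMk measurable_id)) (b1 x), int_bdd m2 b2⟩

lemma SS_meas3 {k : ℝ → ℝ → ℝ} (hk : Measurable (Function.uncurry k)) :
    Measurable fun p : (ℝ × ℝ) × ℝ => SS k p.1.1 p.1.2 p.2 := by
  have a : Measurable fun p : (ℝ × ℝ) × ℝ => p.1.1 := measurable_fst.comp measurable_fst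
  have b : Measurable fun p : (ℝ × ℝ) × ℝ => p.1.2 := measurable_snd.comp measurable_fst
  have c : Measurable fun p : (ℝ × ℝ) × ℝ => p.2 := measurable_snd
  unfold SS
  exact (((hk_comp hk a b).mul (hk_comp hk a c)).add ((hk_comp hk b a).mul (hk_comp hk b c))).add
    ((hk_comp hk c a).mul (hk_comp hk c b))

lemma KKE_triple {ε c r : ℝ} (hε : 0 < ε) (hr : 0 < r) {A : ℝ → ℝ} (hA : Lip1 1 A) :
    ∫ x in Icc (c - r) (c + r), ∫ y in Icc (c - r) (c + r), ∫ z in Icc (c - r) (c + r), KKE ε A x y z ≤ 864 * r := by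
  set I := Icc (c - r) (c + r) with hI
  set μ := volume.restrict I with hμ
  set A0 : Fin 0 → ℝ → ℝ := fun j => j.elim0
  set A1 : Fin 1 → ℝ → ℝ := fun _ => A
  have hvol : μ.real univ = 2 * r := by
    rw [hμ, measureReal_restrict_apply_univ, hI, Real.volume_real_Icc_of_le (by linarith)]; ring
  have hk1 := kE_meas ε (A := A1) (fun _ => hA.cont.measurable)
  have hk1b := kE_bdd (A := A1) hε (fun _ => hA)
  obtain ⟨i1, i2, i3⟩ := tri_int (μ := μ) (KKE_meas3 ε hA.cont.measurable (measurable_fst.comp measurable_fst) (measurable_snd.comp measurable_fst) measurable_snd) (KKE_bdd hε hA)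
  obtain ⟨j1, j2, j3⟩ := tri_int (μ := μ) (SS_meas3 hk1) (SS_bdd hk1b)
  obtain ⟨l1, l2, l3⟩ := tri_int (μ := μ) (eE_meas3 ε (measurable_fst.comp measurable_fst) (measurable_snd.comp measurable_fst) (measurable_snd (α := ℝ × ℝ))) (eE_bdd hε)
  have h1 : ∫ x, ∫ y, ∫ z, KKE ε A x y z ∂μ ∂μ ∂μ ≤ (∫ x, ∫ y, ∫ z, SS (kE ε A1) x y z ∂μ ∂μ ∂μ) + ∫ x, ∫ y, ∫ z, eE ε x y z ∂μ ∂μ ∂μ := by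
    rw [← integral_add j3 l3]
    refine integral_mono i3 (j3.add l3) fun x => ?_
    show _ ≤ (∫ y, ∫ z, SS (kE ε A1) x y z ∂μ ∂μ) + ∫ y, ∫ z, eE ε x y z ∂μ ∂μ
    rw [← integral_add (j2 x) (l2 x)]
    refine integral_mono (i2 x) ((j2 x).add (l2 x)) fun y => ?_
    show _ ≤ (∫ z, SS (kE ε A1) x y z ∂μ) + ∫ z, eE ε x y z ∂μ
    rw [← integral_add (j1 x y) (l1 x y)]
    exact integral_mono (i1 x y) ((j1 x y).add (l1 x y)) fun z => KKE_le_SS hε hA x y z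
  have h2 : ∫ x, ∫ y, ∫ z, eE ε x y z ∂μ ∂μ ∂μ ≤ 24 * (2 * r) := by
    calc _ ≤ ∫ x, (24:ℝ) ∂μ := integral_mono l3 (integrable_const _) fun x => eE_dbl hε x
      _ = _ := by rw [integral_const, hvol, smul_eq_mul, mul_comm]
  rw [sym_one hk1 hk1b] at h1
  have hdm := measurable_deriv A
  have hdb := fun x => hA.deriv_le zero_le_one x
  have hk0 := kE_meas ε (A := A0) (fun j => j.elim0)
  have hk0b := kE_bdd (A := A0) hε (fun j => j.elim0)
  have t0m := TT_meas (μ := μ) hk0 hdm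
  have t0b := TT_bdd (μ := μ) hk0b hdb
  have t1m := TT_meas (μ := μ) hk1 (measurable_const (a := (1:ℝ)))
  have t1b := TT_bdd (μ := μ) hk1b (f := fun _ => 1) (F := 1) (by simp)
  have q0 : Integrable (fun x => (TT μ (kE ε A0) (deriv A) x) ^ 2) μ := int_bdd (t0m.pow_const 2) fun x => by
    rw [abs_pow]; exact pow_le_pow_left₀ (abs_nonneg _) (t0b x) 2
  have q1 : Integrable (fun x => (TT μ (kE ε A1) (fun _ => 1) x) ^ 2) μ := int_bdd (t1m.pow_const 2) fun x => by
    rw [abs_pow]; exact pow_le_pow_left₀ (abs_nonneg _) (t1b x) 2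
  have h3 : ∫ x, (TT μ (kE ε A1) (fun _ => 1) x) ^ 2 ∂μ ≤ 2 * (∫ x, (TT μ (kE ε A0) (deriv A) x) ^ 2 ∂μ) + 32 * (2 * r) := by
    have : ∫ x, (2 * (TT μ (kE ε A0) (deriv A) x) ^ 2 + 32) ∂μ = 2 * (∫ x, (TT μ (kE ε A0) (deriv A) x) ^ 2 ∂μ) + 32 * (2 * r) := by
      rw [integral_add (q0.const_mul 2) (integrable_const _), integral_const_mul, integral_const, hvol, smul_eq_mul]; ring
    rw [← this]
    refine integral_mono_ae q1 ((q0.const_mul 2).add (integrable_const _)) ?_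
    refine (ae_restrict_iff' measurableSet_Icc).mpr (Eventually.of_forall fun x hx => ?_)
    have := T1_parts hA hε hx.1 hx.2 A0
    have h4 : (TT μ (kE ε A1) (fun _ => 1) x - TT μ (kE ε A0) (deriv A) x) ^ 2 ≤ 4 ^ 2 := sq_le_sq' (by linarith [(abs_le.mp this).1]) (abs_le.mp this).2
    show (TT μ (kE ε A1) (fun _ => 1) x) ^ 2 ≤ 2 * (TT μ (kE ε A0) (deriv A) x) ^ 2 + 32
    nlinarith [sq_nonneg (TT μ (kE ε A1) (fun _ => 1) x - 2 * TT μ (kE ε A0) (deriv A) x)]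
  have h5 := H_L2 (c := c) hε hr A0 hdm hdb
  have h6 : ∫ x, deriv A x ^ 2 ∂μ ≤ 2 * r := by
    calc _ ≤ ∫ x, (1:ℝ) ∂μ := integral_mono (int_bdd (C := 1) (hdm.pow_const 2) fun x => by
            rw [abs_pow]; exact pow_le_one₀ (abs_nonneg _) (hdb x)) (integrable_const _) fun x => by
            show deriv A x ^ 2 ≤ 1
            rw [← sq_abs]; exact pow_le_one₀ (abs_nonneg _) (hdb x)
      _ = _ := by rw [integral_const, hvol, smul_eq_mul, mul_one]
  have : ∫ x, ∫ y, ∫ z, KKE ε A x y z ∂μ ∂μ ∂μ ≤ 3 * (2 * (52 * (2 * r)) + 32 * (2 * r)) + 24 * (2 * r) := by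
    have h5' : ∫ x, (TT μ (kE ε A0) (deriv A) x) ^ 2 ∂μ ≤ 52 * ∫ x, deriv A x ^ 2 ∂μ := h5
    linarith
  linarith

/-- L1 -/
lemma L1 (n : ℕ) {δ : ℝ} (hδ : 0 < δ) : ∃ W : ℝ, 0 < W ∧ ∀ (A : Fin n → ℝ → ℝ) (ε c r : ℝ), (∀ j, Lip1 1 (A j)) → 0 < ε → 0 < r →
    ∃ G : Set ℝ, MeasurableSet G ∧ volume.real (Icc (c - r) (c + r) \ G) ≤ δ * r ∧
      ∀ (f : ℝ → ℝ) (F : ℝ), Measurable f → (∀ x, |f x| ≤ F) →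
        ∫ x in Icc (c - r) (c + r) ∩ G, (∫ y in Icc (c - r) (c + r), kE ε A x y * f y) ^ 2 ≤ W * ∫ x in Icc (c - r) (c + r), f x ^ 2 := by
  set K : ℝ := 2 * n * (n * 864) + 48 with hK
  have hK0 : 0 < K := by positivity
  refine ⟨4 * K / δ, by positivity, fun A ε c r hA hε hr => ?_⟩
  set I := Icc (c - r) (c + r) with hI
  set μ := volume.restrict I with hμ
  have hvol : μ.real univ = 2 * r := by
    rw [hμ, measureReal_restrict_apply_univ, hI, Real.volume_real_Icc_of_le (by linarith)]; ring
  have hk1 := kE_meas ε (A := A) (fun j => (hA j).cont.measurable)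
  have hk1b := kE_bdd (A := A) hε hA
  have I1 := fun j => tri_int (μ := μ) (KKE_meas3 ε (hA j).cont.measurable (measurable_fst.comp measurable_fst) (measurable_snd.comp measurable_fst) measurable_snd) (KKE_bdd hε (hA j))
  obtain ⟨l1, l2, l3⟩ := tri_int (μ := μ) (eE_meas3 ε (measurable_fst.comp measurable_fst) (measurable_snd.comp measurable_fst) (measurable_snd (α := ℝ × ℝ))) (eE_bdd hε)
  have hle : ∀ x, cS μ (kE ε A) x ≤ 2 * n * (∑ j, ∫ y, ∫ z, KKE ε (A j) x y z ∂μ ∂μ) + ∫ y, ∫ z, eE ε x y z ∂μ ∂μ := by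
    intro x
    have e1 : 2 * n * (∑ j, ∫ y, ∫ z, KKE ε (A j) x y z ∂μ ∂μ) + ∫ y, ∫ z, eE ε x y z ∂μ ∂μ =
       ∫ y, (2 * n * (∑ j, ∫ z, KKE ε (A j) x y z ∂μ) + ∫ z, eE ε x y z ∂μ) ∂μ := by
      rw [integral_add ((integrable_finsetSum _ fun j _ => (I1 j).2.1 x).const_mul _) (l2 x), integral_const_mul,
        integral_finsetSum _ fun j _ => (I1 j).2.1 x]
    rw [e1]
    refine integral_mono_of_nonneg (Eventually.of_forall fun y => integral_nonneg fun z => abs_nonneg _)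
      (((integrable_finsetSum _ fun j _ => (I1 j).2.1 x).const_mul _).add (l2 x)) (Eventually.of_forall fun y => ?_)
    show ∫ z, |SS (kE ε A) x y z| ∂μ ≤ 2 * n * (∑ j, ∫ z, KKE ε (A j) x y z ∂μ) + ∫ z, eE ε x y z ∂μ
    have e2 : 2 * n * (∑ j, ∫ z, KKE ε (A j) x y z ∂μ) + ∫ z, eE ε x y z ∂μ =
       ∫ z, (2 * n * (∑ j, KKE ε (A j) x y z) + eE ε x y z) ∂μ := by
      rw [integral_add ((integrable_finsetSum _ fun j _ => (I1 j).1 x y).const_mul _) (l1 x y), integral_const_mul,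
        integral_finsetSum _ fun j _ => (I1 j).1 x y]
    rw [e2]
    exact integral_mono_of_nonneg (Eventually.of_forall fun z => abs_nonneg _)
      (((integrable_finsetSum _ fun j _ => (I1 j).1 x y).const_mul _).add (l1 x y)) (Eventually.of_forall fun z => SS_le hε hA x y z)
  have hC : ∫ x, cS μ (kE ε A) x ∂μ ≤ K * r := by
    calc ∫ x, cS μ (kE ε A) x ∂μ ≤ ∫ x, (2 * n * (∑ j, ∫ y, ∫ z, KKE ε (A j) x y z ∂μ ∂μ) + ∫ y, ∫ z, eE ε x y z ∂μ ∂μ) ∂μ :=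
          integral_mono_of_nonneg (Eventually.of_forall fun x => cS_nonneg x)
            (((integrable_finsetSum _ fun j _ => (I1 j).2.2).const_mul _).add l3) (Eventually.of_forall hle)
      _ = 2 * n * (∑ j, ∫ x, ∫ y, ∫ z, KKE ε (A j) x y z ∂μ ∂μ ∂μ) + ∫ x, ∫ y, ∫ z, eE ε x y z ∂μ ∂μ ∂μ := by
        rw [integral_add ((integrable_finsetSum _ fun j _ => (I1 j).2.2).const_mul _) l3, integral_const_mul,
        integral_finsetSum _ fun j _ => (I1 j).2.2]
      _ ≤ 2 * n * (∑ j : Fin n, 864 * r) + ∫ x, (24:ℝ) ∂μ := by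
        refine add_le_add (mul_le_mul_of_nonneg_left (Finset.sum_le_sum fun j _ => KKE_triple hε hr (hA j)) (by positivity)) ?_
        exact integral_mono l3 (integrable_const _) fun x => eE_dbl hε x
      _ = K * r := by
        rw [integral_const, hvol, Finset.sum_const, Finset.card_univ, Fintype.card_fin, nsmul_eq_mul, smul_eq_mul]; ring
  obtain ⟨G, hG, hGc, hGf⟩ := sym_good hk1 hk1b (kE_anti ε A) hC (W := 4 * K / δ) (by positivity)
  refine ⟨G, hG, ?_, fun f F hf hF => ?_⟩
  · have : μ.real Gᶜ = volume.real (I \ G) := by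
      rw [hμ, measureReal_restrict_apply hG.compl]; congr 1; ext y; simp [and_comm]
    rw [← this]; refine hGc.trans (le_of_eq ?_); field_simp
  · have := hGf f F hf hF
    rw [hμ, Measure.restrict_restrict hG, inter_comm] at this
    exact this

/-! ### Vitali covering and the bad set -/

lemma vit_measure {S T : Set ℝ} {r : ℝ → ℝ} {R : ℝ} (κ ν : Measure ℝ) (c : ℝ≥0∞)
    (hr : ∀ x ∈ S, 0 < r x ∧ r x ≤ R)
    (h : ∀ x ∈ S, κ (T ∩ Icc (x - 5 * r x) (x + 5 * r x)) ≤ c * ν (Icc (x - r x) (x + r x))) :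
    κ (T ∩ S) ≤ c * ν univ := by
  obtain ⟨u, huS, hd, hcov⟩ := Vitali.exists_disjoint_subfamily_covering_enlargement_closedBall S (fun x : ℝ => x) r R
    (fun a ha => (hr a ha).2) 5 (by norm_num)
  have hcount : u.Countable := hd.countable_of_nonempty_interior fun x hx => by
    refine ⟨x, ?_⟩
    exact Metric.ball_subset_interior_closedBall (Metric.mem_ball_self (hr x (huS hx)).1)
  have hsub : T ∩ S ⊆ ⋃ x ∈ u, T ∩ Icc (x - 5 * r x) (x + 5 * r x) := by
    rintro x ⟨hxT, hxS⟩
    obtain ⟨b, hb, hsb⟩ := hcov x hxS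
    refine mem_iUnion₂.mpr ⟨b, hb, hxT, ?_⟩
    have := hsb (Metric.mem_closedBall_self (hr x hxS).1.le)
    rwa [Real.closedBall_eq_Icc] at this
  calc κ (T ∩ S) ≤ κ (⋃ x ∈ u, T ∩ Icc (x - 5 * r x) (x + 5 * r x)) := measure_mono hsub
    _ ≤ ∑' x : u, κ (T ∩ Icc (x - 5 * r x) (x + 5 * r x)) := measure_biUnion_le _ hcount _
    _ ≤ ∑' x : u, c * ν (Icc (x - r x) (x + r x)) := ENNReal.tsum_le_tsum fun x => h x (huS x.2)
    _ = c * ∑' x : u, ν (Icc (x - r x) (x + r x)) := ENNReal.tsum_mul_left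
    _ = c * ν (⋃ x ∈ u, Icc (x - r x) (x + r x)) := by
      rw [measure_biUnion hcount (fun x hx y hy hxy => by
        have := hd hx hy hxy
        simp only [Function.onFun, Real.closedBall_eq_Icc] at this ⊢; exact this) fun x _ => measurableSet_Icc]
    _ ≤ c * ν univ := by gcongr; exact subset_univ _

def Bad (g : ℝ → ℝ) (μ : ℝ) : Set ℝ := {x | ∃ r > 0, μ * r < ∫ y in Icc (x - r) (x + r), g y}

lemma Bad_open {g : ℝ → ℝ} (hg : Integrable g) (h0 : ∀ x, 0 ≤ g x) {μ : ℝ} (hμ : 0 < μ) : IsOpen (Bad g μ) := by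
  rw [Metric.isOpen_iff]
  rintro x ⟨r, hr, hx⟩
  set s := ∫ y in Icc (x - r) (x + r), g y
  refine ⟨(s - μ * r) / (2 * μ), by apply div_pos <;> linarith, fun y hy => ?_⟩
  rw [Metric.mem_ball, Real.dist_eq, lt_div_iff₀ (by positivity)] at hy
  refine ⟨r + |y - x|, by positivity, ?_⟩
  have : s ≤ ∫ z in Icc (y - (r + |y - x|)) (y + (r + |y - x|)), g z := by
    refine setIntegral_mono_set hg.integrableOn (Eventually.of_forall h0) (Icc_subset_Icc ?_ ?_).eventuallyLE
    · linarith [le_abs_self (y - x)]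
    · linarith [neg_abs_le (y - x)]
  refine lt_of_lt_of_le ?_ this
  nlinarith [abs_nonneg (y - x)]

lemma not_Bad {g : ℝ → ℝ} {μ x : ℝ} (hx : x ∉ Bad g μ) {r : ℝ} (hr : 0 < r) : ∫ y in Icc (x - r) (x + r), g y ≤ μ * r := by
  by_contra h; exact hx ⟨r, hr, not_le.mp h⟩

lemma not_Bad_int {g : ℝ → ℝ} (hg : Integrable g) (h0 : ∀ x, 0 ≤ g x) {μ x : ℝ} (hx : x ∉ Bad g μ) (y : ℝ) :
    |∫ t in x..y, g t| ≤ μ * |x - y| := by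
  rcases eq_or_ne x y with rfl | hxy
  · simp
  have hp : 0 < |x - y| := abs_pos.mpr (sub_ne_zero.mpr hxy)
  rw [intervalIntegral.abs_integral_eq_abs_integral_uIoc, abs_of_nonneg (setIntegral_nonneg_of_ae (Eventually.of_forall h0))]
  refine le_trans (setIntegral_mono_set hg.integrableOn (Eventually.of_forall h0) (HasSubset.Subset.eventuallyLE ?_)) (not_Bad hx hp)
  intro t ht
  have h1 := uIoc_subset_uIcc ht
  rw [mem_uIcc] at h1
  constructor <;> rcases h1 with h1 | h1 <;> rcases abs_cases (x - y) with h2 | h2 <;> linarith [h1.1, h1.2, h2.1, h2.2]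

lemma Bad_weak {g : ℝ → ℝ} (hg : Integrable g) (h0 : ∀ x, 0 ≤ g x) {μ : ℝ} (hμ : 0 < μ) :
    volume (Bad g μ) ≤ ENNReal.ofReal (10 / μ * ∫ x, g x) := by
  classical
  choose! r hr using (fun x (hx : x ∈ Bad g μ) => hx)
  have hle : ∀ x, ∀ ρ, ∫ y in Icc (x - ρ) (x + ρ), g y ≤ ∫ y, g y := fun x ρ =>
    setIntegral_le_integral hg (Eventually.of_forall h0)
  have := vit_measure (S := Bad g μ) (T := univ) (r := r) (R := (∫ x, g x) / μ) volume (volume.withDensity fun x => ENNReal.ofReal (g x))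
    (ENNReal.ofReal (10 / μ)) (fun x hx => ⟨(hr x hx).1, by
      rw [le_div_iff₀ hμ]; linarith [(hr x hx).2, hle x (r x)]⟩) (fun x hx => by
      rw [univ_inter, Real.volume_Icc, withDensity_apply _ measurableSet_Icc,
        ← ofReal_integral_eq_lintegral_ofReal hg.integrableOn (Eventually.of_forall h0), ← ENNReal.ofReal_mul (by positivity)]
      apply ENNReal.ofReal_le_ofReal
      have := (hr x hx).2
      rw [div_mul_eq_mul_div, le_div_iff₀ hμ]
      linarith)
  rw [univ_inter, withDensity_apply _ MeasurableSet.univ, Measure.restrict_univ,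
    ← ofReal_integral_eq_lintegral_ofReal hg (Eventually.of_forall h0), ← ENNReal.ofReal_mul (by positivity)] at this
  exact this

/-- Lipschitz modification of a primitive off the bad set. -/
lemma lip_mod {a : ℝ → ℝ} (ha : Integrable a) {M : ℝ} (hM : 0 < M) (c : ℝ) {E : Set ℝ} (hE : ∀ x ∈ E, x ∉ Bad (fun y => |a y|) M) :
    ∃ B : ℝ → ℝ, Lip1 1 B ∧ (∀ x ∈ E, M * B x = ∫ t in c..x, a t) ∧
      (∀ x ∈ E, ∀ y, |(∫ t in c..x, a t) - ∫ t in c..y, a t| ≤ M * |x - y|) ∧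
      ∀ y, E.Nonempty → |(∫ t in c..y, a t) - M * B y| ≤ 2 * M * Metric.infDist y E := by
  have hi : ∀ x y, IntervalIntegrable a volume x y := fun x y => ha.intervalIntegrable
  have h1 : ∀ x ∈ E, ∀ y, |(∫ t in c..x, a t) - ∫ t in c..y, a t| ≤ M * |x - y| := by
    intro x hx y
    rw [intervalIntegral.integral_interval_sub_left (hi _ _) (hi _ _), intervalIntegral.integral_symm, abs_neg]
    refine le_trans ?_ (not_Bad_int ha.abs (fun x => abs_nonneg _) (hE x hx) y)
    exact intervalIntegral.norm_integral_le_abs_integral_norm (f := a)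
  have hL : LipschitzOnWith 1 (fun x => (∫ t in c..x, a t) / M) E := LipschitzOnWith.of_dist_le_mul fun x hx y _ => by
    rw [Real.dist_eq, Real.dist_eq, ← sub_div, abs_div, abs_of_pos hM, div_le_iff₀ hM]
    have := h1 x hx y
    simp; linarith
  obtain ⟨B, hB, hBE⟩ := hL.extend_real
  have hB1 : Lip1 1 B := fun x y => by
    have := hB.dist_le_mul x y
    simpa [Real.dist_eq] using this
  have hBE' : ∀ x ∈ E, M * B x = ∫ t in c..x, a t := fun x hx => by
    rw [← hBE hx]; field_simp
  refine ⟨B, hB1, hBE', h1, fun y hne => ?_⟩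
  have : ∀ x ∈ E, |(∫ t in c..y, a t) - M * B y| / (2 * M) ≤ dist y x := by
    intro x hx
    rw [div_le_iff₀ (by positivity), Real.dist_eq]
    have t1 := h1 x hx y
    have t2 := hB1 x y
    have t3 := hBE' x hx
    have e : (∫ t in c..y, a t) - M * B y = -((∫ t in c..x, a t) - ∫ t in c..y, a t) + M * (B x - B y) := by rw [← t3]; ring
    rw [e]
    refine (abs_add_le _ _).trans ?_
    rw [abs_neg, abs_mul, abs_of_pos hM, abs_sub_comm y x]
    nlinarith
  have := (Metric.le_infDist hne).mpr (fun {x} hx => this x hx)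
  rw [div_le_iff₀ (by positivity)] at this
  linarith

/-- Marcinkiewicz integral -/
lemma marc {E : Set ℝ} (hE : MeasurableSet E) (w : ℝ → ℝ≥0∞) (hw : Measurable w) {ε : ℝ} (hε : 0 < ε) :
    ∫⁻ x in E, ∫⁻ y, w y * ENNReal.ofReal (Metric.infDist y E * nnE ε x y) ≤ 4 * ∫⁻ y, w y := by
  have hm : Measurable fun p : ℝ × ℝ => w p.2 * ENNReal.ofReal (Metric.infDist p.2 E * nnE ε p.1 p.2) :=
    (hw.comp measurable_snd).mul (((Metric.continuous_infDist_pt E).measurable.comp measurable_snd).mul (nnE_meas ε)).ennreal_ofReal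
  rw [lintegral_lintegral_swap hm.aemeasurable, ← lintegral_const_mul _ hw]
  apply lintegral_mono; intro y
  show ∫⁻ x in E, w y * ENNReal.ofReal (Metric.infDist y E * nnE ε x y) ≤ 4 * w y
  have hm2 : Measurable fun x => ENNReal.ofReal (Metric.infDist y E * nnE ε x y) :=
    ((hk_comp (nnE_meas ε) measurable_id measurable_const).const_mul _).ennreal_ofReal
  rw [lintegral_const_mul _ hm2, mul_comm]
  gcongr
  rcases eq_or_lt_of_le (Metric.infDist_nonneg (x := y) (s := E)) with h0 | h0
  · rw [← h0]; simp
  set d := Metric.infDist y E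
  have h1 : ∀ x ∈ E, ENNReal.ofReal (d * nnE ε x y) ≤ ENNReal.ofReal d * ENNReal.ofReal (nnE (d / 2) y x) := by
    intro x hx
    rw [← ENNReal.ofReal_mul h0.le]
    apply ENNReal.ofReal_le_ofReal
    apply mul_le_mul_of_nonneg_left _ h0.le
    have : d ≤ |y - x| := by rw [← Real.dist_eq]; exact Metric.infDist_le_dist_of_mem hx
    unfold nnE
    rw [if_pos (by linarith : d / 2 < |y - x|)]
    split_ifs
    · rw [← neg_sub x y, neg_sq]
    · positivity
  calc ∫⁻ x in E, ENNReal.ofReal (d * nnE ε x y) ≤ ∫⁻ x in E, ENNReal.ofReal d * ENNReal.ofReal (nnE (d / 2) y x) :=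
        setLIntegral_mono' hE h1
    _ ≤ ∫⁻ x, ENNReal.ofReal d * ENNReal.ofReal (nnE (d / 2) y x) := lintegral_mono' Measure.restrict_le_self le_rfl
    _ = ENNReal.ofReal d * ∫⁻ x, ENNReal.ofReal (nnE (d / 2) y x) :=
        lintegral_const_mul _ (hk_comp (nnE_meas _) measurable_const measurable_id).ennreal_ofReal
    _ ≤ ENNReal.ofReal d * ENNReal.ofReal (2 / (d / 2)) := by gcongr; exact nnE_lint (by positivity) y
    _ = 4 := by
      rw [← ENNReal.ofReal_mul h0.le, show d * (2 / (d / 2)) = 4 by field_simp; norm_num]; simp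

/-! ### Integration by parts against the commutator kernel -/

noncomputable def phK {n : ℕ} (B : Fin n → ℝ → ℝ) (x y : ℝ) : ℝ := (∏ j, (B j x - B j y) / (x - y)) / (x - y)

lemma phK_le {n : ℕ} {B : Fin n → ℝ → ℝ} (hB : ∀ j, Lip1 1 (B j)) (x y : ℝ) : |phK B x y| ≤ 1 / |x - y| := by
  unfold phK
  rw [abs_div, Finset.abs_prod]
  apply div_le_div_of_nonneg_right _ (abs_nonneg _)
  exact Finset.prod_le_one (fun _ _ => abs_nonneg _) fun j _ => slope_le zero_le_one (hB j) x y

lemma phK_ac {n : ℕ} {B : Fin n → ℝ → ℝ} (hB : ∀ j, Lip1 1 (B j)) {x p q : ℝ} (h : x ∉ uIcc p q) :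
    AbsolutelyContinuousOnInterval (phK B x) p q := by
  have h1 : ∀ s : Finset (Fin n), AbsolutelyContinuousOnInterval (fun y => ∏ j ∈ s, (B j x - B j y) / (x - y)) p q := by
    intro s
    induction s using Finset.induction_on with
    | empty =>
      simp only [Finset.prod_empty]
      have : Lip1 0 (fun _ : ℝ => (1:ℝ)) := fun y z => by simp
      exact this.ac p q
    | insert i s hi ih =>
      simp_rw [Finset.prod_insert hi, div_eq_mul_inv]
      have : Lip1 1 (fun y => B i x - B i y) := fun y z => by
        have := hB i z y
        rw [abs_sub_comm z y] at this
        simpa using this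
      simp_rw [div_eq_mul_inv] at ih
      exact ((this.ac p q).fun_mul (inv_ac h)).fun_mul ih
  have := (h1 Finset.univ).fun_mul (inv_ac h)
  simp_rw [← div_eq_mul_inv] at this
  exact this

lemma phK_deriv {n : ℕ} {B : Fin n → ℝ → ℝ} (hB : ∀ j, Lip1 1 (B j)) {x y : ℝ} (h : x ≠ y)
    (hd : ∀ j, DifferentiableAt ℝ (B j) y) : |deriv (phK B x) y| ≤ (2 * n + 1) * (1 / (x - y) ^ 2) := by
  have hxy : x - y ≠ 0 := sub_ne_zero.mpr h
  have hp : 0 < |x - y| := abs_pos.mpr hxy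
  have h1 : ∀ s : Finset (Fin n), ∃ D, HasDerivAt (fun y => ∏ j ∈ s, (B j x - B j y) / (x - y)) D y ∧ |D| ≤ 2 * s.card / |x - y| := by
    intro s
    induction s using Finset.induction_on with
    | empty => exact ⟨0, by simpa using hasDerivAt_const y (1:ℝ), by simp⟩
    | insert i s hi ih =>
      obtain ⟨D, hD, hDb⟩ := ih
      have hs : HasDerivAt (fun y => (B i x - B i y) / (x - y)) ((-deriv (B i) y * (x - y) - (B i x - B i y) * (-1)) / (x - y) ^ 2) y :=
        ((hd i).hasDerivAt.const_sub (B i x)).div ((hasDerivAt_id y).const_sub x) hxy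
      refine ⟨_, by simp_rw [Finset.prod_insert hi]; exact hs.fun_mul hD, ?_⟩
      have b1 : |(-deriv (B i) y * (x - y) - (B i x - B i y) * (-1)) / (x - y) ^ 2| ≤ 2 / |x - y| := by
        have : (-deriv (B i) y * (x - y) - (B i x - B i y) * (-1)) / (x - y) ^ 2 = (-deriv (B i) y + (B i x - B i y) / (x - y)) / (x - y) := by
          field_simp; ring
        rw [this, abs_div]
        apply div_le_div_of_nonneg_right _ hp.le
        refine (abs_add_le _ _).trans ?_
        rw [abs_neg]
        linarith [(hB i).deriv_le zero_le_one y, slope_le zero_le_one (hB i) x y]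
      have b2 : |∏ j ∈ s, (B j x - B j y) / (x - y)| ≤ 1 := by
        rw [Finset.abs_prod]
        exact Finset.prod_le_one (fun _ _ => abs_nonneg _) fun j _ => slope_le zero_le_one (hB j) x y
      refine (abs_add_le _ _).trans ?_
      have c1 := abs_mul_le_of b1 b2
      have c2 := abs_mul_le_of (slope_le zero_le_one (hB i) x y) hDb
      refine (add_le_add c1 c2).trans (le_of_eq ?_)
      rw [Finset.card_insert_of_notMem hi]; push_cast; ring
  obtain ⟨D, hD, hDb⟩ := h1 Finset.univ
  have hf : HasDerivAt (phK B x) ((D * (x - y) - (∏ j, (B j x - B j y) / (x - y)) * (-1)) / (x - y) ^ 2) y :=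
    hD.div ((hasDerivAt_id y).const_sub x) hxy
  rw [hf.deriv, abs_div, abs_of_nonneg (sq_nonneg (x - y)), mul_one_div]
  apply div_le_div_of_nonneg_right _ (sq_nonneg _)
  have b2 : |∏ j, (B j x - B j y) / (x - y)| ≤ 1 := by
    rw [Finset.abs_prod]
    exact Finset.prod_le_one (fun _ _ => abs_nonneg _) fun j _ => slope_le zero_le_one (hB j) x y
  have c1 : |D * (x - y)| ≤ 2 * n := by
    rw [abs_mul]; rw [le_div_iff₀ hp] at hDb; simpa using hDb
  rw [mul_neg_one, sub_neg_eq_add]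
  exact (abs_add_le _ _).trans (by linarith)

lemma Lip1.ae_diff {M : ℝ} {B : ℝ → ℝ} (hB : Lip1 M B) : ∀ᵐ y, DifferentiableAt ℝ B y := hB.lip.ae_differentiableAt

lemma phK_side {n : ℕ} {B : Fin n → ℝ → ℝ} (hB : ∀ j, Lip1 1 (B j)) {x p q : ℝ} (hpq : p ≤ q) (h : x ∉ uIcc p q) {H : ℝ → ℝ}
    (hH : AbsolutelyContinuousOnInterval H p q) :
    |∫ y in p..q, phK B x y * deriv H y| ≤ |H q| / |x - q| + |H p| / |x - p| + (2 * n + 1) * ∫ y in p..q, 1 / (x - y) ^ 2 * |H y| := by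
  have hne : ∀ y ∈ uIcc p q, x ≠ y := fun y hy h0 => h (h0 ▸ hy)
  rw [(phK_ac hB h).integral_mul_deriv_eq_deriv_mul hH]
  have b1 : |phK B x q * H q| ≤ |H q| / |x - q| := by
    rw [abs_mul, mul_comm, ← mul_one_div]; exact mul_le_mul_of_nonneg_left (phK_le hB x q) (abs_nonneg _)
  have b2 : |phK B x p * H p| ≤ |H p| / |x - p| := by
    rw [abs_mul, mul_comm, ← mul_one_div]; exact mul_le_mul_of_nonneg_left (phK_le hB x p) (abs_nonneg _)
  have hcont : ContinuousOn (fun y => (2 * (n:ℝ) + 1) * (1 / (x - y) ^ 2 * |H y|)) (uIcc p q) := by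
    refine continuousOn_const.mul ((continuousOn_const.div (by fun_prop) fun y hy => ?_).mul hH.continuousOn.abs)
    exact pow_ne_zero _ (sub_ne_zero.mpr (hne y hy))
  have b3 : |∫ y in p..q, deriv (phK B x) y * H y| ≤ ∫ y in p..q, (2 * n + 1) * (1 / (x - y) ^ 2 * |H y|) := by
    refine intervalIntegral.norm_integral_le_of_norm_le (μ := volume) (f := fun y => deriv (phK B x) y * H y) hpq ?_ hcont.intervalIntegrable
    have : ∀ᵐ y, ∀ j, DifferentiableAt ℝ (B j) y := ae_all_iff.mpr fun j => (hB j).ae_diff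
    filter_upwards [this] with y hy hyI
    rw [Real.norm_eq_abs, abs_mul, ← mul_assoc]
    apply mul_le_mul_of_nonneg_right _ (abs_nonneg _)
    exact phK_deriv hB (hne y (by rw [uIcc_of_le hpq]; exact Ioc_subset_Icc_self hyI)) hy
  rw [intervalIntegral.integral_const_mul] at b3
  have := abs_sub (phK B x q * H q - phK B x p * H p) (∫ y in p..q, deriv (phK B x) y * H y)
  have := abs_sub (phK B x q * H q) (phK B x p * H p)
  linarith

lemma kE_eq_ite {n : ℕ} (B : Fin n → ℝ → ℝ) (ε x y : ℝ) : kE ε B x y = if ε < |x - y| then phK B x y else 0 := rfl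

lemma BP {n : ℕ} {B : Fin n → ℝ → ℝ} (hB : ∀ j, Lip1 1 (B j)) {ε x u v K : ℝ} (hε : 0 < ε) (hu : u < x - ε) (hv : x + ε < v)
    {H : ℝ → ℝ} (hH : AbsolutelyContinuousOnInterval H u v) (hHu : H u = 0) (hHv : H v = 0)
    (h1 : |H (x - ε)| ≤ K * ε) (h2 : |H (x + ε)| ≤ K * ε) :
    |∫ y in Icc u v, kE ε B x y * deriv H y| ≤ 2 * K + (2 * n + 1) * ∫ y in Icc u v, nnE ε x y * |H y| := by
  have huv : u ≤ v := by linarith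
  have hms : MeasurableSet {y : ℝ | ε < |x - y|} := measurableSet_lt measurable_const (measurable_const.sub measurable_id).abs
  have hHc : ContinuousOn H (Icc u v) := by have := hH.continuousOn; rwa [uIcc_of_le huv] at this
  have hkm := hk_comp (kE_meas ε (fun j => (hB j).cont.measurable)) (measurable_const (a := x)) measurable_id
  have hdi : IntegrableOn (deriv H) (Icc u v) := by
    have := hH.intervalIntegrable_deriv
    rwa [intervalIntegrable_iff_integrableOn_Icc_of_le huv] at this
  have i0 : IntegrableOn (fun y => kE ε B x y * deriv H y) (Icc u v) :=
    hdi.bdd_mul (c := 1 / ε) hkm.aestronglyMeasurable (Eventually.of_forall fun y => kE_bdd hε hB x y)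
  have i1 : IntegrableOn (fun y => phK B x y * deriv H y) (Icc u v ∩ {y | ε < |x - y|}) := by
    refine (i0.mono_set inter_subset_left).congr_fun (fun y hy => ?_) (measurableSet_Icc.inter hms)
    simp only [kE_eq_ite]; rw [if_pos (show ε < |x - y| from hy.2)]
  have hnm := hk_comp (nnE_meas ε) (measurable_const (a := x)) measurable_id
  have j0 : IntegrableOn (fun y => nnE ε x y * |H y|) (Icc u v) :=
    (hHc.abs.integrableOn_Icc).bdd_mul (c := 1 / ε ^ 2) hnm.aestronglyMeasurable (Eventually.of_forall fun y => nnE_bdd hε x y)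
  have j1 : IntegrableOn (fun y => 1 / (x - y) ^ 2 * |H y|) (Icc u v ∩ {y | ε < |x - y|}) := by
    refine (j0.mono_set inter_subset_left).congr_fun (fun y hy => ?_) (measurableSet_Icc.inter hms)
    simp only [nnE]; rw [if_pos (show ε < |x - y| from hy.2)]
  have e1 : ∫ y in Icc u v, kE ε B x y * deriv H y = ∫ y in Icc u v, (if ε < |x - y| then phK B x y * deriv H y else 0) := by
    simp only [kE_eq_ite, ite_mul, zero_mul]
  have e2 : ∫ y in Icc u v, nnE ε x y * |H y| = ∫ y in Icc u v, (if ε < |x - y| then 1 / (x - y) ^ 2 * |H y| else 0) := by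
    simp only [nnE, ite_mul, zero_mul]
  rw [e1, e2, trunc_split hε (by linarith) (by linarith) _ i1, trunc_split hε (by linarith) (by linarith) _ j1,
    max_eq_right hu.le, min_eq_right hv.le]
  have s1 := phK_side hB (x := x) (p := u) (q := x - ε) (by linarith) (by
    rw [uIcc_of_le (by linarith)]; intro hh; linarith [hh.2]) (hH.mono (by
    rw [uIcc_of_le (by linarith), uIcc_of_le (by linarith)]; exact Icc_subset_Icc (by linarith) (by linarith)))
  have s2 := phK_side hB (x := x) (p := x + ε) (q := v) (by linarith) (by
    rw [uIcc_of_le (by linarith)]; intro hh; linarith [hh.1]) (hH.mono (by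
    rw [uIcc_of_le (by linarith), uIcc_of_le (by linarith)]; exact Icc_subset_Icc (by linarith) (by linarith)))
  rw [hHu] at s1; rw [hHv] at s2
  have t1 : |H (x - ε)| / |x - (x - ε)| ≤ K := by
    rw [show x - (x - ε) = ε by ring, abs_of_pos hε, div_le_iff₀ hε]; exact h1
  have t2 : |H (x + ε)| / |x - (x + ε)| ≤ K := by
    rw [show x - (x + ε) = -ε by ring, abs_neg, abs_of_pos hε, div_le_iff₀ hε]; exact h2
  simp only [abs_zero, zero_div] at s1 s2
  refine (abs_add_le _ _).trans ?_
  rw [mul_add]; linarith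

lemma prod_sub_le {n : ℕ} {M e : ℝ} (hM : 0 ≤ M) (he : 0 ≤ e) {u v : Fin n → ℝ} (s : Finset (Fin n)) (hu : ∀ j, |u j| ≤ M) (hv : ∀ j, |v j| ≤ M)
    (h : ∀ j, |u j - v j| ≤ M * e) : |∏ j ∈ s, u j - ∏ j ∈ s, v j| ≤ s.card * M ^ s.card * e := by
  induction s using Finset.induction_on with
  | empty => simp
  | insert i s hi ih =>
    rw [Finset.prod_insert hi, Finset.prod_insert hi, Finset.card_insert_of_notMem hi]
    have e1 : u i * ∏ j ∈ s, u j - v i * ∏ j ∈ s, v j = (u i - v i) * ∏ j ∈ s, u j + v i * (∏ j ∈ s, u j - ∏ j ∈ s, v j) := by ring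
    have b : |∏ j ∈ s, u j| ≤ M ^ s.card := by
      rw [Finset.abs_prod]; exact (Finset.prod_le_prod (fun _ _ => abs_nonneg _) fun j _ => hu j).trans (by simp)
    rw [e1]
    refine (abs_add_le _ _).trans ((add_le_add (abs_mul_le_of (h i) b) (abs_mul_le_of (hv i) ih)).trans (le_of_eq ?_))
    push_cast; ring

/-! ### Local weak type estimate for commutators with integrable data -/

lemma markov {μ : Measure ℝ} {φ : ℝ → ℝ≥0∞} (hφ : AEMeasurable φ μ) {s b : ℝ} (hs : 0 < s) (h : ∫⁻ x, φ x ∂μ ≤ ENNReal.ofReal b) :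
    μ {x | ENNReal.ofReal s < φ x} ≤ ENNReal.ofReal (b / s) := by
  have h1 := mul_meas_ge_le_lintegral₀ hφ (ENNReal.ofReal s)
  have hs0 : ENNReal.ofReal s ≠ 0 := by simpa using hs
  rw [ENNReal.ofReal_div_of_pos hs, ENNReal.le_div_iff_mul_le (Or.inl hs0) (Or.inl ENNReal.ofReal_ne_top), mul_comm]
  refine le_trans ?_ (h1.trans h)
  gcongr
  intro hx; exact le_of_lt hx

lemma abs_int_le_toReal {s : Set ℝ} {p : ℝ → ℝ} {φ : ℝ → ℝ≥0∞} {b : ℝ} (hb : 0 ≤ b) (h : ∀ y, ENNReal.ofReal |p y| ≤ φ y) (h2 : ∫⁻ y, φ y ≤ ENNReal.ofReal b) :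
    |∫ y in s, p y| ≤ b := by
  have h3 : ‖∫ y in s, p y‖ₑ ≤ ENNReal.ofReal b := by
    refine (enorm_integral_le_lintegral_enorm _).trans (le_trans ?_ h2)
    refine (lintegral_mono' Measure.restrict_le_self le_rfl).trans (lintegral_mono fun y => ?_)
    rw [← ofReal_norm_eq_enorm, Real.norm_eq_abs]; exact h y
  rw [← ofReal_norm_eq_enorm, Real.norm_eq_abs] at h3
  exact (ENNReal.ofReal_le_ofReal_iff hb).mp h3

noncomputable def prim (c : ℝ) (a : ℝ → ℝ) (x : ℝ) : ℝ := ∫ t in c..x, a t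

lemma Bad_supp {g : ℝ → ℝ} (hg : Integrable g) (h0 : ∀ x, 0 ≤ g x) {c r M : ℝ} (hr : 0 < r) (hM : 1 ≤ M) (hgr : ∫ x, g x ≤ r)
    (hsupp : ∀ y ∉ Icc (c - r) (c + r), g y = 0) : Bad g M ⊆ Icc (c - 3 * r) (c + 3 * r) := by
  rintro x ⟨ρ, hρ, hx⟩
  have h1 : ∫ y in Icc (x - ρ) (x + ρ), g y ≤ r := (setIntegral_le_integral hg (Eventually.of_forall h0)).trans hgr
  have h2 : ρ < r := by nlinarith
  by_contra hn
  have : ∫ y in Icc (x - ρ) (x + ρ), g y = 0 := by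
    apply setIntegral_eq_zero_of_forall_eq_zero
    intro y hy
    apply hsupp
    intro hy2
    exact hn ⟨by linarith [hy.1, hy.2, hy2.1, hy2.2], by linarith [hy.1, hy.2, hy2.1, hy2.2]⟩
  rw [this] at hx; nlinarith

/-- The decomposition at a good point. -/
lemma L2_point {n : ℕ} {M : ℝ} (hM : 1 ≤ M) {a : Fin n → ℝ → ℝ} {f : ℝ → ℝ} {ε c r : ℝ} (hε : 0 < ε) (hr : 0 < r)
    (ha : ∀ j, Integrable (a j)) (hf : Integrable f)
    {E : Set ℝ} (hEa : ∀ x ∈ E, ∀ j, x ∉ Bad (fun y => |a j y|) M) (hEf : ∀ x ∈ E, x ∉ Bad (fun y => |f y|) M)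
    (hEc : IsClosed E) (hE3 : Eᶜ ⊆ Icc (c - 3 * r) (c + 3 * r)) (hfs : ∀ y ∉ Icc (c - r) (c + r), f y = 0) :
    ∃ (B : Fin n → ℝ → ℝ) (g : ℝ → ℝ), (∀ j, Lip1 1 (B j)) ∧ Measurable g ∧ (∀ x, |g x| ≤ 1) ∧
      ∀ x ∈ E, x ∈ Icc (c - r) (c + r) → ∀ s1 s2 : ℝ, 0 ≤ s1 → 0 ≤ s2 →
        ∫⁻ y, ENNReal.ofReal |f y| * ENNReal.ofReal (Metric.infDist y E * nnE ε x y) ≤ ENNReal.ofReal s1 →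
        ∫⁻ y, (Eᶜ).indicator (fun _ => 1) y * ENNReal.ofReal (Metric.infDist y E * nnE ε x y) ≤ ENNReal.ofReal s2 →
        |∫ y, kE ε (fun j => prim c (a j)) x y * f y| ≤ 2 * n * M ^ n * s1 + M ^ n * (4 * M + (2 * n + 1) * (2 * M * s2)) +
          M ^ (n + 1) * |∫ y in Icc (c - 3 * r) (c + 3 * r), kE ε B x y * g y| := by
  have hM0 : 0 < M := by linarith
  have hEne : E.Nonempty := by
    by_contra hne
    rw [not_nonempty_iff_eq_empty] at hne
    rw [hne, compl_empty] at hE3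
    have := hE3 (mem_univ (c + 4 * r))
    linarith [this.2]
  choose B hB hBE hBx hBd using fun j => lip_mod (ha j) hM0 c (E := E) (fun x hx => hEa x hx j)
  obtain ⟨Bf, hBf, hBfE, hBfx, hBfd⟩ := lip_mod hf hM0 c (E := E) hEf
  refine ⟨B, deriv Bf, hB, measurable_deriv _, fun x => hBf.deriv_le zero_le_one x, ?_⟩
  intro x hxE hxI s1 s2 hs1 hs2 hL1 hL2
  set u := c - 3 * r - ε - 1 with hu
  set v := c + 3 * r + ε + 1 with hv
  set A : Fin n → ℝ → ℝ := fun j => prim c (a j) with hA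
  have hAcont : ∀ j, Continuous (A j) := fun j => intervalIntegral.continuous_primitive (fun x y => (ha j).intervalIntegrable) c
  set H : ℝ → ℝ := fun y => prim c f y - M * Bf y with hH
  have hd0 : ∀ y ∈ E, Metric.infDist y E = 0 := fun y hy => Metric.infDist_zero_of_mem hy
  have hHE : ∀ y ∈ E, H y = 0 := fun y hy => by simp only [hH, prim]; rw [hBfE y hy]; ring
  have hHle : ∀ y, |H y| ≤ 2 * M * Metric.infDist y E := fun y => hBfd y hEne
  have hHx : ∀ y, |H y| ≤ 2 * M * |x - y| := fun y => (hHle y).trans (mul_le_mul_of_nonneg_left (by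
    rw [abs_sub_comm, ← Real.dist_eq]; exact Metric.infDist_le_dist_of_mem hxE) (by positivity))
  have hout : ∀ y, y ∉ Icc (c - 3 * r) (c + 3 * r) → y ∈ E := fun y hy => by
    by_contra h; exact hy (hE3 h)
  have huv : u ≤ v := by simp only [hu, hv]; linarith
  have hHac : AbsolutelyContinuousOnInterval H u v := by
    have e1 : AbsolutelyContinuousOnInterval (prim c f) u v :=
      IntervalIntegrable.absolutelyContinuousOnInterval_intervalIntegral (a := u) (b := v) hf.intervalIntegrable (by
        rw [uIcc_of_le huv]; simp only [hu, hv]; constructor <;> linarith)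
    exact e1.fun_sub ((hBf.ac u v).const_mul M)
  have hdH : ∀ᵐ y, f y = deriv H y + M * deriv Bf y := by
    filter_upwards [LocallyIntegrable.ae_hasDerivAt_integral hf.locallyIntegrable, hBf.ae_diff] with y h1 h2
    have h3 : HasDerivAt H (f y - M * deriv Bf y) y := (h1 c).sub (h2.hasDerivAt.const_mul M)
    rw [h3.deriv]; ring
  have hkBm := hk_comp (kE_meas ε (fun j => (hB j).cont.measurable)) (measurable_const (a := x)) measurable_id
  have hkAm := hk_comp (kE_meas ε (fun j => (hAcont j).measurable)) (measurable_const (a := x)) measurable_id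
  -- slope bounds
  have hsA : ∀ j y, |(A j x - A j y) / (x - y)| ≤ M := fun j y => by
    rw [abs_div]; exact div_le_of_le_mul₀ (abs_nonneg _) hM0.le (hBx j x hxE y)
  have hsB : ∀ j y, |M * ((B j x - B j y) / (x - y))| ≤ M := fun j y => by
    rw [abs_mul, abs_of_pos hM0]
    exact mul_le_of_le_one_right hM0.le (slope_le zero_le_one (hB j) x y)
  have hkd : ∀ y, |kE ε A x y - M ^ n * kE ε B x y| ≤ 2 * n * M ^ n * (Metric.infDist y E * nnE ε x y) := by
    intro y
    unfold kE nnE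
    split_ifs with h
    · have hp : 0 < |x - y| := hε.trans h
      rw [← mul_div_assoc, ← sub_div, abs_div]
      have e1 : M ^ n * ∏ j, (B j x - B j y) / (x - y) = ∏ j, (M * ((B j x - B j y) / (x - y))) := by
        rw [Finset.prod_mul_distrib]; simp
      rw [e1]
      have := prod_sub_le hM0.le (e := 2 * Metric.infDist y E / |x - y|) (div_nonneg (mul_nonneg two_pos.le Metric.infDist_nonneg) hp.le) Finset.univ
        (fun j => hsA j y) (fun j => hsB j y) (fun j => by
          have e2 : (A j x - A j y) / (x - y) - M * ((B j x - B j y) / (x - y)) = - (A j y - M * B j y) / (x - y) := by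
            have : A j x = M * B j x := (hBE j x hxE).symm
            rw [this]; ring
          rw [e2, abs_div, abs_neg, ← mul_div_assoc]
          apply div_le_div_of_nonneg_right _ hp.le
          have := hBd j y hEne
          calc _ ≤ 2 * M * Metric.infDist y E := this
            _ = _ := by ring)
      rw [Finset.card_univ, Fintype.card_fin] at this
      rw [div_le_iff₀ hp]
      refine this.trans (le_of_eq ?_)
      rw [← sq_abs (x - y)]; field_simp
    · simp
  have hfI : Integrable fun y => kE ε B x y * f y :=
    hf.bdd_mul (c := 1 / ε) hkBm.aestronglyMeasurable (Eventually.of_forall fun y => kE_bdd hε hB x y)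
  have hdI : Integrable fun y => (kE ε A x y - M ^ n * kE ε B x y) * f y := by
    refine hf.bdd_mul (c := M ^ n / ε + M ^ n * (1 / ε)) (hkAm.sub (hkBm.const_mul _)).aestronglyMeasurable (Eventually.of_forall fun y => ?_)
    rw [Real.norm_eq_abs]
    refine (abs_sub _ _).trans (add_le_add ?_ ?_)
    · unfold kE; split_ifs with h
      · rw [abs_div, Finset.abs_prod]
        refine div_le_div₀ (by positivity) ?_ hε h.le
        exact (Finset.prod_le_prod (fun _ _ => abs_nonneg _) fun j _ => hsA j y).trans (by simp)
      · simp; positivity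
    · rw [abs_mul, abs_of_pos (by positivity)]
      exact mul_le_mul_of_nonneg_left (kE_bdd hε hB x y) (by positivity)
  have e0 : ∫ y, kE ε A x y * f y = (∫ y, (kE ε A x y - M ^ n * kE ε B x y) * f y) + M ^ n * ∫ y, kE ε B x y * f y := by
    rw [← integral_const_mul, ← integral_add hdI (hfI.const_mul _)]
    congr 1; ext y; ring
  have e1 : ∫ y, kE ε B x y * f y = ∫ y in Icc u v, kE ε B x y * f y := by
    rw [setIntegral_eq_integral_of_forall_compl_eq_zero]
    intro y hy
    rw [hfs y fun h => hy ?_, mul_zero]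
    exact ⟨by simp only [hu]; linarith [h.1], by simp only [hv]; linarith [h.2]⟩
  have hdHi : IntegrableOn (deriv H) (Icc u v) := by
    have := hHac.intervalIntegrable_deriv
    rwa [intervalIntegrable_iff_integrableOn_Icc_of_le huv] at this
  have i1 : IntegrableOn (fun y => kE ε B x y * deriv H y) (Icc u v) :=
    hdHi.bdd_mul (c := 1 / ε) hkBm.aestronglyMeasurable (Eventually.of_forall fun y => kE_bdd hε hB x y)
  have i2 : IntegrableOn (fun y => kE ε B x y * deriv Bf y) (Icc u v) := by
    refine int_bdd (C := 1 / ε * 1) (hkBm.mul (measurable_deriv _)) fun y => ?_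
    exact abs_mul_le_of (kE_bdd hε hB x y) (hBf.deriv_le zero_le_one y)
  have e2 : ∫ y in Icc u v, kE ε B x y * f y = (∫ y in Icc u v, kE ε B x y * deriv H y) + M * ∫ y in Icc u v, kE ε B x y * deriv Bf y := by
    rw [← integral_const_mul, ← integral_add i1 (i2.const_mul _)]
    apply integral_congr_ae
    filter_upwards [ae_restrict_of_ae hdH] with y hy
    rw [hy]; ring
  have hg0 : ∀ y, y ∉ Icc (c - 3 * r) (c + 3 * r) → deriv Bf y = 0 := by
    intro y hy
    have hop : IsOpen (Icc (c - 3 * r) (c + 3 * r))ᶜ := isClosed_Icc.isOpen_compl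
    have hcst : ∃ k : ℝ, ∀ᶠ z in nhds y, M * Bf z = k := by
      rw [mem_Icc, not_and_or, not_le, not_le] at hy
      rcases hy with hy | hy
      · refine ⟨∫ t in c..(c - 3 * r), f t, ?_⟩
        filter_upwards [Iio_mem_nhds hy] with z hz
        rw [mem_Iio] at hz
        rw [hBfE z (hout z fun h => by linarith [h.1]), ← intervalIntegral.integral_add_adjacent_intervals (b := c - 3 * r) hf.intervalIntegrable hf.intervalIntegrable,
          add_eq_left, intervalIntegral.integral_symm, intervalIntegral.integral_of_le hz.le, neg_eq_zero]
        exact setIntegral_eq_zero_of_forall_eq_zero fun t ht => hfs t fun h => by linarith [h.1, ht.2]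
      · refine ⟨∫ t in c..(c + 3 * r), f t, ?_⟩
        filter_upwards [Ioi_mem_nhds hy] with z hz
        rw [mem_Ioi] at hz
        rw [hBfE z (hout z fun h => by linarith [h.2]), ← intervalIntegral.integral_add_adjacent_intervals (b := c + 3 * r) hf.intervalIntegrable hf.intervalIntegrable,
          add_eq_left, intervalIntegral.integral_of_le hz.le]
        exact setIntegral_eq_zero_of_forall_eq_zero fun t ht => hfs t fun h => by linarith [h.2, ht.1]
    obtain ⟨k, hk⟩ := hcst
    have : Bf =ᶠ[nhds y] fun _ => k / M := by
      filter_upwards [hk] with z hz; rw [← hz]; field_simp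
    rw [this.deriv_eq]; simp
  have e3 : ∫ y in Icc u v, kE ε B x y * deriv Bf y = ∫ y in Icc (c - 3 * r) (c + 3 * r), kE ε B x y * deriv Bf y := by
    apply setIntegral_eq_of_subset_of_forall_sdiff_eq_zero measurableSet_Icc
    · exact Icc_subset_Icc (by simp only [hu]; linarith) (by simp only [hv]; linarith)
    · intro y hy; rw [hg0 y hy.2, mul_zero]
  have b1 : |∫ y, (kE ε A x y - M ^ n * kE ε B x y) * f y| ≤ 2 * n * M ^ n * s1 := by
    have := abs_int_le_toReal (s := univ) (p := fun y => (kE ε A x y - M ^ n * kE ε B x y) * f y)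
      (φ := fun y => ENNReal.ofReal (2 * n * M ^ n) * (ENNReal.ofReal |f y| * ENNReal.ofReal (Metric.infDist y E * nnE ε x y)))
      (b := 2 * n * M ^ n * s1) (by positivity) (fun y => by
        rw [← ENNReal.ofReal_mul (abs_nonneg _), ← ENNReal.ofReal_mul (by positivity), abs_mul]
        apply ENNReal.ofReal_le_ofReal
        have := mul_le_mul_of_nonneg_right (hkd y) (abs_nonneg (f y))
        linarith) (by
        rw [lintegral_const_mul' _ _ ENNReal.ofReal_ne_top, ENNReal.ofReal_mul (p := 2 * n * M ^ n) (by positivity)]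
        exact mul_le_mul' le_rfl hL1)
    simpa using this
  have b2 : ∫ y in Icc u v, nnE ε x y * |H y| ≤ 2 * M * s2 := by
    refine (le_abs_self _).trans (abs_int_le_toReal (φ := fun y => ENNReal.ofReal (2 * M) * ((Eᶜ).indicator (fun _ => 1) y * ENNReal.ofReal (Metric.infDist y E * nnE ε x y))) (by positivity) (fun y => ?_) ?_)
    · by_cases hy : y ∈ E
      · rw [hHE y hy]; simp
      · rw [indicator_of_mem (by exact hy), one_mul, ← ENNReal.ofReal_mul (by positivity)]
        apply ENNReal.ofReal_le_ofReal
        rw [abs_mul, abs_abs, abs_of_nonneg (nnE_nonneg ε x y)]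
        have := mul_le_mul_of_nonneg_left (hHle y) (nnE_nonneg ε x y)
        linarith
    · rw [lintegral_const_mul' _ _ ENNReal.ofReal_ne_top, ENNReal.ofReal_mul (p := 2 * M) (by positivity)]
      exact mul_le_mul' le_rfl hL2
  have b3 := BP hB (ε := ε) (x := x) (u := u) (v := v) (K := 2 * M) hε (by simp only [hu]; linarith [hxI.1]) (by simp only [hv]; linarith [hxI.2]) hHac
    (hHE u (hout u fun h => by simp only [hu] at h; linarith [h.1])) (hHE v (hout v fun h => by simp only [hv] at h; linarith [h.2]))
    (by have := hHx (x - ε); rwa [show x - (x - ε) = ε by ring, abs_of_pos hε] at this)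
    (by have := hHx (x + ε); rwa [show x - (x + ε) = -ε by ring, abs_neg, abs_of_pos hε] at this)
  rw [e0, e1, e2, e3]
  have b4 : |∫ y in Icc u v, kE ε B x y * deriv H y| ≤ 4 * M + (2 * n + 1) * (2 * M * s2) := by
    refine b3.trans (add_le_add (by linarith) (mul_le_mul_of_nonneg_left b2 (by positivity)))
  rw [mul_add]
  refine (abs_add_le _ _).trans ?_
  rw [add_assoc]
  refine add_le_add b1 ((abs_add_le _ _).trans (add_le_add ?_ (le_of_eq ?_)))
  · rw [abs_mul, abs_of_pos (by positivity)]
    exact mul_le_mul_of_nonneg_left b4 (by positivity)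
  · rw [← mul_assoc, abs_mul, abs_of_pos (by positivity), pow_succ]

lemma L2 (n : ℕ) {δ : ℝ} (hδ : 0 < δ) : ∃ C : ℝ, 0 < C ∧ ∀ (a : Fin n → ℝ → ℝ) (f : ℝ → ℝ) (ε c r : ℝ), 0 < ε → 0 < r →
    (∀ j, Integrable (a j)) → Integrable f → Measurable f → (∀ j, ∀ y ∉ Icc (c - r) (c + r), a j y = 0) → (∀ y ∉ Icc (c - r) (c + r), f y = 0) →
    (∀ j, ∫ y, |a j y| ≤ r) → ∫ y, |f y| ≤ r →
    volume {x ∈ Icc (c - r) (c + r) | C < |∫ y, kE ε (fun j => prim c (a j)) x y * f y|} ≤ ENNReal.ofReal (δ * r) := by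
  obtain ⟨W, hW, hL⟩ := L1 n (δ := δ / 24) (by positivity)
  set M : ℝ := 40 * (n + 1) / δ + 1 with hM
  set τ : ℝ := √(24 * W / δ) with hτ
  have hτ0 : 0 < τ := Real.sqrt_pos.mpr (by positivity)
  have hM1 : 1 ≤ M := by simp only [hM]; linarith [show 0 < 40 * ((n : ℝ) + 1) / δ by positivity]
  have hM0 : 0 < M := by linarith
  have hMd : 10 * (n + 1) / M ≤ δ / 4 := by
    rw [div_le_iff₀ hM0, hM, mul_add (δ / 4)]
    have : δ / 4 * (40 * (n + 1) / δ) = 10 * (n + 1) := by field_simp; norm_num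
    rw [this]; linarith
  refine ⟨2 * n * M ^ n * (16 / δ) + M ^ n * (4 * M + (2 * n + 1) * (2 * M * 8)) + M ^ (n + 1) * τ, by positivity, ?_⟩
  intro a f ε c r hε hr ha hf hfm has hfs ha1 hf1
  set Ω : Set ℝ := (⋃ j, Bad (fun y => |a j y|) M) ∪ Bad (fun y => |f y|) M with hΩ
  have hΩo : IsOpen Ω := (isOpen_iUnion fun j => Bad_open (ha j).abs (fun _ => abs_nonneg _) hM0).union (Bad_open hf.abs (fun _ => abs_nonneg _) hM0)
  have hΩ3 : Ω ⊆ Icc (c - 3 * r) (c + 3 * r) := by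
    refine union_subset (iUnion_subset fun j => ?_) ?_
    · exact Bad_supp (ha j).abs (fun _ => abs_nonneg _) hr hM1 (ha1 j) (fun y hy => by simp [has j y hy])
    · exact Bad_supp hf.abs (fun _ => abs_nonneg _) hr hM1 hf1 (fun y hy => by simp [hfs y hy])
  have hΩv : volume Ω ≤ ENNReal.ofReal (δ / 4 * r) := by
    have e : ∀ g : ℝ → ℝ, Integrable g → ∫ y, |g y| ≤ r → volume (Bad (fun y => |g y|) M) ≤ ENNReal.ofReal (10 / M * r) := fun g hg h1 =>
      (Bad_weak hg.abs (fun _ => abs_nonneg _) hM0).trans (ENNReal.ofReal_le_ofReal (by gcongr))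
    calc volume Ω ≤ volume (⋃ j, Bad (fun y => |a j y|) M) + volume (Bad (fun y => |f y|) M) := measure_union_le _ _
      _ ≤ ∑ j : Fin n, ENNReal.ofReal (10 / M * r) + ENNReal.ofReal (10 / M * r) := by
        refine add_le_add ((measure_iUnion_fintype_le _ _).trans (Finset.sum_le_sum fun j _ => e _ (ha j) (ha1 j))) (e _ hf hf1)
      _ = ENNReal.ofReal (10 * (n + 1) / M * r) := by
        rw [← ENNReal.ofReal_sum_of_nonneg (fun _ _ => by positivity), ← ENNReal.ofReal_add (Finset.sum_nonneg fun _ _ => by positivity) (by positivity)]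
        congr 1; simp; ring
      _ ≤ _ := ENNReal.ofReal_le_ofReal (by gcongr)
  have hEc : IsClosed Ωᶜ := hΩo.isClosed_compl
  obtain ⟨B, g, hB, hgm, hg1, hpt⟩ := L2_point (M := M) hM1 (a := a) (f := f) (ε := ε) (c := c) (r := r) (E := Ωᶜ) hε hr ha hf
    (fun x hx j h => hx (Or.inl (mem_iUnion.mpr ⟨j, h⟩))) (fun x hx h => hx (Or.inr h)) hEc (by rwa [compl_compl]) hfs
  obtain ⟨G, hG, hGv, hGi⟩ := hL B ε c (3 * r) hB hε (by positivity)
  have hGi := hGi g 1 hgm hg1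
  set Φ1 : ℝ → ℝ≥0∞ := fun x => ∫⁻ y, ENNReal.ofReal |f y| * ENNReal.ofReal (Metric.infDist y Ωᶜ * nnE ε x y) with hΦ1
  set Φ2 : ℝ → ℝ≥0∞ := fun x => ∫⁻ y, (Ωᶜᶜ).indicator (fun _ => 1) y * ENNReal.ofReal (Metric.infDist y Ωᶜ * nnE ε x y) with hΦ2
  set I3 : Set ℝ := Icc (c - 3 * r) (c + 3 * r) with hI3
  set Tg : ℝ → ℝ := TT (volume.restrict I3) (kE ε B) g with hTg
  have hkm := kE_meas ε (fun j => (hB j).cont.measurable)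
  have hw1 : Measurable fun y => ENNReal.ofReal |f y| := (continuous_abs.measurable.comp hfm).ennreal_ofReal
  have hw2 : Measurable ((Ωᶜᶜ).indicator (fun _ => (1 : ℝ≥0∞))) := measurable_const.indicator (hEc.measurableSet.compl)
  have hΦm : ∀ w : ℝ → ℝ≥0∞, Measurable w → Measurable fun x => ∫⁻ y, w y * ENNReal.ofReal (Metric.infDist y Ωᶜ * nnE ε x y) := fun w hw =>
    Measurable.lintegral_prod_right' (f := fun p : ℝ × ℝ => w p.2 * ENNReal.ofReal (Metric.infDist p.2 Ωᶜ * nnE ε p.1 p.2))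
      ((hw.comp measurable_snd).mul (((Metric.continuous_infDist_pt _).measurable.comp measurable_snd).mul (nnE_meas ε)).ennreal_ofReal)
  have v1 : volume.restrict Ωᶜ {x | ENNReal.ofReal (16 / δ) < Φ1 x} ≤ ENNReal.ofReal (δ / 4 * r) := by
    have := markov (μ := volume.restrict Ωᶜ) (φ := Φ1) (hΦm _ hw1).aemeasurable (s := 16 / δ) (b := 4 * r) (by positivity) (by
      refine (marc hEc.measurableSet _ hw1 hε).trans ?_
      rw [ENNReal.ofReal_mul (by norm_num), ← ofReal_integral_eq_lintegral_ofReal hf.abs (Eventually.of_forall fun _ => abs_nonneg _)]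
      refine mul_le_mul' (by simp) (ENNReal.ofReal_le_ofReal hf1))
    rwa [show 4 * r / (16 / δ) = δ / 4 * r by field_simp; norm_num] at this
  have v2 : volume.restrict Ωᶜ {x | ENNReal.ofReal 8 < Φ2 x} ≤ ENNReal.ofReal (δ / 8 * r) := by
    have := markov (μ := volume.restrict Ωᶜ) (φ := Φ2) (hΦm _ hw2).aemeasurable (s := 8) (b := 4 * (δ / 4 * r)) (by positivity) (by
      refine (marc hEc.measurableSet _ hw2 hε).trans ?_
      rw [ENNReal.ofReal_mul (by norm_num), lintegral_indicator_const hEc.measurableSet.compl, one_mul, compl_compl]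
      refine mul_le_mul' (by simp) hΩv)
    rwa [show 4 * (δ / 4 * r) / 8 = δ / 8 * r by ring] at this
  have v3 : volume (I3 \ G) ≤ ENNReal.ofReal (δ / 8 * r) := by
    rw [← ofReal_measureReal (measure_ne_top_of_subset sdiff_subset (by simp [hI3]))]
    exact ENNReal.ofReal_le_ofReal (hGv.trans (le_of_eq (by ring)))
  have v4 : volume.restrict (I3 ∩ G) {x | ENNReal.ofReal (τ ^ 2) < ENNReal.ofReal (Tg x ^ 2)} ≤ ENNReal.ofReal (δ / 4 * r) := by
    haveI : IsFiniteMeasure (volume.restrict I3) := ⟨by simp [hI3]⟩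
    haveI : IsFiniteMeasure (volume.restrict (I3 ∩ G)) := ⟨by
      rw [Measure.restrict_apply_univ]; exact (measure_mono inter_subset_left).trans_lt (by simp [hI3])⟩
    have hTm : Measurable Tg := TT_meas hkm hgm
    have hTb := TT_bdd (μ := volume.restrict I3) (fun x y => kE_bdd hε hB x y) hg1
    have := markov (μ := volume.restrict (I3 ∩ G)) (φ := fun x => ENNReal.ofReal (Tg x ^ 2)) (hTm.pow_const 2).ennreal_ofReal.aemeasurable (s := τ ^ 2) (b := W * (6 * r)) (by positivity) (by
      rw [← ofReal_integral_eq_lintegral_ofReal _ (Eventually.of_forall fun _ => sq_nonneg _)]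
      · apply ENNReal.ofReal_le_ofReal
        refine hGi.trans (mul_le_mul_of_nonneg_left ?_ hW.le)
        calc ∫ x in I3, g x ^ 2 ≤ ∫ x in I3, (1 : ℝ) := by
              refine integral_mono_of_nonneg (Eventually.of_forall fun _ => sq_nonneg _) (integrable_const _) (Eventually.of_forall fun x => ?_)
              show g x ^ 2 ≤ 1
              rw [← sq_abs]; have := hg1 x; have := abs_nonneg (g x); nlinarith
          _ ≤ _ := by simp [hI3, Real.volume_real_Icc]; constructor <;> linarith
      · refine int_bdd (C := (1 / ε * 1 * (volume.restrict I3).real univ) * (1 / ε * 1 * (volume.restrict I3).real univ)) (hTm.pow_const 2) fun x => ?_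
        rw [sq, abs_mul]; exact mul_le_mul (hTb x) (hTb x) (abs_nonneg _) ((abs_nonneg _).trans (hTb x)))
    have e : W * (6 * r) / τ ^ 2 = δ / 4 * r := by
      rw [hτ, Real.sq_sqrt (by positivity)]; field_simp; norm_num
    rwa [e] at this
  have hsub : {x ∈ Icc (c - r) (c + r) | 2 * n * M ^ n * (16 / δ) + M ^ n * (4 * M + (2 * n + 1) * (2 * M * 8)) + M ^ (n + 1) * τ < |∫ y, kE ε (fun j => prim c (a j)) x y * f y|} ⊆
      Ω ∪ ({x | ENNReal.ofReal (16 / δ) < Φ1 x} ∩ Ωᶜ) ∪ ({x | ENNReal.ofReal 8 < Φ2 x} ∩ Ωᶜ) ∪ (I3 \ G) ∪ ({x | ENNReal.ofReal (τ ^ 2) < ENNReal.ofReal (Tg x ^ 2)} ∩ (I3 ∩ G)) := by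
    rintro x ⟨hxI, hx⟩
    by_contra hn
    simp only [mem_union, not_or] at hn
    obtain ⟨⟨⟨⟨n1, n2⟩, n3⟩, n4⟩, n5⟩ := hn
    have hx3 : x ∈ I3 := ⟨by linarith [hxI.1], by linarith [hxI.2]⟩
    have hxG : x ∈ G := by by_contra h; exact n4 ⟨hx3, h⟩
    have m1 : Φ1 x ≤ ENNReal.ofReal (16 / δ) := by by_contra h; exact n2 ⟨not_le.mp h, n1⟩
    have m2 : Φ2 x ≤ ENNReal.ofReal 8 := by by_contra h; exact n3 ⟨not_le.mp h, n1⟩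
    have m3 : Tg x ^ 2 ≤ τ ^ 2 := by
      by_contra h; exact n5 ⟨(ENNReal.ofReal_lt_ofReal_iff (lt_of_le_of_lt (sq_nonneg _) (not_le.mp h))).mpr (not_le.mp h), hx3, hxG⟩
    have m4 : |Tg x| ≤ τ := abs_le_of_sq_le_sq' m3 hτ0.le |> abs_le.mpr
    have := hpt x n1 hxI (16 / δ) 8 (by positivity) (by norm_num) m1 m2
    refine absurd (hx.trans_le this) (not_lt.mpr ?_)
    gcongr
    exact m4
  refine (measure_mono hsub).trans ?_
  rw [Measure.restrict_apply' hEc.measurableSet] at v1 v2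
  rw [Measure.restrict_apply' (measurableSet_Icc.inter hG)] at v4
  refine (measure_union_le _ _).trans ((add_le_add ((measure_union_le _ _).trans (add_le_add ((measure_union_le _ _).trans (add_le_add ((measure_union_le _ _).trans (add_le_add hΩv v1)) v2)) v3)) v4).trans (le_of_eq ?_))
  rw [← ENNReal.ofReal_add (by positivity) (by positivity), ← ENNReal.ofReal_add (by positivity) (by positivity), ← ENNReal.ofReal_add (by positivity) (by positivity), ← ENNReal.ofReal_add (by positivity) (by positivity)]
  congr 1; ring

/-! ### BMO functions and the John-Nirenberg inequality -/

noncomputable def av (b : ℝ → ℝ) (c r : ℝ) : ℝ := (2 * r)⁻¹ * ∫ y in Icc (c - r) (c + r), b y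

def BM1 (b : ℝ → ℝ) : Prop := Measurable b ∧ LocallyIntegrable b volume ∧ ∀ c r, 0 < r → ∫ y in Icc (c - r) (c + r), |b y - av b c r| ≤ 2 * r

lemma BM1.intOn {b : ℝ → ℝ} (hb : BM1 b) (k u v : ℝ) : IntegrableOn (fun y => b y - k) (Icc u v) :=
  (hb.2.1.integrableOn_isCompact isCompact_Icc).sub (integrableOn_const (by simp))

/-- averages over nested intervals -/
lemma av_sub {b : ℝ → ℝ} (hb : BM1 b) {k c r C R : ℝ} (hr : 0 < r) (h : Icc (c - r) (c + r) ⊆ Icc (C - R) (C + R)) :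
    |av b c r - k| ≤ (2 * r)⁻¹ * ∫ y in Icc (C - R) (C + R), |b y - k| := by
  have e : av b c r - k = (2 * r)⁻¹ * ∫ y in Icc (c - r) (c + r), (b y - k) := by
    rw [integral_sub (hb.2.1.integrableOn_isCompact isCompact_Icc) (integrableOn_const (by simp))]
    simp [av, Real.volume_real_Icc]
    rw [max_eq_left (by linarith)]; field_simp; ring
  rw [e, abs_mul, abs_of_pos (by positivity)]
  refine mul_le_mul_of_nonneg_left ((abs_integral_le_integral_abs).trans ?_) (by positivity)
  exact setIntegral_mono_set (hb.intOn k _ _).abs (Eventually.of_forall fun _ => abs_nonneg _) (Eventually.of_forall h)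

lemma av_nested {b : ℝ → ℝ} (hb : BM1 b) {c r C R : ℝ} (hr : 0 < r) (hR : 0 < R) (h : Icc (c - r) (c + r) ⊆ Icc (C - R) (C + R)) :
    |av b c r - av b C R| ≤ R / r := by
  refine (av_sub hb hr h).trans ?_
  refine (mul_le_mul_of_nonneg_left (hb.2.2 C R hR) (by positivity)).trans (le_of_eq ?_)
  field_simp

lemma li_ii {g : ℝ → ℝ} (hg : LocallyIntegrable g volume) (u v : ℝ) : IntervalIntegrable g volume u v :=
  intervalIntegrable_iff.mpr ((hg.integrableOn_isCompact isCompact_uIcc).mono_set uIoc_subset_uIcc)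

lemma leb_pt {g : ℝ → ℝ} (hg : LocallyIntegrable g volume) {x K R : ℝ} (hR : 0 < R) (hd : HasDerivAt (fun z => ∫ t in (0 : ℝ)..z, g t) (g x) x) (hK : K < g x) :
    ∃ ρ, 0 < ρ ∧ ρ < R ∧ K * (2 * ρ) < ∫ t in Icc (x - ρ) (x + ρ), g t := by
  have hi : ∀ u v, IntervalIntegrable g volume u v := li_ii hg
  rw [hasDerivAt_iff_tendsto_slope_zero] at hd
  have h1 := hd.eventually (lt_mem_nhds hK)
  rw [eventually_nhdsWithin_iff, Metric.eventually_nhds_iff] at h1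
  obtain ⟨δ, hδ, h1⟩ := h1
  set ρ := min δ R / 2 with hρ
  have hm : 0 < min δ R := lt_min hδ hR
  have hρ0 : 0 < ρ := by positivity
  have hρδ : ρ < δ := by have := min_le_left δ R; linarith
  refine ⟨ρ, hρ0, by have := min_le_right δ R; linarith, ?_⟩
  have a1 := h1 (y := ρ) (by rw [Real.dist_eq, sub_zero, abs_of_pos hρ0]; exact hρδ) (by simp; exact hρ0.ne')
  have a2 := h1 (y := -ρ) (by rw [Real.dist_eq, sub_zero, abs_neg, abs_of_pos hρ0]; exact hρδ) (by simp; exact hρ0.ne')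
  rw [intervalIntegral.integral_interval_sub_left (hi _ _) (hi _ _), smul_eq_mul] at a1 a2
  rw [integral_Icc_eq_integral_Ioc, ← intervalIntegral.integral_of_le (by linarith), ← intervalIntegral.integral_add_adjacent_intervals (b := x) (hi _ _) (hi _ _)]
  rw [intervalIntegral.integral_symm] at a2
  have a1' : K * ρ < ∫ t in x..(x + ρ), g t := by
    rw [inv_mul_eq_div, lt_div_iff₀ hρ0] at a1; exact a1
  have a2' : K * ρ < ∫ t in (x + -ρ)..x, g t := by
    rw [inv_neg, neg_mul_neg, inv_mul_eq_div, lt_div_iff₀ hρ0] at a2; exact a2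
  rw [sub_eq_add_neg]; linarith

def JNP (b : ℝ → ℝ) (l η : ℝ) : Prop := ∀ c r, 0 < r → volume {x ∈ Icc (c - r) (c + r) | l < |b x - av b c r|} ≤ ENNReal.ofReal (η * (2 * r))

lemma JN_step {b : ℝ → ℝ} (hb : BM1 b) {l η : ℝ} (hl : 0 ≤ l) (hη : 0 ≤ η) (h : JNP b l η) : JNP b (l + 65) (η / 2) := by
  intro c r hr
  set k := av b c r with hk
  set g : ℝ → ℝ := fun y => |b y - k| with hg
  have hgl : LocallyIntegrable g volume := fun x => (hb.2.1.sub (locallyIntegrable_const k) x).imp fun s hs => ⟨hs.1, hs.2.abs⟩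
  set I2 := Icc (c - 2 * r) (c + 2 * r) with hI2
  have hg2 : ∫ y in I2, g y ≤ 12 * r := by
    have e1 := hb.2.2 c (2 * r) (by positivity)
    have e2 : |av b c (2 * r) - k| ≤ 2 := by
      rw [abs_sub_comm]
      refine (av_nested hb hr (by positivity) (Icc_subset_Icc (by linarith) (by linarith))).trans (le_of_eq (by field_simp))
    calc ∫ y in I2, g y ≤ ∫ y in I2, (|b y - av b c (2 * r)| + 2) := by
          refine integral_mono (hb.intOn k _ _).abs ((hb.intOn _ _ _).abs.add (integrableOn_const (by simp [hI2]))) fun y => ?_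
          have := abs_add_le (b y - av b c (2 * r)) (av b c (2 * r) - k)
          simp only [hg]; rw [sub_add_sub_cancel] at this; linarith
      _ = (∫ y in I2, |b y - av b c (2 * r)|) + 8 * r := by
          rw [integral_add (hb.intOn _ _ _).abs (integrableOn_const (by simp [hI2]))]
          simp [hI2, Real.volume_real_Icc]; rw [max_eq_left (by linarith)]; ring
      _ ≤ _ := by linarith
  set T : Set ℝ := {x ∈ Icc (c - r) (c + r) | l + 65 < |b x - k|} with hT
  set S : Set ℝ := {x ∈ T | HasDerivAt (fun z => ∫ t in (0 : ℝ)..z, g t) (g x) x} with hS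
  have hTS : volume T ≤ volume (T ∩ S) := by
    refine measure_mono_ae ?_
    filter_upwards [LocallyIntegrable.ae_hasDerivAt_integral hgl] with x hx hxT
    exact ⟨hxT, hxT, hx 0⟩
  have key : ∀ x ∈ S, ∃ ρ, 0 < ρ ∧ ρ ≤ r ∧ ∫ t in Icc (x - ρ) (x + ρ), g t = 60 * (2 * ρ) := by
    rintro x ⟨⟨hxI, hx⟩, hxd⟩
    obtain ⟨ρ0, h0, h1, h2⟩ := leb_pt hgl (K := 60) hr hxd (by simp only [hg]; linarith)
    have hc : Continuous fun ρ : ℝ => (∫ t in (x - ρ)..(x + ρ), g t) - 60 * (2 * ρ) := by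
      have hp : Continuous fun z : ℝ => ∫ t in (0 : ℝ)..z, g t := intervalIntegral.continuous_primitive (li_ii hgl) 0
      have : ∀ ρ : ℝ, (∫ t in (x - ρ)..(x + ρ), g t) = (∫ t in (0 : ℝ)..(x + ρ), g t) - ∫ t in (0 : ℝ)..(x - ρ), g t := fun ρ =>
        (intervalIntegral.integral_interval_sub_left (li_ii hgl _ _) (li_ii hgl _ _)).symm
      simp_rw [this]; fun_prop
    have hII : ∀ ρ : ℝ, 0 < ρ → ∫ t in Icc (x - ρ) (x + ρ), g t = ∫ t in (x - ρ)..(x + ρ), g t := fun ρ hρ => by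
      rw [integral_Icc_eq_integral_Ioc, ← intervalIntegral.integral_of_le (by linarith)]
    have h3 : ∫ t in Icc (x - r) (x + r), g t ≤ 12 * r := le_trans (setIntegral_mono_set (hb.intOn k _ _).abs (Eventually.of_forall fun _ => abs_nonneg _)
      (Eventually.of_forall (Icc_subset_Icc (by linarith [hxI.1]) (by linarith [hxI.2])))) hg2
    have hz : (0 : ℝ) ∈ Icc ((∫ t in (x - r)..(x + r), g t) - 60 * (2 * r)) ((∫ t in (x - ρ0)..(x + ρ0), g t) - 60 * (2 * ρ0)) := by
      rw [hII _ hr] at h3; rw [hII _ h0] at h2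
      constructor <;> linarith
    obtain ⟨ρ, hρ, hρ2⟩ := intermediate_value_Icc' h1.le hc.continuousOn hz
    refine ⟨ρ, by linarith [hρ.1], hρ.2, ?_⟩
    rw [hII _ (by linarith [hρ.1])]; simp only at hρ2; linarith
  choose! ρ hρ0 hρr hρe using key
  set ν : Measure ℝ := (volume.restrict I2).withDensity (fun y => ENNReal.ofReal (g y)) with hν
  have hνu : ν univ ≤ ENNReal.ofReal (12 * r) := by
    rw [hν, withDensity_apply _ MeasurableSet.univ, Measure.restrict_univ, ← ofReal_integral_eq_lintegral_ofReal (hb.intOn k _ _).abs (Eventually.of_forall fun _ => abs_nonneg _)]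
    exact ENNReal.ofReal_le_ofReal hg2
  have := vit_measure (S := S) (r := ρ) (R := r) (T := T) volume ν (ENNReal.ofReal (η / 12)) (fun x hx => ⟨hρ0 x hx, hρr x hx⟩) (fun x hx => by
    have hp := hρ0 x hx
    have hpr := hρr x hx
    have hxI := hx.1.1
    have hsub : Icc (x - ρ x) (x + ρ x) ⊆ I2 := Icc_subset_Icc (by linarith [hxI.1]) (by linarith [hxI.2])
    have e1 : ν (Icc (x - ρ x) (x + ρ x)) = ENNReal.ofReal (60 * (2 * ρ x)) := by
      rw [hν, withDensity_apply _ measurableSet_Icc, Measure.restrict_restrict measurableSet_Icc, inter_eq_left.mpr hsub,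
        ← ofReal_integral_eq_lintegral_ofReal (hb.intOn k _ _).abs (Eventually.of_forall fun _ => abs_nonneg _), ← hρe x hx]
    have e2 : |av b x (ρ x) - k| ≤ 60 := by
      refine (av_sub hb (C := x) (R := ρ x) hp subset_rfl).trans (le_of_eq ?_)
      have := hρe x hx
      simp only [hg] at this
      rw [this]; field_simp
    have e3 : |av b x (ρ x) - av b x (5 * ρ x)| ≤ 5 := by
      refine (av_nested hb hp (by positivity) (Icc_subset_Icc (by linarith) (by linarith))).trans (le_of_eq (by field_simp))
    rw [e1, ← ENNReal.ofReal_mul (by positivity), show η / 12 * (60 * (2 * ρ x)) = η * (2 * (5 * ρ x)) by ring]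
    refine le_trans (measure_mono ?_) (h x (5 * ρ x) (by positivity))
    rintro y ⟨⟨-, hy1⟩, hy2⟩
    refine ⟨hy2, ?_⟩
    have t1 := abs_sub_abs_le_abs_sub (b y - k) (b y - av b x (5 * ρ x))
    have t2 := abs_add_le (av b x (5 * ρ x) - av b x (ρ x)) (av b x (ρ x) - k)
    rw [sub_add_sub_cancel, abs_sub_comm (av b x (5 * ρ x)) (av b x (ρ x))] at t2
    rw [show b y - k - (b y - av b x (5 * ρ x)) = av b x (5 * ρ x) - k by ring] at t1
    linarith)
  refine hTS.trans (this.trans ((mul_le_mul' le_rfl hνu).trans (le_of_eq ?_)))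
  rw [← ENNReal.ofReal_mul (by positivity)]; congr 1; ring

lemma JN_all {b : ℝ → ℝ} (hb : BM1 b) (k : ℕ) : JNP b (65 * k) ((1 / 2) ^ k) := by
  induction k with
  | zero =>
    intro c r hr
    refine (measure_mono (sep_subset _ _)).trans ?_
    rw [Real.volume_Icc]; apply ENNReal.ofReal_le_ofReal; simp; linarith
  | succ k ih =>
    have := JN_step hb (by positivity) (by positivity) ih
    convert this using 1
    · push_cast; ring
    · rw [pow_succ]; ring

lemma JN (q : ℝ) (hq : 0 < q) : ∃ C : ℝ, 0 < C ∧ ∀ b : ℝ → ℝ, BM1 b → ∀ c r, 0 < r →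
    ∫⁻ y in Icc (c - r) (c + r), ENNReal.ofReal (|b y - av b c r| ^ q) ≤ ENNReal.ofReal (C * r) := by
  set s : ℕ → ℝ := fun k => (65 * (k + 1) : ℝ) ^ q * (1 / 2) ^ k with hs
  have hs0 : ∀ k, 0 < s k := fun k => by positivity
  have hsum : Summable s := by
    have e1 : Summable fun k : ℕ => (65 : ℝ) ^ q * (2 * ((k + 1 : ℕ) : ℝ) ^ (⌈q⌉₊) * (1 / 2) ^ (k + 1)) := by
      refine Summable.mul_left _ ?_
      have := (summable_nat_add_iff 1).mpr (summable_pow_mul_geometric_of_norm_lt_one (R := ℝ) ⌈q⌉₊ (r := 1 / 2) (by norm_num))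
      simpa [mul_assoc] using this.mul_left 2
    refine Summable.of_nonneg_of_le (fun k => (hs0 k).le) (fun k => ?_) e1
    simp only [hs]
    rw [Real.mul_rpow (by norm_num) (by positivity), mul_assoc]
    refine mul_le_mul_of_nonneg_left ?_ (by positivity)
    have : ((k : ℝ) + 1) ^ q ≤ ((k + 1 : ℕ) : ℝ) ^ ⌈q⌉₊ := by
      rw [← Real.rpow_natCast]; push_cast
      exact Real.rpow_le_rpow_of_exponent_le (by linarith [show (0 : ℝ) ≤ k by positivity]) (Nat.le_ceil q)
    calc _ ≤ ((k + 1 : ℕ) : ℝ) ^ ⌈q⌉₊ * (1 / 2) ^ k := by gcongr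
      _ = _ := by rw [pow_succ (1 / 2 : ℝ)]; ring
  refine ⟨2 * ∑' k, s k, by have := hsum.tsum_pos (fun k => (hs0 k).le) 0 (hs0 0); positivity, ?_⟩
  intro b hb c r hr
  set I := Icc (c - r) (c + r) with hI
  set g : ℝ → ℝ := fun y => |b y - av b c r| with hg
  have hgm : Measurable g := (hb.1.sub_const _).abs
  have hmS : ∀ k : ℕ, MeasurableSet {x ∈ I | 65 * (k : ℝ) < g x} := fun k => measurableSet_Icc.inter (measurableSet_lt measurable_const hgm)
  calc ∫⁻ y in I, ENNReal.ofReal (g y ^ q) ≤ ∫⁻ y in I, ∑' k : ℕ, ENNReal.ofReal ((65 * (k + 1) : ℝ) ^ q) * indicator {x ∈ I | 65 * (k : ℝ) < g x} 1 y := by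
        refine setLIntegral_mono' measurableSet_Icc fun y hy => ?_
        by_cases h0 : g y = 0
        · rw [h0, Real.zero_rpow hq.ne']; simp
        have hp : 0 < g y := lt_of_le_of_ne (abs_nonneg _) (Ne.symm h0)
        set k : ℕ := ⌈g y / 65⌉₊ - 1 with hk
        have hc : 0 < ⌈g y / 65⌉₊ := Nat.ceil_pos.mpr (by positivity)
        have hk1 : ((k : ℝ) + 1) = ⌈g y / 65⌉₊ := by rw [hk]; push_cast [Nat.cast_sub (show 1 ≤ ⌈g y / 65⌉₊ from hc)]; ring
        refine le_trans ?_ (ENNReal.le_tsum k)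
        have hlt : (k : ℝ) < g y / 65 := Nat.lt_ceil.mp (by omega)
        rw [indicator_of_mem (show y ∈ {x ∈ I | 65 * (k : ℝ) < g x} from ⟨hy, by linarith⟩)]
        simp only [Pi.one_apply, mul_one]
        apply ENNReal.ofReal_le_ofReal
        refine Real.rpow_le_rpow hp.le ?_ hq.le
        rw [hk1]; have := Nat.le_ceil (g y / 65); linarith
    _ = ∑' k : ℕ, ∫⁻ y in I, ENNReal.ofReal ((65 * (k + 1) : ℝ) ^ q) * indicator {x ∈ I | 65 * (k : ℝ) < g x} 1 y :=
        lintegral_tsum fun k => ((measurable_one.indicator (hmS k)).const_mul _).aemeasurable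
    _ ≤ ∑' k : ℕ, ENNReal.ofReal (s k * (2 * r)) := by
        refine ENNReal.tsum_le_tsum fun k => ?_
        rw [lintegral_const_mul' _ _ ENNReal.ofReal_ne_top, lintegral_indicator_one (hmS k)]
        simp only [hs]
        rw [mul_assoc, ENNReal.ofReal_mul (by positivity)]
        refine mul_le_mul' le_rfl (le_trans (Measure.restrict_le_self _) (JN_all hb k c r hr))
    _ = _ := by
        rw [← ENNReal.ofReal_tsum_of_nonneg (fun k => by have := hs0 k; positivity) (hsum.mul_right _), tsum_mul_right]
        congr 1; ring

/-! ### Local estimate for the BMO kernel -/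

lemma hold {p : ℝ} (hp : 1 < p) {β f : ℝ → ℝ} (hβ : Measurable β) (hf : Measurable f) {s : Set ℝ} {C μ r : ℝ} (hC : 0 ≤ C) (hμ : 0 ≤ μ) (hr : 0 < r)
    (h1 : ∫⁻ y in s, ENNReal.ofReal (|β y| ^ (p / (p - 1))) ≤ ENNReal.ofReal (C * r)) (hi : IntegrableOn (fun y => |f y| ^ p) s)
    (h2 : ∫ y in s, |f y| ^ p ≤ μ ^ p * r) :
    IntegrableOn (fun y => β y * f y) s ∧ ∫ y in s, |β y * f y| ≤ C ^ ((p - 1) / p) * μ * r := by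
  have hp0 : 0 < p := by linarith
  have hp1 : 0 < p - 1 := by linarith
  set q := p / (p - 1) with hq
  have hq0 : 0 < q := by positivity
  have hpq : q.HolderConjugate p := by
    rw [Real.holderConjugate_iff]
    refine ⟨by rw [hq, one_lt_div hp1]; linarith, ?_⟩
    rw [hq]; field_simp; ring
  have h2' : ∫⁻ y in s, ENNReal.ofReal (|f y| ^ p) ≤ ENNReal.ofReal (μ ^ p * r) := by
    rw [← ofReal_integral_eq_lintegral_ofReal hi (Eventually.of_forall fun _ => by positivity)]
    exact ENNReal.ofReal_le_ofReal h2
  have key : ∫⁻ y in s, ENNReal.ofReal |β y * f y| ≤ ENNReal.ofReal (C ^ ((p - 1) / p) * μ * r) := by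
    have := ENNReal.lintegral_mul_le_Lp_mul_Lq (volume.restrict s) hpq (f := fun y => ENNReal.ofReal |β y|) (g := fun y => ENNReal.ofReal |f y|)
      hβ.abs.ennreal_ofReal.aemeasurable hf.abs.ennreal_ofReal.aemeasurable
    calc _ = ∫⁻ y in s, ((fun y => ENNReal.ofReal |β y|) * (fun y => ENNReal.ofReal |f y|)) y := by
          congr 1; ext y; rw [Pi.mul_apply, ← ENNReal.ofReal_mul (abs_nonneg _), abs_mul]
      _ ≤ _ := this
      _ ≤ ENNReal.ofReal (C * r) ^ (1 / q) * ENNReal.ofReal (μ ^ p * r) ^ (1 / p) := by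
          gcongr
          · convert h1 using 3 with y; rw [ENNReal.ofReal_rpow_of_nonneg (abs_nonneg _) hq0.le]
          · convert h2' using 3 with y; rw [ENNReal.ofReal_rpow_of_nonneg (abs_nonneg _) hp0.le]
      _ = _ := by
          rw [ENNReal.ofReal_rpow_of_nonneg (by positivity) (by positivity), ENNReal.ofReal_rpow_of_nonneg (by positivity) (by positivity),
            ← ENNReal.ofReal_mul (by positivity), Real.mul_rpow hC hr.le, Real.mul_rpow (by positivity) hr.le, ← Real.rpow_mul hμ,
            mul_one_div_cancel hp0.ne', Real.rpow_one]
          have e1 : (1 / q) = (p - 1) / p := by rw [hq]; field_simp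
          have e2 : r ^ (1 / q) * r ^ (1 / p) = r := by
            rw [← Real.rpow_add hr, one_div, one_div, hpq.inv_add_inv_eq_one, Real.rpow_one]
          rw [e1] at e2 ⊢
          congr 1
          linear_combination (C ^ ((p - 1) / p) * μ) * e2
  have hinteg : IntegrableOn (fun y => β y * f y) s := by
    refine ⟨(hβ.mul hf).aestronglyMeasurable, ?_⟩
    rw [hasFiniteIntegral_iff_norm]; exact lt_of_le_of_lt key ENNReal.ofReal_lt_top
  refine ⟨hinteg, ?_⟩
  rw [← ENNReal.ofReal_le_ofReal_iff (by positivity), ofReal_integral_eq_lintegral_ofReal hinteg.abs (Eventually.of_forall fun _ => by positivity)]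
  exact key

lemma f_int {p : ℝ} (hp : 1 < p) {f : ℝ → ℝ} (hf : Measurable f) {c r μ : ℝ} (hμ : 0 ≤ μ) (hr : 0 < r)
    (hi : IntegrableOn (fun y => |f y| ^ p) (Icc (c - r) (c + r))) (h2 : ∫ y in Icc (c - r) (c + r), |f y| ^ p ≤ μ ^ p * r) :
    IntegrableOn f (Icc (c - r) (c + r)) ∧ ∫ y in Icc (c - r) (c + r), |f y| ≤ 2 * μ * r := by
  have := hold hp (β := fun _ => 1) measurable_const hf (C := 2) (by norm_num) hμ hr (s := Icc (c - r) (c + r)) (by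
    simp; rw [← ENNReal.ofReal_ofNat, ← ENNReal.ofReal_mul (by norm_num)] <;> try exact le_of_eq (by congr 1; ring)) hi h2
  simp only [one_mul] at this
  refine ⟨this.1, this.2.trans ?_⟩
  have : (2 : ℝ) ^ ((p - 1) / p) ≤ 2 := by
    calc (2 : ℝ) ^ ((p - 1) / p) ≤ 2 ^ (1 : ℝ) := Real.rpow_le_rpow_of_exponent_le (by norm_num) (by rw [div_le_one (by linarith)]; linarith)
      _ = 2 := Real.rpow_one 2
  gcongr

lemma bf_int {p : ℝ} (hp : 1 < p) : ∃ C : ℝ, 0 < C ∧ ∀ b : ℝ → ℝ, BM1 b → ∀ f : ℝ → ℝ, Measurable f → ∀ c r μ : ℝ, 0 ≤ μ → 0 < r →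
    IntegrableOn (fun y => |f y| ^ p) (Icc (c - r) (c + r)) → ∫ y in Icc (c - r) (c + r), |f y| ^ p ≤ μ ^ p * r →
    IntegrableOn (fun y => (b y - av b c r) * f y) (Icc (c - r) (c + r)) ∧ ∫ y in Icc (c - r) (c + r), |(b y - av b c r) * f y| ≤ C * μ * r := by
  obtain ⟨C, hC, h⟩ := JN (p / (p - 1)) (div_pos (by linarith) (by linarith))
  refine ⟨C ^ ((p - 1) / p), by positivity, ?_⟩
  intro b hb f hf c r μ hμ hr hi h2
  exact hold hp (hb.1.sub_const _) hf hC.le hμ hr (h b hb c r hr) hi h2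

noncomputable def Dd (b : ℝ → ℝ) (x y : ℝ) : ℝ := (∫ t in y..x, b t) - b y * (x - y)

noncomputable def KA {m : ℕ} (ε : ℝ) (b : ℝ → ℝ) (a : Fin m → ℝ → ℝ) (x y : ℝ) : ℝ :=
  if ε < |x - y| then Dd b x y * (∏ j, ∫ t in y..x, a j t) / (x - y) ^ (m + 2) else 0

lemma prim_sub {a : ℝ → ℝ} (ha : ∀ u v, IntervalIntegrable a volume u v) (c x y : ℝ) : prim c a x - prim c a y = ∫ t in y..x, a t := by
  unfold prim; exact intervalIntegral.integral_interval_sub_left (ha _ _) (ha _ _)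

lemma KA_split {m : ℕ} {ε c r k : ℝ} {b : ℝ → ℝ} {a : Fin m → ℝ → ℝ} (hε : 0 < ε) (hb : BM1 b) (ha : ∀ j, LocallyIntegrable (a j) volume) {x y : ℝ}
    (hx : x ∈ Icc (c - r) (c + r)) (hy : y ∈ Icc (c - r) (c + r)) {l : Fin m → ℝ} (hl : ∀ j, 0 < l j) :
    KA ε b a x y = 2 * (∏ j, l j) * kE ε (fun j => prim c ((Fin.cons (fun t => (Icc (c - r) (c + r)).indicator (fun t => (b t - k) / 2) t) (fun j t => (Icc (c - r) (c + r)).indicator (fun t => a j t / l j) t) : Fin (m + 1) → ℝ → ℝ) j)) x y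
      - (∏ j, l j) * (b y - k) * kE ε (fun j => prim c (fun t => (Icc (c - r) (c + r)).indicator (fun t => a j t / l j) t)) x y := by
  set I := Icc (c - r) (c + r) with hI
  unfold KA kE
  split_ifs with h
  swap
  · simp
  have hxy : x - y ≠ 0 := by rintro h0; rw [h0] at h; simp at h; linarith
  have hbi := li_ii hb.2.1
  have sub : uIcc y x ⊆ I := (convex_Icc _ _).ordConnected.uIcc_subset hy hx
  have ind : ∀ g : ℝ → ℝ, IntegrableOn g I → prim c (fun t => I.indicator g t) x - prim c (fun t => I.indicator g t) y = ∫ t in y..x, g t := by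
    intro g hg
    rw [prim_sub (fun u v => (hg.integrable_indicator measurableSet_Icc).intervalIntegrable)]
    exact intervalIntegral.integral_congr fun t ht => indicator_of_mem (sub ht) g
  have e1 : ∀ j, prim c (fun t => I.indicator (fun t => a j t / l j) t) x - prim c (fun t => I.indicator (fun t => a j t / l j) t) y = (∫ t in y..x, a j t) / l j := by
    intro j
    have := ind (fun t => a j t / l j) (((ha j).integrableOn_isCompact isCompact_Icc).div_const _)
    rw [this, intervalIntegral.integral_div]
  have e2 : prim c (fun t => I.indicator (fun t => (b t - k) / 2) t) x - prim c (fun t => I.indicator (fun t => (b t - k) / 2) t) y = ((∫ t in y..x, b t) - k * (x - y)) / 2 := by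
    rw [ind (fun t => (b t - k) / 2) ((hb.intOn k _ _).div_const _), intervalIntegral.integral_div, intervalIntegral.integral_sub (hbi _ _) (by simp)]
    simp; ring
  rw [Fin.prod_univ_succ]
  simp only [Fin.cons_zero, Fin.cons_succ]
  simp_rw [e1, e2]
  have hlp : ∏ j, l j ≠ 0 := Finset.prod_ne_zero_iff.mpr fun j _ => (hl j).ne'
  have e3 : ∏ j, (∫ t in y..x, a j t) / l j / (x - y) = (∏ j, ∫ t in y..x, a j t) / (∏ j, l j) / (x - y) ^ m := by
    rw [Finset.prod_div_distrib, Finset.prod_div_distrib]; simp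
  rw [e3]
  unfold Dd
  field_simp
  ring

lemma kE_bddR {n : ℕ} {ε R : ℝ} (hε : 0 < ε) (hR : 0 ≤ R) {A : Fin n → ℝ → ℝ} (hA : ∀ j x y, |A j x - A j y| ≤ R) (x y : ℝ) : |kE ε A x y| ≤ (R / ε) ^ n / ε := by
  unfold kE; split_ifs with h
  · rw [abs_div, Finset.abs_prod]
    refine div_le_div₀ (by positivity) ?_ hε h.le
    refine (Finset.prod_le_prod (fun _ _ => abs_nonneg _) fun j _ => (?_ : _ ≤ R / ε)).trans (by rw [Finset.prod_const, Finset.card_univ, Fintype.card_fin])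
    rw [abs_div]; exact div_le_div₀ hR (hA j x y) hε h.le
  · simp; positivity

lemma kE_int {n : ℕ} {ε r c : ℝ} (hε : 0 < ε) (hr : 0 < r) {a : Fin n → ℝ → ℝ} (ha : ∀ j, Integrable (a j)) (h1 : ∀ j, ∫ y, |a j y| ≤ r) {f : ℝ → ℝ} (hf : Integrable f) (x : ℝ) :
    Integrable fun y => kE ε (fun j => prim c (a j)) x y * f y := by
  have hc : ∀ j, Continuous (prim c (a j)) := fun j => intervalIntegral.continuous_primitive (fun x y => (ha j).intervalIntegrable) c
  refine hf.bdd_mul (c := (r / ε) ^ n / ε) (hk_comp (kE_meas ε (fun j => (hc j).measurable)) (measurable_const (a := x)) measurable_id).aestronglyMeasurable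
    (Eventually.of_forall fun y => kE_bddR hε hr.le (fun j x y => ?_) x y)
  rw [prim_sub (fun u v => (ha j).intervalIntegrable)]
  rw [← Real.norm_eq_abs]
  refine (intervalIntegral.norm_integral_le_integral_norm_uIoc).trans (le_trans (setIntegral_le_integral (ha j).norm (Eventually.of_forall fun _ => norm_nonneg _)) ?_)
  exact h1 j

lemma L3 (m : ℕ) {p δ : ℝ} (hp : 1 < p) (hδ : 0 < δ) : ∃ C : ℝ, 0 < C ∧ ∀ (b : ℝ → ℝ) (a : Fin m → ℝ → ℝ) (f : ℝ → ℝ) (ε c r μ : ℝ) (l : Fin m → ℝ), BM1 b → (∀ j, LocallyIntegrable (a j) volume) → Measurable f →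
    0 < ε → 0 < r → 0 < μ → (∀ j, 0 < l j) → (∀ j, ∫ y in Icc (c - r) (c + r), |a j y| ≤ l j * r) → IntegrableOn (fun y => |f y| ^ p) (Icc (c - r) (c + r)) →
    ∫ y in Icc (c - r) (c + r), |f y| ^ p ≤ μ ^ p * r →
    volume {x ∈ Icc (c - r) (c + r) | C * ((∏ j, l j) * μ) < |∫ y in Icc (c - r) (c + r), KA ε b a x y * f y|} ≤ ENNReal.ofReal (δ * r) := by
  obtain ⟨C0, hC0, h0⟩ := L2 m (δ := δ / 2) (by positivity)
  obtain ⟨C1, hC1, h1⟩ := L2 (m + 1) (δ := δ / 2) (by positivity)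
  obtain ⟨Cb, hCb, hb⟩ := bf_int hp
  refine ⟨4 * C1 + Cb * C0, by positivity, ?_⟩
  intro b a f ε c r μ l hbm ha hf hε hr hμ hl ha1 hfi hf1
  set I := Icc (c - r) (c + r) with hI
  set k := av b c r with hk
  obtain ⟨i1, j1⟩ := f_int hp hf hμ.le hr hfi hf1
  obtain ⟨i2, j2⟩ := hb b hbm f hf c r μ hμ.le hr hfi hf1
  set a0 : Fin m → ℝ → ℝ := fun j t => I.indicator (fun t => a j t / l j) t with ha0
  set β : ℝ → ℝ := fun t => I.indicator (fun t => (b t - k) / 2) t with hβ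
  set a1 : Fin (m + 1) → ℝ → ℝ := Fin.cons β a0 with ha1'
  set f1 : ℝ → ℝ := fun t => I.indicator (fun t => f t / (2 * μ)) t with hf1'
  set f2 : ℝ → ℝ := fun t => I.indicator (fun t => (b t - k) * f t / (Cb * μ)) t with hf2'
  have nrm : ∀ (g : ℝ → ℝ) (s t : ℝ), 0 < s → ∫ y in I, |g y| ≤ s * t → ∫ y, |I.indicator (fun y => g y / s) y| ≤ t := by
    intro g s t hs h
    have : (fun y => |I.indicator (fun y => g y / s) y|) = I.indicator (fun y => |g y| / s) := by
      ext y; by_cases hy : y ∈ I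
      · rw [indicator_of_mem hy, indicator_of_mem hy, abs_div, abs_of_pos hs]
      · rw [indicator_of_notMem hy, indicator_of_notMem hy, abs_zero]
    rw [this, integral_indicator measurableSet_Icc, integral_div, div_le_iff₀ hs, mul_comm]; exact h
  have ia0 : ∀ j, Integrable (a0 j) := fun j => IntegrableOn.integrable_indicator (((ha j).integrableOn_isCompact isCompact_Icc).div_const _) measurableSet_Icc
  have iβ : Integrable β := IntegrableOn.integrable_indicator ((hbm.intOn k _ _).div_const _) measurableSet_Icc
  have ia1 : ∀ j, Integrable (a1 j) := fun j => by
    refine Fin.cases ?_ (fun j => ?_) j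
    · exact iβ
    · exact ia0 j
  have if1 : Integrable f1 := IntegrableOn.integrable_indicator (i1.div_const _) measurableSet_Icc
  have if2 : Integrable f2 := IntegrableOn.integrable_indicator (i2.div_const _) measurableSet_Icc
  have na0 : ∀ j, ∫ y, |a0 j y| ≤ r := fun j => nrm (a j) (l j) r (hl j) (ha1 j)
  have na1 : ∀ j, ∫ y, |a1 j y| ≤ r := fun j => by
    refine Fin.cases ?_ (fun j => ?_) j
    · exact nrm (fun t => b t - k) 2 r (by norm_num) (hbm.2.2 c r hr)
    · exact na0 j
  have nf1 : ∫ y, |f1 y| ≤ r := nrm f (2 * μ) r (by positivity) j1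
  have nf2 : ∫ y, |f2 y| ≤ r := nrm _ (Cb * μ) r (by positivity) j2
  have sa0 : ∀ j, ∀ y ∉ I, a0 j y = 0 := fun j y hy => indicator_of_notMem hy _
  have sa1 : ∀ j, ∀ y ∉ I, a1 j y = 0 := fun j => by
    refine Fin.cases ?_ (fun j => ?_) j
    · exact fun y hy => indicator_of_notMem hy (fun t => (b t - k) / 2)
    · exact sa0 j
  have V0 := h0 a0 f2 ε c r hε hr ia0 if2 (((hbm.1.sub_const k).mul hf).div_const _ |>.indicator measurableSet_Icc) sa0 (fun y hy => indicator_of_notMem hy _) na0 nf2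
  have V1 := h1 a1 f1 ε c r hε hr ia1 if1 ((hf.div_const _).indicator measurableSet_Icc) sa1 (fun y hy => indicator_of_notMem hy _) na1 nf1
  have hsub : {x ∈ I | (4 * C1 + Cb * C0) * ((∏ j, l j) * μ) < |∫ y in I, KA ε b a x y * f y|} ⊆
      {x ∈ I | C0 < |∫ y, kE ε (fun j => prim c (a0 j)) x y * f2 y|} ∪ {x ∈ I | C1 < |∫ y, kE ε (fun j => prim c (a1 j)) x y * f1 y|} := by
    rintro x ⟨hxI, hx⟩
    by_contra hn
    rw [mem_union, not_or] at hn
    have n1 : |∫ y, kE ε (fun j => prim c (a0 j)) x y * f2 y| ≤ C0 := by by_contra h; exact hn.1 ⟨hxI, not_le.mp h⟩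
    have n2 : |∫ y, kE ε (fun j => prim c (a1 j)) x y * f1 y| ≤ C1 := by by_contra h; exact hn.2 ⟨hxI, not_le.mp h⟩
    have hP : 0 < ∏ j, l j := Finset.prod_pos fun j _ => hl j
    have e : ∫ y in I, KA ε b a x y * f y = 4 * (∏ j, l j) * μ * (∫ y, kE ε (fun j => prim c (a1 j)) x y * f1 y) - Cb * (∏ j, l j) * μ * ∫ y, kE ε (fun j => prim c (a0 j)) x y * f2 y := by
      rw [← integral_const_mul, ← integral_const_mul, ← integral_sub ((kE_int hε hr ia1 na1 if1 x).const_mul _) ((kE_int hε hr ia0 na0 if2 x).const_mul _), ← integral_indicator measurableSet_Icc]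
      congr 1; ext y
      by_cases hy : y ∈ I
      · rw [indicator_of_mem hy, KA_split hε hbm ha hxI hy hl (k := k)]
        simp only [hf1', hf2']
        rw [indicator_of_mem hy, indicator_of_mem hy]
        field_simp
        ring
      · simp only [hf1', hf2']
        rw [indicator_of_notMem hy, indicator_of_notMem hy, indicator_of_notMem hy]; ring
    rw [e] at hx
    refine absurd hx (not_lt.mpr ((abs_sub _ _).trans ?_))
    rw [abs_mul (4 * (∏ j, l j) * μ), abs_mul (Cb * (∏ j, l j) * μ), abs_of_pos (show 0 < 4 * (∏ j, l j) * μ by positivity), abs_of_pos (show 0 < Cb * (∏ j, l j) * μ by positivity)]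
    calc _ ≤ 4 * (∏ j, l j) * μ * C1 + Cb * (∏ j, l j) * μ * C0 :=
          add_le_add (mul_le_mul_of_nonneg_left n2 (by positivity)) (mul_le_mul_of_nonneg_left n1 (by positivity))
      _ = _ := by ring
  refine (measure_mono hsub).trans ((measure_union_le _ _).trans ((add_le_add V0 V1).trans (le_of_eq ?_)))
  rw [← ENNReal.ofReal_add (by positivity) (by positivity)]; congr 1; ring

/-! ### Kernel estimates -/

lemma av_dbl {b : ℝ → ℝ} (hb : BM1 b) {c r : ℝ} (hr : 0 < r) (k : ℕ) : |av b c (2 ^ k * r) - av b c r| ≤ 2 * k := by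
  induction k with
  | zero => simp
  | succ k ih =>
    have h1 := av_nested hb (c := c) (r := 2 ^ k * r) (C := c) (R := 2 ^ (k + 1) * r) (by positivity) (by positivity)
      (Icc_subset_Icc (by have : 0 < 2 ^ k * r := by positivity
                          rw [pow_succ]; linarith) (by have : 0 < 2 ^ k * r := by positivity
                                                       rw [pow_succ]; linarith))
    have e : 2 ^ (k + 1) * r / (2 ^ k * r) = 2 := by field_simp; ring
    rw [e, abs_sub_comm] at h1
    have := abs_add_le (av b c (2 ^ (k + 1) * r) - av b c (2 ^ k * r)) (av b c (2 ^ k * r) - av b c r)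
    rw [sub_add_sub_cancel] at this
    push_cast; linarith

lemma ii_le {g : ℝ → ℝ} (hg : LocallyIntegrable g volume) {c R x y : ℝ} (hx : x ∈ Icc (c - R) (c + R)) (hy : y ∈ Icc (c - R) (c + R)) :
    |∫ t in y..x, g t| ≤ ∫ t in Icc (c - R) (c + R), |g t| := by
  have h1 : |∫ t in y..x, g t| ≤ ∫ t in Set.uIoc y x, |g t| := by
    rw [intervalIntegral.abs_integral_eq_abs_integral_uIoc]
    exact abs_integral_le_integral_abs
  refine h1.trans (setIntegral_mono_set (hg.integrableOn_isCompact isCompact_Icc).abs (Eventually.of_forall fun _ => abs_nonneg _) (Eventually.of_forall ?_))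
  exact uIoc_subset_uIcc.trans (uIcc_subset_Icc hy hx)

lemma BM1.sub {b : ℝ → ℝ} (hb : BM1 b) (k : ℝ) : LocallyIntegrable (fun y => b y - k) volume := hb.2.1.sub (locallyIntegrable_const k)

lemma Dd_eq {b : ℝ → ℝ} (hb : BM1 b) (k x y : ℝ) : Dd b x y = (∫ t in y..x, (b t - k)) - (b y - k) * (x - y) := by
  rw [intervalIntegral.integral_sub (li_ii hb.2.1 _ _) (by simp)]
  simp [Dd]; ring

lemma KA_size {m : ℕ} {ε c R s : ℝ} {b : ℝ → ℝ} {a : Fin m → ℝ → ℝ} (hb : BM1 b) (ha : ∀ j, LocallyIntegrable (a j) volume) {x y : ℝ}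
    (hR : 0 < R) (hs : 0 < s) (hx : x ∈ Icc (c - R) (c + R)) (hy : y ∈ Icc (c - R) (c + R)) (hxy : R ≤ s * |x - y|) {l : Fin m → ℝ}
    (hl : ∀ j, ∫ t in Icc (c - R) (c + R), |a j t| ≤ l j * R) :
    |KA ε b a x y| ≤ 2 * s ^ (m + 2) * (∏ j, l j) * ((1 + |b y - av b c R|) / R) := by
  have hl0 : ∀ j, 0 ≤ l j := fun j => by
    have : 0 ≤ l j * R := (integral_nonneg fun _ => abs_nonneg _).trans (hl j)
    exact nonneg_of_mul_nonneg_left this hR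
  have hL : 0 ≤ ∏ j, l j := Finset.prod_nonneg fun j _ => hl0 j
  unfold KA
  split_ifs with h
  · have hd : 0 < |x - y| := by
      by_contra hh
      have : |x - y| = 0 := le_antisymm (not_lt.mp hh) (abs_nonneg _)
      rw [this] at hxy; linarith
    have h2R : |x - y| ≤ 2 * R := by rw [abs_le]; constructor <;> linarith [hx.1, hx.2, hy.1, hy.2]
    have e1 : |Dd b x y| ≤ 2 * R * (1 + |b y - av b c R|) := by
      rw [Dd_eq hb (av b c R)]
      have g1 := (ii_le (hb.sub (av b c R)) hx hy).trans (hb.2.2 c R hR)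
      have g2 := abs_sub (∫ t in y..x, (b t - av b c R)) ((b y - av b c R) * (x - y))
      rw [abs_mul (b y - av b c R)] at g2
      have g3 := mul_le_mul_of_nonneg_left h2R (abs_nonneg (b y - av b c R))
      linarith
    have e2 : |∏ j, ∫ t in y..x, a j t| ≤ (∏ j, l j) * R ^ m := by
      rw [Finset.abs_prod]
      calc _ ≤ ∏ j, (l j * R) := Finset.prod_le_prod (fun _ _ => abs_nonneg _) fun j _ => (ii_le (ha j) hx hy).trans (hl j)
        _ = _ := by rw [Finset.prod_mul_distrib]; simp
    rw [abs_div, abs_pow, div_le_iff₀ (by positivity)]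
    have e3 : R ^ (m + 2) ≤ s ^ (m + 2) * |x - y| ^ (m + 2) := by rw [← mul_pow]; gcongr
    calc _ ≤ (2 * R * (1 + |b y - av b c R|)) * ((∏ j, l j) * R ^ m) := abs_mul_le_of e1 e2
      _ = (2 * (∏ j, l j) * ((1 + |b y - av b c R|) / R)) * R ^ (m + 2) := by field_simp; ring
      _ ≤ (2 * (∏ j, l j) * ((1 + |b y - av b c R|) / R)) * (s ^ (m + 2) * |x - y| ^ (m + 2)) := by gcongr
      _ = _ := by ring
  · rw [abs_zero]; positivity

/-- product form of the kernel -/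
lemma KA_prod {m : ℕ} {ε : ℝ} {b : ℝ → ℝ} {a : Fin m → ℝ → ℝ} {x y : ℝ} (h : ε < |x - y|) (l : Fin m → ℝ) (hl : ∀ j, 0 < l j) :
    KA ε b a x y = (∏ j, l j) * ((Dd b x y / (x - y)) * (∏ j, (∫ t in y..x, a j t) / l j / (x - y)) * (x - y)⁻¹) := by
  unfold KA
  rw [if_pos h, Finset.prod_div_distrib, Finset.prod_div_distrib]
  have : (∏ j, l j) ≠ 0 := (Finset.prod_pos fun j _ => hl j).ne'
  simp only [Finset.prod_const, Finset.card_univ, Fintype.card_fin]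
  by_cases hxy : x - y = 0
  · simp [hxy]
  · field_simp; try ring

lemma quot_diff {P Q : ℝ} {x c y B E R ρ : ℝ} (hR : 0 < R) (hcy : R / 2 ≤ |c - y|) (hxy : 3 * R / 8 ≤ |x - y|) (hxc : |x - c| ≤ ρ / 4)
    (hQ : |Q| ≤ B) (hPQ : |P - Q| ≤ E) : |P / (x - y) - Q / (c - y)| ≤ 3 * E / R + 2 * B * ρ / R ^ 2 := by
  have h1 : c - y ≠ 0 := by intro h; rw [h, abs_zero] at hcy; linarith
  have h2 : x - y ≠ 0 := by intro h; rw [h, abs_zero] at hxy; linarith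
  have hE : 0 ≤ E := (abs_nonneg _).trans hPQ
  have hB : 0 ≤ B := (abs_nonneg _).trans hQ
  have hρ : 0 ≤ ρ := by linarith [abs_nonneg (x - c)]
  have e : P / (x - y) - Q / (c - y) = (P - Q) / (x - y) + Q * (c - x) / ((x - y) * (c - y)) := by
    field_simp; ring
  rw [e]
  refine (abs_add_le _ _).trans (add_le_add ?_ ?_)
  · rw [abs_div, div_le_div_iff₀ (abs_pos.mpr h2) hR]
    nlinarith
  · rw [abs_div, abs_mul, abs_mul, div_le_div_iff₀ (by positivity) (by positivity), abs_sub_comm c x]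
    have g1 : |Q| * |x - c| ≤ B * (ρ / 4) := mul_le_mul hQ hxc (abs_nonneg _) hB
    have g2 : (3 * R / 8) * (R / 2) ≤ |x - y| * |c - y| := mul_le_mul hxy hcy (by positivity) (by positivity)
    have g3 : |Q| * |x - c| * R ^ 2 ≤ B * (ρ / 4) * R ^ 2 := by gcongr
    have g4 : 2 * B * ρ * ((3 * R / 8) * (R / 2)) ≤ 2 * B * ρ * (|x - y| * |c - y|) := by gcongr
    have : 0 ≤ B * ρ * R ^ 2 := by positivity
    nlinarith

lemma KA_diff {m : ℕ} {ε c ρ : ℝ} {b : ℝ → ℝ} {a : Fin m → ℝ → ℝ} (hb : BM1 b) (ha : ∀ j, LocallyIntegrable (a j) volume) {x y : ℝ} {k : ℕ}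
    (hρ : 0 < ρ) (hxc : |x - c| ≤ ρ / 4) (hy1 : 2 ^ k * ρ < |y - c|) (hy2 : |y - c| ≤ 2 ^ (k + 1) * ρ) (hex : ε < |x - y|) (hec : ε < |c - y|) {l : Fin m → ℝ} (hl0 : ∀ j, 0 < l j)
    (hl : ∀ j R, ρ ≤ R → ∫ t in Icc (c - R) (c + R), |a j t| ≤ l j * R) :
    |KA ε b a x y - KA ε b a c y| ≤ (4 ^ m * (24 * m + 104)) * (∏ j, l j) * (1 / 2) ^ (k + 1) * ((k + 1 + |b y - av b c (2 ^ (k + 1) * ρ)|) / (2 ^ (k + 1) * ρ)) := by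
  set R := 2 ^ (k + 1) * ρ with hRdef
  have hR : 0 < R := by positivity
  have h2k : (1 : ℝ) ≤ 2 ^ k := one_le_pow₀ (by norm_num)
  have hρ2 : ρ ≤ R / 2 := by rw [hRdef, pow_succ]; nlinarith
  have hRR : ρ / R = (1 / 2) ^ (k + 1) := by rw [hRdef, one_div, inv_pow]; field_simp
  have hcy : R / 2 ≤ |c - y| := by rw [abs_sub_comm, hRdef, pow_succ]; linarith
  have hxy : 3 * R / 8 ≤ |x - y| := by
    have := abs_sub_abs_le_abs_sub (c - y) (c - x)
    rw [sub_sub_sub_cancel_left, abs_sub_comm c x] at this; linarith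
  rw [abs_le] at hy2
  have hcI : c ∈ Icc (c - R) (c + R) := ⟨by linarith, by linarith⟩
  have hyI : y ∈ Icc (c - R) (c + R) := ⟨by linarith, by linarith⟩
  have hxc' := abs_le.mp hxc
  have hxI : x ∈ Icc (c - R) (c + R) := ⟨by linarith, by linarith⟩
  have hxρ : x ∈ Icc (c - ρ) (c + ρ) := ⟨by linarith, by linarith⟩
  have hcρ : c ∈ Icc (c - ρ) (c + ρ) := ⟨by linarith, by linarith⟩
  set κ := av b c R with hκ
  set e := ρ / R with he
  have he0 : 0 ≤ e := by positivity
  rw [KA_prod hex l hl0, KA_prod hec l hl0, ← mul_sub, abs_mul, abs_of_pos (Finset.prod_pos fun j _ => hl0 j), ← hRR]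
  have hL := Finset.prod_pos (s := Finset.univ) fun j _ => hl0 j
  -- the factors
  set β := |b y - κ| with hβ
  have bq : |∫ t in y..c, (b t - κ)| ≤ 2 * R := (ii_le (hb.sub κ) hcI hyI).trans (hb.2.2 c R hR)
  have bd : |∫ t in c..x, (b t - κ)| ≤ 6 * (k + 1) * ρ := by
    refine (ii_le (hb.sub κ) hxρ hcρ).trans ?_
    have h1 := hb.2.2 c ρ hρ
    have h2 := av_dbl hb (c := c) hρ (k + 1)
    rw [← hRdef, ← hκ, abs_sub_comm] at h2
    calc ∫ t in Icc (c - ρ) (c + ρ), |b t - κ| ≤ ∫ t in Icc (c - ρ) (c + ρ), (|b t - av b c ρ| + |av b c ρ - κ|) := by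
          refine integral_mono (hb.intOn κ _ _).abs ((hb.intOn _ _ _).abs.add (integrableOn_const (by simp))) fun t => ?_
          have := abs_add_le (b t - av b c ρ) (av b c ρ - κ)
          rw [sub_add_sub_cancel] at this; exact this
      _ = (∫ t in Icc (c - ρ) (c + ρ), |b t - av b c ρ|) + 2 * ρ * |av b c ρ - κ| := by
          rw [integral_add (hb.intOn _ _ _).abs (integrableOn_const (by simp))]
          simp [Real.volume_real_Icc]; left; rw [max_eq_left (by linarith)]; ring
      _ ≤ 2 * ρ + 2 * ρ * (2 * ((k + 1 : ℕ) : ℝ)) := by gcongr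
      _ ≤ _ := by push_cast; nlinarith
  have hii := li_ii (hb.sub κ)
  have hne : ∀ z, ε < |z - y| → R / 8 ≤ |z - y| → z - y ≠ 0 := fun z _ h hh => by rw [hh, abs_zero] at h; linarith
  have hxne : x - y ≠ 0 := hne x hex (by linarith)
  have hcne : c - y ≠ 0 := hne c hec (by linarith)
  have hv : |Dd b x y / (x - y) - Dd b c y / (c - y)| ≤ 22 * (k + 1) * e := by
    have e1 : Dd b x y / (x - y) - Dd b c y / (c - y) = (∫ t in y..x, (b t - κ)) / (x - y) - (∫ t in y..c, (b t - κ)) / (c - y) := by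
      rw [Dd_eq hb κ, Dd_eq hb κ]; field_simp; ring
    rw [e1]
    refine (quot_diff hR hcy hxy hxc bq (E := 6 * (k + 1) * ρ) ?_).trans ?_
    · rw [intervalIntegral.integral_interval_sub_left (hii _ _) (hii _ _)]; exact bd
    · have : 3 * (6 * (k + 1) * ρ) / R + 2 * (2 * R) * ρ / R ^ 2 = (18 * (k + 1) + 4) * e := by rw [he]; field_simp; ring
      rw [this]; have hk : (0 : ℝ) ≤ k := k.cast_nonneg
      gcongr; linarith
  have hvc : |Dd b c y / (c - y)| ≤ 4 + β := by
    rw [Dd_eq hb κ, sub_div, mul_div_cancel_right₀ _ hcne]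
    refine (abs_sub _ _).trans (add_le_add ?_ le_rfl)
    rw [abs_div, div_le_iff₀ (by linarith)]; linarith
  have hal : ∀ j, LocallyIntegrable (fun t => a j t) volume := ha
  have hu : ∀ z ∈ Icc (c - R) (c + R), 3 * R / 8 ≤ |z - y| → ∀ j, |(∫ t in y..z, a j t) / l j / (z - y)| ≤ 4 := fun z hz h j => by
    have g := (ii_le (ha j) hz hyI).trans (hl j R (by linarith))
    rw [abs_div, abs_div, abs_of_pos (hl0 j), div_le_iff₀ (by linarith), div_le_iff₀ (hl0 j)]
    have := hl0 j
    nlinarith [mul_le_mul_of_nonneg_left h this.le]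
  have hud : ∀ j, |(∫ t in y..x, a j t) / l j / (x - y) - (∫ t in y..c, a j t) / l j / (c - y)| ≤ 4 * (2 * e) := fun j => by
    refine (quot_diff hR hcy hxy hxc (B := R) (E := ρ) ?_ ?_).trans ?_
    · rw [abs_div, abs_of_pos (hl0 j), div_le_iff₀ (hl0 j)]
      exact (ii_le (ha j) hcI hyI).trans ((hl j R (by linarith)).trans (by linarith))
    · rw [← sub_div, intervalIntegral.integral_interval_sub_left (li_ii (ha j) _ _) (li_ii (ha j) _ _), abs_div, abs_of_pos (hl0 j), div_le_iff₀ (hl0 j)]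
      exact (ii_le (ha j) hxρ hcρ).trans ((hl j ρ le_rfl).trans (by linarith))
    · have : 3 * ρ / R + 2 * R * ρ / R ^ 2 = 5 * e := by rw [he]; field_simp; norm_num
      rw [this]; linarith
  have hpx : |∏ j, (∫ t in y..x, a j t) / l j / (x - y)| ≤ 4 ^ m := by
    rw [Finset.abs_prod]
    calc _ ≤ ∏ j : Fin m, (4 : ℝ) := Finset.prod_le_prod (fun _ _ => abs_nonneg _) fun j _ => hu x hxI hxy j
      _ = _ := by simp
  have hpc : |∏ j, (∫ t in y..c, a j t) / l j / (c - y)| ≤ 4 ^ m := by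
    rw [Finset.abs_prod]
    calc _ ≤ ∏ j : Fin m, (4 : ℝ) := Finset.prod_le_prod (fun _ _ => abs_nonneg _) fun j _ => hu c hcI (by linarith) j
      _ = _ := by simp
  have hpd : |(∏ j, (∫ t in y..x, a j t) / l j / (x - y)) - ∏ j, (∫ t in y..c, a j t) / l j / (c - y)| ≤ m * 4 ^ m * (2 * e) := by
    have := prod_sub_le (M := 4) (e := 2 * e) (by norm_num) (by positivity) (u := fun j => (∫ t in y..x, a j t) / l j / (x - y))
      (v := fun j => (∫ t in y..c, a j t) / l j / (c - y)) Finset.univ (hu x hxI hxy) (hu c hcI (by linarith)) hud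
    simpa using this
  have hqx : |(x - y)⁻¹| ≤ 3 / R := by
    rw [abs_inv, inv_le_comm₀ (by linarith) (by positivity), inv_div]; linarith
  have hqd : |(x - y)⁻¹ - (c - y)⁻¹| ≤ 2 * e / R := by
    have := quot_diff (P := 1) (Q := 1) hR hcy hxy hxc (B := 1) (E := 0) (by simp) (by simp)
    rw [one_div, one_div] at this
    refine this.trans (le_of_eq ?_)
    rw [he]; field_simp; ring
  have hβ0 : 0 ≤ β := abs_nonneg _
  have hk : (0 : ℝ) ≤ k := k.cast_nonneg
  set V := Dd b x y / (x - y); set V' := Dd b c y / (c - y)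
  set U := ∏ j, (∫ t in y..x, a j t) / l j / (x - y); set U' := ∏ j, (∫ t in y..c, a j t) / l j / (c - y)
  have key : |V * U * (x - y)⁻¹ - V' * U' * (c - y)⁻¹| ≤ 22 * (k + 1) * e * 4 ^ m * (3 / R) + (4 + β) * (m * 4 ^ m * (2 * e)) * (3 / R) + (4 + β) * 4 ^ m * (2 * e / R) := by
    have : V * U * (x - y)⁻¹ - V' * U' * (c - y)⁻¹ = (V - V') * U * (x - y)⁻¹ + V' * (U - U') * (x - y)⁻¹ + V' * U' * ((x - y)⁻¹ - (c - y)⁻¹) := by ring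
    rw [this]
    exact (abs_add_three _ _ _).trans (add_le_add (add_le_add (abs_mul_le_of (abs_mul_le_of hv hpx) hqx) (abs_mul_le_of (abs_mul_le_of hvc hpd) hqx)) (abs_mul_le_of (abs_mul_le_of hvc hpc) hqd))
  refine (mul_le_mul_of_nonneg_left key hL.le).trans ?_
  have e5 : 22 * (k + 1) * e * 4 ^ m * (3 / R) + (4 + β) * (m * 4 ^ m * (2 * e)) * (3 / R) + (4 + β) * 4 ^ m * (2 * e / R) = 4 ^ m * (e / R) * (66 * (k + 1) + (4 + β) * (6 * m + 2)) := by
    field_simp; ring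
  rw [e5]
  have e6 : 66 * ((k : ℝ) + 1) + (4 + β) * (6 * m + 2) ≤ (24 * m + 104) * (k + 1 + β) := by
    have : (0 : ℝ) ≤ m := m.cast_nonneg
    have := mul_nonneg this hk
    have := mul_nonneg (m.cast_nonneg : (0 : ℝ) ≤ m) hβ0
    nlinarith
  calc _ ≤ (∏ j, l j) * (4 ^ m * (e / R) * ((24 * m + 104) * (k + 1 + β))) := by gcongr
    _ = _ := by ring

/-! ### The truncated operators acting on compactly supported functions -/

noncomputable def TA {m : ℕ} (ε : ℝ) (b : ℝ → ℝ) (a : Fin m → ℝ → ℝ) (f : ℝ → ℝ) (x : ℝ) : ℝ := ∫ y, KA ε b a x y * f y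

def CS (p R0 : ℝ) (f : ℝ → ℝ) : Prop := Measurable f ∧ Integrable (fun y => |f y| ^ p) ∧ ∀ y, R0 < |y| → f y = 0

lemma CS.ind {p R0 : ℝ} (hp : 0 < p) {f : ℝ → ℝ} (h : CS p R0 f) {s : Set ℝ} (hs : MeasurableSet s) : CS p R0 (s.indicator f) := by
  refine ⟨h.1.indicator hs, ?_, fun y hy => ?_⟩
  · have : (fun y => |s.indicator f y| ^ p) = s.indicator (fun y => |f y| ^ p) := by
      ext y; by_cases hy : y ∈ s <;> simp [hy, Real.zero_rpow hp.ne']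
    rw [this]; exact h.2.1.indicator hs
  · by_cases hs' : y ∈ s <;> simp [hs', h.2.2 y hy]

lemma KA_meas {m : ℕ} {ε : ℝ} {b : ℝ → ℝ} {a : Fin m → ℝ → ℝ} (hb : BM1 b) (ha : ∀ j, LocallyIntegrable (a j) volume) (x : ℝ) : Measurable (fun y => KA ε b a x y) := by
  have h1 : ∀ g : ℝ → ℝ, LocallyIntegrable g volume → Measurable (fun y => ∫ t in y..x, g t) := fun g hg => by
    have : (fun y => ∫ t in y..x, g t) = fun y => - ∫ t in x..y, g t := by ext y; rw [intervalIntegral.integral_symm]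
    rw [this]; exact (intervalIntegral.continuous_primitive (li_ii hg) x).neg.measurable
  unfold KA Dd
  refine Measurable.ite ?_ ?_ measurable_const
  · exact measurableSet_lt measurable_const (by fun_prop)
  · refine Measurable.div (Measurable.mul ((h1 b hb.2.1).sub (hb.1.mul (by fun_prop))) (Finset.measurable_fun_prod _ fun j _ => h1 _ (ha j))) (by fun_prop)

lemma mu_of {p : ℝ} (hp : 0 < p) {g : ℝ → ℝ} (hg : ∀ y, 0 ≤ g y) {s : Set ℝ} {r : ℝ} (hr : 0 < r) : ∃ μ : ℝ, 0 ≤ μ ∧ ∫ y in s, g y ≤ μ ^ p * r := by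
  have h0 : 0 ≤ ∫ y in s, g y := integral_nonneg hg
  refine ⟨((∫ y in s, g y) / r) ^ (1 / p), by positivity, ?_⟩
  rw [← Real.rpow_mul (by positivity), one_div_mul_cancel hp.ne', Real.rpow_one]
  exact le_of_eq (by field_simp)

lemma CS.ints {p R0 : ℝ} (hp : 1 < p) {f : ℝ → ℝ} (h : CS p R0 f) {b : ℝ → ℝ} (hb : BM1 b) (c : ℝ) {R : ℝ} (hR : 0 < R) :
    IntegrableOn f (Icc (c - R) (c + R)) ∧ IntegrableOn (fun y => (b y - av b c R) * f y) (Icc (c - R) (c + R)) := by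
  obtain ⟨μ, hμ, h2⟩ := mu_of (p := p) (by linarith) (g := fun y => |f y| ^ p) (fun _ => by positivity) (s := Icc (c - R) (c + R)) hR
  obtain ⟨C, _, hC⟩ := bf_int hp
  exact ⟨(f_int hp h.1 hμ hR h.2.1.integrableOn h2).1, (hC b hb f h.1 c R μ hμ hR h.2.1.integrableOn h2).1⟩

lemma TA_maj {m : ℕ} {p R0 : ℝ} (hp : 1 < p) {f : ℝ → ℝ} (h : CS p R0 f) {b : ℝ → ℝ} (hb : BM1 b) {a : Fin m → ℝ → ℝ} (ha : ∀ j, LocallyIntegrable (a j) volume)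
    {δ : ℝ} (hδ : 0 < δ) (X : ℝ) : ∃ G : ℝ → ℝ, Integrable G ∧ ∀ ε x, δ ≤ ε → |x| ≤ X → ∀ y, |KA ε b a x y * f y| ≤ G y := by
  set R := max X R0 ⊔ 1 with hRd
  have hR : 0 < R := lt_of_lt_of_le one_pos (le_max_right _ _)
  have hXR : X ≤ R := (le_max_left _ _).trans (le_max_left _ _)
  have hR0 : R0 ≤ R := (le_max_right _ _).trans (le_max_left _ _)
  obtain ⟨i1, i2⟩ := h.ints hp hb 0 hR
  set I := Icc (0 - R) (0 + R) with hI
  set l : Fin m → ℝ := fun j => (∫ t in I, |a j t|) / R with hl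
  set M := 2 * (R / δ) ^ (m + 2) * (∏ j, l j) with hM
  have hl0 : ∀ j, 0 ≤ l j := fun j => div_nonneg (integral_nonneg fun _ => abs_nonneg _) hR.le
  have hL : 0 ≤ ∏ j, l j := Finset.prod_nonneg fun j _ => hl0 j
  have hM0 : 0 ≤ M := by positivity
  refine ⟨I.indicator fun y => M / R * (|f y| + |(b y - av b 0 R) * f y|), ?_, ?_⟩
  · have i3 : IntegrableOn (fun y => M / R * (|f y| + |(b y - av b 0 R) * f y|)) I := (i1.abs.add i2.abs).const_mul _
    exact i3.integrable_indicator measurableSet_Icc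
  · intro ε x hε hx y
    by_cases hy : y ∈ I
    · rw [indicator_of_mem hy]
      have hxI : x ∈ I := by rw [abs_le] at hx; exact ⟨by linarith, by linarith⟩
      by_cases hxy : ε < |x - y|
      · have := KA_size (ε := ε) hb ha hR (s := R / δ) (by positivity) hxI hy (by
          rw [div_mul_eq_mul_div, le_div_iff₀ hδ]; gcongr; linarith) (l := l) (fun j => by simp only [hl]; rw [div_mul_cancel₀ _ hR.ne'])
        rw [abs_mul]
        calc _ ≤ M * ((1 + |b y - av b 0 R|) / R) * |f y| := by gcongr
          _ = _ := by rw [abs_mul]; ring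
      · unfold KA; rw [if_neg hxy, zero_mul, abs_zero]; positivity
    · rw [indicator_of_notMem hy, h.2.2 y, mul_zero, abs_zero]
      by_contra hh
      have := abs_le.mp (not_lt.mp hh)
      exact hy ⟨by linarith, by linarith⟩

lemma TA_int {m : ℕ} {p R0 : ℝ} (hp : 1 < p) {f : ℝ → ℝ} (h : CS p R0 f) {b : ℝ → ℝ} (hb : BM1 b) {a : Fin m → ℝ → ℝ} (ha : ∀ j, LocallyIntegrable (a j) volume)
    {ε : ℝ} (hε : 0 < ε) (x : ℝ) : Integrable (fun y => KA ε b a x y * f y) := by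
  obtain ⟨G, hG, hb'⟩ := TA_maj hp h hb ha hε |x|
  exact hG.mono' ((KA_meas hb ha x).mul h.1).aestronglyMeasurable (Eventually.of_forall (hb' ε x le_rfl le_rfl))

lemma TA_cont {m : ℕ} {p R0 : ℝ} (hp : 1 < p) {f : ℝ → ℝ} (h : CS p R0 f) {b : ℝ → ℝ} (hb : BM1 b) {a : Fin m → ℝ → ℝ} (ha : ∀ j, LocallyIntegrable (a j) volume)
    {ε : ℝ} (hε : 0 < ε) : Continuous (fun x => TA ε b a f x) := by
  rw [continuous_iff_continuousAt]
  intro x0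
  obtain ⟨G, hG, hb'⟩ := TA_maj hp h hb ha hε (|x0| + 1)
  have hev : ∀ᶠ x in nhds x0, |x| ≤ |x0| + 1 := by
    filter_upwards [Metric.ball_mem_nhds x0 one_pos] with x hx
    rw [Metric.mem_ball, Real.dist_eq] at hx
    have := abs_sub_abs_le_abs_sub x x0; linarith
  refine continuousAt_of_dominated (bound := G) (Eventually.of_forall fun x => ((KA_meas hb ha x).mul h.1).aestronglyMeasurable) (hev.mono fun x hx => Eventually.of_forall fun y => hb' ε x le_rfl hx y) hG ?_
  have hae : ∀ᵐ y : ℝ, y ≠ x0 + ε ∧ y ≠ x0 - ε := by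
    have h1 : ∀ z : ℝ, ∀ᵐ y : ℝ, y ≠ z := fun z => by simp [ae_iff]
    filter_upwards [h1 (x0 + ε), h1 (x0 - ε)] with y h1 h2 using ⟨h1, h2⟩
  filter_upwards [hae] with y hy
  refine ContinuousAt.mul ?_ continuousAt_const
  rcases lt_trichotomy |x0 - y| ε with h1 | h1 | h1
  · have : (fun x => KA ε b a x y) =ᶠ[nhds x0] fun _ => 0 := by
      have : ∀ᶠ x in nhds x0, |x - y| < ε := (by fun_prop : Continuous fun x : ℝ => |x - y|).continuousAt.eventually (gt_mem_nhds h1)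
      filter_upwards [this] with x hx
      unfold KA; rw [if_neg (not_lt.mpr hx.le)]
    exact continuousAt_const.congr this.symm
  · exfalso
    rcases (abs_eq hε.le).mp h1 with h2 | h2
    · exact hy.2 (by linarith)
    · exact hy.1 (by linarith)
  · have hne : x0 - y ≠ 0 := by intro hh; rw [hh, abs_zero] at h1; linarith
    have e : (fun x => KA ε b a x y) =ᶠ[nhds x0] fun x => Dd b x y * (∏ j, ∫ t in y..x, a j t) / (x - y) ^ (m + 2) := by
      have : ∀ᶠ x in nhds x0, ε < |x - y| := (by fun_prop : Continuous fun x : ℝ => |x - y|).continuousAt.eventually (lt_mem_nhds h1)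
      filter_upwards [this] with x hx
      unfold KA; rw [if_pos hx]
    refine ContinuousAt.congr ?_ e.symm
    have hc : ∀ g : ℝ → ℝ, LocallyIntegrable g volume → Continuous (fun x => ∫ t in y..x, g t) := fun g hg => intervalIntegral.continuous_primitive (li_ii hg) y
    unfold Dd
    refine ContinuousAt.div (ContinuousAt.mul ?_ ?_) (by fun_prop) (pow_ne_zero _ hne)
    · exact ((hc b hb.2.1).sub (by fun_prop)).continuousAt
    · exact (continuous_finset_prod _ fun j _ => hc _ (ha j)).continuousAt

lemma one_ball {p : ℝ} (hp : 1 < p) : ∃ C : ℝ, 0 < C ∧ ∀ b : ℝ → ℝ, BM1 b → ∀ f : ℝ → ℝ, ∀ R0, CS p R0 f → ∀ c R μ θ n : ℝ, 0 ≤ μ → 0 < R → 0 ≤ θ → 0 ≤ n →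
    ∫ y in Icc (c - R) (c + R), |f y| ^ p ≤ μ ^ p * R → ∀ H : ℝ → ℝ≥0∞, ∀ S : Set ℝ, S ⊆ Icc (c - R) (c + R) →
    (∀ y ∈ S, H y ≤ ENNReal.ofReal (θ * ((n + |b y - av b c R|) / R) * |f y|)) → ∫⁻ y in S, H y ≤ ENNReal.ofReal (θ * (2 * n + C) * μ) := by
  obtain ⟨C, hC0, hC⟩ := bf_int hp
  refine ⟨C, hC0, ?_⟩
  intro b hb f R0 hf c R μ θ n hμ hR hθ hn h2 H S hS hH
  obtain ⟨i1, j1⟩ := f_int hp hf.1 hμ hR hf.2.1.integrableOn h2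
  obtain ⟨i2, j2⟩ := hC b hb f hf.1 c R μ hμ hR hf.2.1.integrableOn h2
  have hb1 := hb.1
  have hf1 := hf.1
  have e : ∀ y, θ * ((n + |b y - av b c R|) / R) * |f y| = θ / R * (n * |f y| + |(b y - av b c R) * f y|) := fun y => by rw [abs_mul]; ring
  have i3 : IntegrableOn (fun y => θ / R * (n * |f y| + |(b y - av b c R) * f y|)) (Icc (c - R) (c + R)) := ((i1.abs.const_mul n).add i2.abs).const_mul _
  calc ∫⁻ y in S, H y ≤ ∫⁻ y in S, ENNReal.ofReal (θ / R * (n * |f y| + |(b y - av b c R) * f y|)) := by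
        refine setLIntegral_mono (by fun_prop) fun y hy => ?_
        rw [← e]; exact hH y hy
    _ ≤ ∫⁻ y in Icc (c - R) (c + R), ENNReal.ofReal (θ / R * (n * |f y| + |(b y - av b c R) * f y|)) := lintegral_mono_set hS
    _ = ENNReal.ofReal (∫ y in Icc (c - R) (c + R), θ / R * (n * |f y| + |(b y - av b c R) * f y|)) := by
        rw [ofReal_integral_eq_lintegral_ofReal i3 (Eventually.of_forall fun _ => by positivity)]
    _ ≤ _ := by
        refine ENNReal.ofReal_le_ofReal ?_
        rw [integral_const_mul, integral_add (i1.abs.const_mul n) i2.abs, integral_const_mul]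
        calc _ ≤ θ / R * (n * (2 * μ * R) + C * μ * R) := by gcongr
          _ = _ := by field_simp

lemma sum_geo : Summable (fun k : ℕ => (k + 1 : ℝ) * (1 / 2) ^ (k + 1)) := by
  have := summable_pow_mul_geometric_of_norm_lt_one 1 (r := (1 / 2 : ℝ)) (by norm_num [abs_of_pos])
  have h2 := (summable_nat_add_iff 1).mpr this
  simpa using h2

lemma REG (m : ℕ) {p : ℝ} (hp : 1 < p) : ∃ C : ℝ, 0 < C ∧ ∀ (b : ℝ → ℝ) (a : Fin m → ℝ → ℝ) (f : ℝ → ℝ) (δ c x ρ μ R0 : ℝ) (l : Fin m → ℝ), BM1 b → (∀ j, LocallyIntegrable (a j) volume) →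
    CS p R0 f → 0 < δ → 0 < ρ → |x - c| ≤ ρ / 4 → 0 < μ → (∀ j, 0 < l j) → (∀ j R, ρ ≤ R → ∫ t in Icc (c - R) (c + R), |a j t| ≤ l j * R) →
    (∀ R, ρ ≤ R → ∫ y in Icc (c - R) (c + R), |f y| ^ p ≤ μ ^ p * R) →
    |TA δ b a ({y | ρ < |y - c|}.indicator f) x - TA δ b a ({y | ρ < |y - c|}.indicator f) c| ≤ C * ((∏ j, l j) * μ) := by
  obtain ⟨Cb, hCb, hob⟩ := one_ball hp
  set C1 : ℝ := 4 ^ m * (24 * m + 104) with hC1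
  have hC1p : 0 < C1 := by positivity
  have hsm : Summable (fun k : ℕ => (1 / 2 : ℝ) ^ (k + 1) * (2 * (k + 1) + Cb)) := by
    have h1 := sum_geo.mul_left 2
    have h2 := ((summable_nat_add_iff 1).mpr (summable_geometric_of_lt_one (r := (1 / 2 : ℝ)) (by norm_num) (by norm_num))).mul_left Cb
    refine (h1.add h2).congr fun k => by ring
  set S0 := ∑' k : ℕ, (1 / 2 : ℝ) ^ (k + 1) * (2 * (k + 1) + Cb) with hS0
  have hS0n : 0 ≤ S0 := tsum_nonneg fun k => by positivity
  refine ⟨4 * 3 ^ (m + 2) * (2 + Cb) + C1 * S0, by positivity, ?_⟩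
  intro b a f δ c x ρ μ R0 l hb ha hf hδ hρ hxc hμ hl0 hl hfl
  have hL := Finset.prod_pos (s := Finset.univ) fun j _ => hl0 j
  set L := ∏ j, l j with hLd
  set E : Set ℝ := {y | ρ < |y - c|} with hE
  have hEm : MeasurableSet E := measurableSet_lt measurable_const (by fun_prop)
  have hF := hf.ind (by linarith) hEm
  have hxc' := abs_le.mp hxc
  unfold TA
  rw [← integral_sub (TA_int hp hF hb ha hδ x) (TA_int hp hF hb ha hδ c)]
  have hinteg : Integrable (fun y => KA δ b a x y * E.indicator f y - KA δ b a c y * E.indicator f y) := (TA_int hp hF hb ha hδ x).sub (TA_int hp hF hb ha hδ c)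
  refine abs_integral_le_integral_abs.trans ?_
  rw [← ENNReal.ofReal_le_ofReal_iff (by positivity), ofReal_integral_eq_lintegral_ofReal hinteg.abs (Eventually.of_forall fun _ => abs_nonneg _)]
  set H : ℝ → ℝ≥0∞ := fun y => ENNReal.ofReal (|KA δ b a x y - KA δ b a c y| * |f y|) with hH
  have e1 : ∀ y, ENNReal.ofReal |KA δ b a x y * E.indicator f y - KA δ b a c y * E.indicator f y| = E.indicator H y := fun y => by
    by_cases hy : y ∈ E
    · simp only [indicator_of_mem hy, hH]; rw [← sub_mul, abs_mul]
    · simp [indicator_of_notMem hy]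
  refine le_trans (le_of_eq (lintegral_congr e1)) ?_
  rw [lintegral_indicator hEm]
  set Mis : Set ℝ := {y | ρ < |y - c| ∧ ¬ (δ < |x - y| ↔ δ < |c - y|)} with hMis
  set B : ℕ → Set ℝ := fun k => {y | (2 ^ k * ρ < |y - c| ∧ |y - c| ≤ 2 ^ (k + 1) * ρ) ∧ (δ < |x - y| ↔ δ < |c - y|)} with hB
  have hsub : E ⊆ Mis ∪ ⋃ k, B k := by
    intro y hy
    by_cases hm : (δ < |x - y| ↔ δ < |c - y|)
    · right
      rw [mem_iUnion]
      have hy' : ρ < |y - c| := hy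
      obtain ⟨n, hn1, hn2⟩ := exists_nat_pow_near (x := |y - c| / ρ) (y := 2) (by rw [one_le_div hρ]; exact hy'.le) (by norm_num)
      rw [le_div_iff₀ hρ] at hn1
      rw [div_lt_iff₀ hρ] at hn2
      rcases hn1.lt_or_eq with h | h
      · exact ⟨n, ⟨h, hn2.le⟩, hm⟩
      · rcases n with _ | n
        · simp at h; linarith
        · refine ⟨n, ⟨?_, h.ge⟩, hm⟩
          rw [← h, pow_succ]; have : 0 < 2 ^ n * ρ := by positivity
          linarith
    · left; exact ⟨hy, hm⟩
  have g1 : ∫⁻ y in Mis, H y ≤ ENNReal.ofReal (4 * 3 ^ (m + 2) * L * (2 * 1 + Cb) * μ) := by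
    set R := max ρ (4 * δ / 3) with hR
    have hRρ : ρ ≤ R := le_max_left _ _
    have hMR : ∀ y ∈ Mis, |y - c| ≤ 4 * δ / 3 ∧ 3 * δ / 5 ≤ |x - y| ∧ 3 * δ / 5 ≤ |c - y| ∧ ρ < |y - c| := by
      rintro y ⟨hy1, hy2⟩
      have t1 := abs_sub_abs_le_abs_sub (c - y) (c - x)
      rw [sub_sub_sub_cancel_left, abs_sub_comm c x] at t1
      have t2 := abs_sub_abs_le_abs_sub (x - y) (x - c)
      rw [sub_sub_sub_cancel_left] at t2
      rw [abs_sub_comm y c] at hy1 ⊢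
      by_cases hq : δ < |x - y|
      · have : ¬ δ < |c - y| := fun h => hy2 (by simp [hq, h])
        refine ⟨by linarith, by linarith, by linarith, hy1⟩
      · have : δ < |c - y| := by by_contra h; exact hy2 (by simp [hq, h])
        refine ⟨by linarith, by linarith, by linarith, hy1⟩
    refine hob b hb f R0 hf c R μ _ 1 hμ.le (by positivity) (by positivity) (by norm_num) (hfl R hRρ) H Mis ?_ ?_
    · intro y hy
      have := (hMR y hy).1
      have h3 : 4 * δ / 3 ≤ R := le_max_right _ _
      rw [abs_le] at this
      exact ⟨by linarith, by linarith⟩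
    · intro y hy
      obtain ⟨k1, k2, k3, k4⟩ := hMR y hy
      have hRe : R = 4 * δ / 3 := max_eq_right (by linarith)
      have hR0 : 0 < R := by positivity
      have k1' := abs_le.mp k1
      have hyI : y ∈ Icc (c - R) (c + R) := ⟨by linarith, by linarith⟩
      have s1 := KA_size (ε := δ) hb ha hR0 (s := 3) (by norm_num) (x := x) ⟨by linarith, by linarith⟩ hyI (by linarith) (fun j => hl j R hRρ)
      have s2 := KA_size (ε := δ) hb ha hR0 (s := 3) (by norm_num) (x := c) ⟨by linarith, by linarith⟩ hyI (by linarith) (fun j => hl j R hRρ)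
      refine ENNReal.ofReal_le_ofReal ?_
      gcongr
      refine (abs_sub _ _).trans ((add_le_add s1 s2).trans (le_of_eq ?_))
      ring
  have g2 : ∀ k, ∫⁻ y in B k, H y ≤ ENNReal.ofReal (C1 * L * μ * ((1 / 2 : ℝ) ^ (k + 1) * (2 * (k + 1) + Cb))) := by
    intro k
    have hR0 : 0 < 2 ^ (k + 1) * ρ := by positivity
    have h1k : (1 : ℝ) ≤ 2 ^ (k + 1) := one_le_pow₀ (by norm_num)
    refine (hob b hb f R0 hf c (2 ^ (k + 1) * ρ) μ (C1 * L * (1 / 2) ^ (k + 1)) (k + 1) hμ.le hR0 (by positivity) (by positivity) (hfl _ (by nlinarith)) H (B k) ?_ ?_).trans (le_of_eq (by congr 1; ring))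
    · rintro y ⟨⟨_, hy⟩, _⟩
      rw [abs_le] at hy
      exact ⟨by linarith, by linarith⟩
    · rintro y ⟨⟨hy1, hy2⟩, hm⟩
      refine ENNReal.ofReal_le_ofReal ?_
      gcongr
      by_cases hq : δ < |x - y|
      · exact KA_diff hb ha hρ hxc hy1 hy2 hq (hm.mp hq) hl0 hl
      · have : ¬ δ < |c - y| := fun h => hq (hm.mpr h)
        unfold KA; rw [if_neg hq, if_neg this, sub_zero, abs_zero]; positivity
  calc ∫⁻ y in E, H y ≤ ∫⁻ y in Mis ∪ ⋃ k, B k, H y := lintegral_mono_set hsub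
    _ ≤ (∫⁻ y in Mis, H y) + ∫⁻ y in ⋃ k, B k, H y := lintegral_union_le _ _ _
    _ ≤ (∫⁻ y in Mis, H y) + ∑' k, ∫⁻ y in B k, H y := by gcongr; exact lintegral_iUnion_le _ _
    _ ≤ ENNReal.ofReal (4 * 3 ^ (m + 2) * L * (2 * 1 + Cb) * μ) + ∑' k : ℕ, ENNReal.ofReal (C1 * L * μ * ((1 / 2 : ℝ) ^ (k + 1) * (2 * (k + 1) + Cb))) := by
        gcongr with k; exact g2 k
    _ = _ := by
        rw [← ENNReal.ofReal_tsum_of_nonneg (fun k => by positivity) (hsm.mul_left _), tsum_mul_left, ← ENNReal.ofReal_add (by positivity) (by positivity)]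
        congr 1; ring

/-! ### Cotlar type inequality and good-lambda inequality -/

def HL (r : ℝ) (g : ℝ → ℝ) : Prop := Measurable g ∧ Integrable (fun y => |g y| ^ r)

lemma HL.loc {r : ℝ} (hr : 1 ≤ r) {g : ℝ → ℝ} (h : HL r g) : LocallyIntegrable g volume := by
  rw [locallyIntegrable_iff]
  intro k hk
  have i1 : IntegrableOn (fun y => 1 + |g y| ^ r) k := (integrableOn_const hk.measure_lt_top.ne).add h.2.integrableOn
  refine i1.mono' h.1.aestronglyMeasurable (Eventually.of_forall fun y => ?_)
  rw [Real.norm_eq_abs]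
  rcases le_total |g y| 1 with h1 | h1
  · have : 0 ≤ |g y| ^ r := by positivity
    linarith
  · have := Real.rpow_le_rpow_of_exponent_le h1 hr
    rw [Real.rpow_one] at this; linarith

lemma HL.le {r : ℝ} (hr : 1 ≤ r) {g : ℝ → ℝ} (h : HL r g) {c R l : ℝ} (hR : 0 < R) (hl : 0 ≤ l) (h2 : ∫ y in Icc (c - R) (c + R), |g y| ^ r ≤ l ^ r * R) :
    ∫ y in Icc (c - R) (c + R), |g y| ≤ 2 * l * R := by
  rcases hr.eq_or_lt with h1 | h1
  · rw [← h1] at h2; simp only [Real.rpow_one] at h2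
    have : 0 ≤ l * R := by positivity
    linarith
  · exact (f_int h1 h.1 hl hR h.2.integrableOn h2).2

def BadS {m : ℕ} (r : Fin m → ℝ) (p : ℝ) (a : Fin m → ℝ → ℝ) (f : ℝ → ℝ) (lam : Fin m → ℝ) (μ : ℝ) : Set ℝ :=
  (⋃ j, Bad (fun y => |a j y| ^ r j) (lam j ^ r j)) ∪ Bad (fun y => |f y| ^ p) (μ ^ p)

lemma gd {m : ℕ} {r : Fin m → ℝ} {p : ℝ} {a : Fin m → ℝ → ℝ} {f : ℝ → ℝ} {lam : Fin m → ℝ} {μ : ℝ} (hp : 1 < p) (hr : ∀ j, 1 ≤ r j) (ha : ∀ j, HL (r j) (a j)) (hf : HL p f)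
    (hl : ∀ j, 0 < lam j) (hμ : 0 < μ) {x c ρ : ℝ} (hx : x ∉ BadS r p a f lam μ) (hρ : 0 < ρ) (hxc : |x - c| ≤ ρ) :
    (∀ j R, ρ ≤ R → ∫ t in Icc (c - R) (c + R), |a j t| ≤ 4 * lam j * R) ∧ (∀ R, ρ ≤ R → ∫ y in Icc (c - R) (c + R), |f y| ^ p ≤ (2 * μ) ^ p * R) := by
  simp only [BadS, mem_union, mem_iUnion, not_or, not_exists] at hx
  rw [abs_le] at hxc
  have hsub : ∀ R, ρ ≤ R → Icc (c - R) (c + R) ⊆ Icc (x - 2 * R) (x + 2 * R) := fun R h => Icc_subset_Icc (by linarith) (by linarith)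
  refine ⟨fun j R hR => ?_, fun R hR => ?_⟩
  · have h1 := not_Bad (hx.1 j) (r := 2 * R) (by linarith)
    have h2 := (ha j).le (hr j) (by linarith) (hl j).le h1
    refine (setIntegral_mono_set (((ha j).loc (hr j)).integrableOn_isCompact isCompact_Icc).abs (Eventually.of_forall fun _ => abs_nonneg _) (hsub R hR).eventuallyLE).trans (h2.trans (le_of_eq (by ring)))
  · have h1 := not_Bad hx.2 (r := 2 * R) (by linarith)
    refine (setIntegral_mono_set hf.2.integrableOn (Eventually.of_forall fun _ => by positivity) (hsub R hR).eventuallyLE).trans (h1.trans ?_)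
    rw [Real.mul_rpow (by norm_num) hμ.le]
    have : (2 : ℝ) ≤ 2 ^ p := by
      have := Real.rpow_le_rpow_of_exponent_le (x := 2) (by norm_num) hp.le
      rwa [Real.rpow_one] at this
    have h0 : 0 ≤ μ ^ p * R := by have : 0 < R := by linarith
                                  positivity
    nlinarith

lemma TA_trunc {m : ℕ} {δ ρ ε x : ℝ} {b : ℝ → ℝ} {a : Fin m → ℝ → ℝ} {f : ℝ → ℝ} (he : ε = max δ ρ) :
    TA δ b a ({y | ρ < |y - x|}.indicator f) x = TA ε b a f x := by
  unfold TA
  congr 1; ext y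
  by_cases h : ρ < |x - y|
  · rw [indicator_of_mem (by rw [mem_ofPred_eq, abs_sub_comm]; exact h)]
    unfold KA
    by_cases h2 : δ < |x - y|
    · rw [if_pos h2, if_pos (by rw [he]; exact max_lt h2 h)]
    · rw [if_neg h2, if_neg (by rw [he, max_lt_iff]; tauto)]
  · rw [indicator_of_notMem (by rw [mem_ofPred_eq, abs_sub_comm]; exact h)]
    unfold KA
    rw [if_neg (c := ε < _) (by rw [he, max_lt_iff]; tauto)]; simp

lemma TA_split {m : ℕ} {p R0 : ℝ} (hp : 1 < p) {f : ℝ → ℝ} (h : CS p R0 f) {b : ℝ → ℝ} (hb : BM1 b) {a : Fin m → ℝ → ℝ} (ha : ∀ j, LocallyIntegrable (a j) volume)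
    {ε : ℝ} (hε : 0 < ε) (x c ρ : ℝ) : TA ε b a f x = (∫ y in Icc (c - ρ) (c + ρ), KA ε b a x y * f y) + TA ε b a ({y | ρ < |y - c|}.indicator f) x := by
  have hm : MeasurableSet {y : ℝ | ρ < |y - c|} := measurableSet_lt measurable_const (by fun_prop)
  unfold TA
  rw [← integral_indicator measurableSet_Icc, ← integral_add ((TA_int hp h hb ha hε x).indicator measurableSet_Icc) (TA_int hp (h.ind (by linarith) hm) hb ha hε x)]
  congr 1; ext y
  by_cases hy : ρ < |y - c|
  · rw [indicator_of_mem (s := {y : ℝ | ρ < |y - c|}) hy, indicator_of_notMem, zero_add]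
    rintro ⟨h1, h2⟩
    have : |y - c| ≤ ρ := abs_le.mpr ⟨by linarith, by linarith⟩
    linarith
  · rw [indicator_of_notMem (s := {y : ℝ | ρ < |y - c|}) hy, indicator_of_mem, mul_zero, add_zero]
    have := abs_le.mp (not_lt.mp hy)
    exact ⟨by linarith, by linarith⟩

/-- superlevel set of the maximal truncation -/
def Om {m : ℕ} (δ : ℝ) (b : ℝ → ℝ) (a : Fin m → ℝ → ℝ) (f : ℝ → ℝ) (t : ℝ) : Set ℝ := {x | ∃ ε, δ ≤ ε ∧ t < |TA ε b a f x|}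

lemma Om_open {m : ℕ} {p R0 : ℝ} (hp : 1 < p) {f : ℝ → ℝ} (h : CS p R0 f) {b : ℝ → ℝ} (hb : BM1 b) {a : Fin m → ℝ → ℝ} (ha : ∀ j, LocallyIntegrable (a j) volume)
    {δ : ℝ} (hδ : 0 < δ) (t : ℝ) : IsOpen (Om δ b a f t) := by
  have : Om δ b a f t = ⋃ ε, ⋃ _ : δ ≤ ε, {x | t < |TA ε b a f x|} := by ext x; simp [Om]
  rw [this]
  exact isOpen_iUnion fun ε => isOpen_iUnion fun hε => isOpen_lt continuous_const (TA_cont hp h hb ha (by linarith)).abs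

lemma cotlar (m : ℕ) {p : ℝ} (hp : 1 < p) : ∃ K : ℝ, 0 < K ∧ ∀ (r : Fin m → ℝ) (b : ℝ → ℝ) (a : Fin m → ℝ → ℝ) (f : ℝ → ℝ) (lam : Fin m → ℝ) (μ δ R0 t Rm : ℝ), BM1 b → (∀ j, 1 ≤ r j) → (∀ j, HL (r j) (a j)) →
    CS p R0 f → (∀ j, 0 < lam j) → 0 < μ → 0 < δ → K * ((∏ j, lam j) * μ) ≤ t → (∀ ε x, δ ≤ ε → 6 * t < |TA ε b a f x| → ε ≤ Rm) →
    volume (Om δ b a f (6 * t) \ BadS r p a f lam μ) ≤ 10 * volume {x | 3 * t < |TA δ b a f x|} := by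
  obtain ⟨C3, hC3, h3⟩ := L3 m (δ := 1 / 4) hp (by norm_num)
  obtain ⟨CR, hCR, hRG⟩ := REG m hp
  refine ⟨(C3 + CR) * (4 ^ m * 2), by positivity, ?_⟩
  intro r b a f lam μ δ R0 t Rm hb hr ha hf hl hμ hδ hK hRm
  have hal := fun j => (ha j).loc (hr j)
  have hP : ∏ j, (4 * lam j) = 4 ^ m * ∏ j, lam j := by rw [Finset.prod_mul_distrib]; simp
  have hL := Finset.prod_pos (s := Finset.univ) fun j _ => hl j
  have hk3 : C3 * ((∏ j, (4 * lam j)) * (2 * μ)) ≤ t := by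
    rw [hP]; refine le_trans ?_ hK
    have : 0 ≤ CR * (4 ^ m * 2) * ((∏ j, lam j) * μ) := by positivity
    linarith
  have hkR : CR * ((∏ j, (4 * lam j)) * (2 * μ)) ≤ t := by
    rw [hP]; refine le_trans ?_ hK
    have : 0 ≤ C3 * (4 ^ m * 2) * ((∏ j, lam j) * μ) := by positivity
    linarith
  have ht : 0 < t := lt_of_lt_of_le (by positivity) hK
  set S := Om δ b a f (6 * t) \ BadS r p a f lam μ with hS
  have hch : ∀ x ∈ S, ∃ ε, δ ≤ ε ∧ 6 * t < |TA ε b a f x| := fun x hx => hx.1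
  choose! e he using hch
  set D : Set ℝ := {x | 3 * t < |TA δ b a f x|} with hD
  have hDm : MeasurableSet D := measurableSet_lt measurable_const (TA_cont hp hf hb hal hδ).abs.measurable
  have := vit_measure (S := S) (T := univ) (r := fun x => e x / 4) (R := Rm / 4) volume (volume.restrict D) 10 (fun x hx => ?_) (fun x hx => ?_)
  · rwa [univ_inter, Measure.restrict_apply_univ] at this
  · obtain ⟨h1, h2⟩ := he x hx
    exact ⟨by linarith, by linarith [hRm _ x h1 h2]⟩
  · obtain ⟨h1, h2⟩ := he x hx
    set ε := e x
    have hε : 0 < ε := by linarith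
    obtain ⟨g1, g2⟩ := gd (ρ := ε) (c := x) hp hr ha ⟨hf.1, hf.2.1⟩ hl hμ hx.2 hε (by simp [hε.le])
    have hbad := h3 b a f δ x ε (2 * μ) (fun j => 4 * lam j) hb hal hf.1 hδ hε (by positivity) (fun j => by have := hl j; positivity) (fun j => g1 j ε le_rfl) hf.2.1.integrableOn (g2 ε le_rfl)
    set W := {z ∈ Icc (x - ε) (x + ε) | C3 * ((∏ j, (4 * lam j)) * (2 * μ)) < |∫ y in Icc (x - ε) (x + ε), KA δ b a z y * f y|} with hW
    have hsub : Icc (x - ε / 4) (x + ε / 4) ⊆ (Icc (x - ε / 4) (x + ε / 4) ∩ D) ∪ W := by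
      intro z hz
      by_cases hzW : z ∈ W
      · exact Or.inr hzW
      · left
        refine ⟨hz, ?_⟩
        have hzI : z ∈ Icc (x - ε) (x + ε) := ⟨by linarith [hz.1], by linarith [hz.2]⟩
        have w1 : |∫ y in Icc (x - ε) (x + ε), KA δ b a z y * f y| ≤ t := by
          by_contra hh; exact hzW ⟨hzI, by linarith⟩
        have w2 := (hRG b a f δ x z ε (2 * μ) R0 (fun j => 4 * lam j) hb hal hf hδ hε (abs_le.mpr ⟨by linarith [hz.1], by linarith [hz.2]⟩) (by positivity) (fun j => by have := hl j; positivity) g1 g2).trans hkR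
        rw [TA_trunc (ε := ε) (max_eq_right h1).symm] at w2
        show 3 * t < |TA δ b a f z|
        rw [TA_split hp hf hb hal hδ z x ε]
        set P := ∫ y in Icc (x - ε) (x + ε), KA δ b a z y * f y
        set Q := TA δ b a ({y | ε < |y - x|}.indicator f) z
        have t1 := abs_sub_abs_le_abs_sub (TA ε b a f x) (TA ε b a f x - Q)
        rw [sub_sub_cancel, abs_sub_comm _ Q] at t1
        have t2 := abs_sub_abs_le_abs_sub Q (-P)
        rw [sub_neg_eq_add, abs_neg, add_comm Q P] at t2
        linarith
    have hv := (measure_mono (μ := volume) hsub).trans (measure_union_le _ _)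
    rw [Real.volume_Icc] at hv
    have hv2 : ENNReal.ofReal (ε / 4) ≤ volume (Icc (x - ε / 4) (x + ε / 4) ∩ D) := by
      have h5 : ENNReal.ofReal (ε / 4) + ENNReal.ofReal (1 / 4 * ε) ≤ volume (Icc (x - ε / 4) (x + ε / 4) ∩ D) + ENNReal.ofReal (1 / 4 * ε) := by
        rw [← ENNReal.ofReal_add (by positivity) (by positivity)]
        refine le_trans (le_of_eq (by congr 1; ring)) (hv.trans (by gcongr))
      exact (ENNReal.add_le_add_iff_right ENNReal.ofReal_ne_top).mp h5
    rw [univ_inter, Measure.restrict_apply measurableSet_Icc, Real.volume_Icc]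
    calc _ = 10 * ENNReal.ofReal (ε / 4) := by
          rw [← ENNReal.ofReal_ofNat, ← ENNReal.ofReal_mul (by norm_num)]; congr 1; ring
      _ ≤ _ := by gcongr

lemma goodlam (m : ℕ) {p η : ℝ} (hp : 1 < p) (hη : 0 < η) : ∃ K : ℝ, 0 < K ∧ ∀ (r : Fin m → ℝ) (b : ℝ → ℝ) (a : Fin m → ℝ → ℝ) (f : ℝ → ℝ) (lam : Fin m → ℝ) (μ δ R0 t : ℝ), BM1 b → (∀ j, 1 ≤ r j) → (∀ j, HL (r j) (a j)) →
    CS p R0 f → (∀ j, 0 < lam j) → 0 < μ → 0 < δ → K * ((∏ j, lam j) * μ) ≤ t → volume (Om δ b a f t) < ⊤ →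
    volume ({x | 3 * t < |TA δ b a f x|} \ BadS r p a f lam μ) ≤ ENNReal.ofReal (40 * η) * volume (Om δ b a f t) := by
  obtain ⟨C3, hC3, h3⟩ := L3 m (δ := η) hp hη
  obtain ⟨CR, hCR, hRG⟩ := REG m hp
  refine ⟨(C3 + CR) * (4 ^ m * 2), by positivity, ?_⟩
  intro r b a f lam μ δ R0 t hb hr ha hf hl hμ hδ hK hfin
  have hal := fun j => (ha j).loc (hr j)
  have hP : ∏ j, (4 * lam j) = 4 ^ m * ∏ j, lam j := by rw [Finset.prod_mul_distrib]; simp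
  have hL := Finset.prod_pos (s := Finset.univ) fun j _ => hl j
  have hk3 : C3 * ((∏ j, (4 * lam j)) * (2 * μ)) ≤ t := by
    rw [hP]; refine le_trans ?_ hK
    have : 0 ≤ CR * (4 ^ m * 2) * ((∏ j, lam j) * μ) := by positivity
    linarith
  have hkR : CR * ((∏ j, (4 * lam j)) * (2 * μ)) ≤ t := by
    rw [hP]; refine le_trans ?_ hK
    have : 0 ≤ C3 * (4 ^ m * 2) * ((∏ j, lam j) * μ) := by positivity
    linarith
  have ht : 0 < t := lt_of_lt_of_le (by positivity) hK
  set Ω := Om δ b a f t with hΩ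
  have hop : IsOpen Ω := Om_open hp hf hb hal hδ t
  set T := {x | 3 * t < |TA δ b a f x|} \ BadS r p a f lam μ with hT
  have hTΩ : T ⊆ Ω := fun x hx => by
    have : 3 * t < |TA δ b a f x| := hx.1
    exact ⟨δ, le_rfl, by linarith⟩
  have hne : (Ωᶜ).Nonempty := by
    rw [nonempty_compl]; intro h; rw [h] at hfin; simp at hfin
  set d : ℝ → ℝ := fun x => Metric.infDist x Ωᶜ with hd
  have hdp : ∀ x ∈ Ω, 0 < d x := fun x hx => (hop.isClosed_compl.notMem_iff_infDist_pos hne).mp (fun h => h hx)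
  have hball : ∀ x, ∀ s, s < d x → Icc (x - s) (x + s) ⊆ Ω := fun x s hs z hz => by
    by_contra hh
    have h1 := Metric.infDist_le_dist_of_mem (x := x) (show z ∈ Ωᶜ from hh)
    rw [Real.dist_eq, abs_sub_comm] at h1
    have : |z - x| ≤ s := abs_le.mpr ⟨by linarith [hz.1], by linarith [hz.2]⟩
    exact absurd (h1.trans this) (not_le.mpr hs)
  have := vit_measure (S := Ω) (T := T) (r := fun x => d x / 10) (R := (volume Ω).toReal) volume (volume.restrict Ω) (ENNReal.ofReal (40 * η)) (fun x hx => ?_) (fun x hx => ?_)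
  · rwa [inter_eq_left.mpr hTΩ, Measure.restrict_apply_univ] at this
  · have h0 := hdp x hx
    refine ⟨by positivity, ?_⟩
    rw [← ENNReal.ofReal_le_iff_le_toReal hfin.ne]
    refine le_trans ?_ (measure_mono (hball x (d x / 2) (by linarith)))
    rw [Real.volume_Icc]; exact ENNReal.ofReal_le_ofReal (by linarith)
  · have h0 := hdp x hx
    set R := d x with hR
    have e1 : Icc (x - 5 * (R / 10)) (x + 5 * (R / 10)) = Icc (x - R / 2) (x + R / 2) := by congr 1 <;> ring
    simp only [e1]
    have e2 : volume.restrict Ω (Icc (x - R / 10) (x + R / 10)) = ENNReal.ofReal (R / 5) := by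
      rw [Measure.restrict_apply measurableSet_Icc, inter_eq_left.mpr (hball x (R / 10) (by linarith)), Real.volume_Icc]; congr 1; ring
    rw [e2, ← ENNReal.ofReal_mul (by positivity)]
    rcases (T ∩ Icc (x - R / 2) (x + R / 2)).eq_empty_or_nonempty with h | ⟨x1, hx1T, hx1⟩
    · rw [h]; simp
    obtain ⟨x0, hx0, hx0d⟩ := hop.isClosed_compl.exists_infDist_eq_dist hne x
    rw [Real.dist_eq] at hx0d
    have hx0d' : |x - x0| = R := hx0d.symm
    have hab := abs_le.mp hx0d'.le
    have hnear : ∀ z ∈ Icc (x - R / 2) (x + R / 2), |z - x0| ≤ 8 * R / 4 := fun z hz => abs_le.mpr ⟨by linarith [hz.1], by linarith [hz.2]⟩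
    obtain ⟨g1, g2⟩ := gd (ρ := 8 * R) (c := x0) hp hr ha ⟨hf.1, hf.2.1⟩ hl hμ hx1T.2 (by positivity) (by linarith [hnear x1 hx1])
    have hbad := h3 b a f δ x0 (8 * R) (2 * μ) (fun j => 4 * lam j) hb hal hf.1 hδ (by positivity) (by positivity) (fun j => by have := hl j; positivity) (fun j => g1 j _ le_rfl) hf.2.1.integrableOn (g2 _ le_rfl)
    refine le_trans (measure_mono ?_) (hbad.trans (ENNReal.ofReal_le_ofReal (by linarith)))
    rintro z ⟨hzT, hz⟩
    have hzn := hnear z hz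
    have hzn' := abs_le.mp hzn
    refine ⟨⟨by linarith, by linarith⟩, lt_of_le_of_lt hk3 ?_⟩
    have w2 := (hRG b a f δ x0 z (8 * R) (2 * μ) R0 (fun j => 4 * lam j) hb hal hf hδ (by positivity) hzn (by positivity) (fun j => by have := hl j; positivity) g1 g2).trans hkR
    rw [TA_trunc (ε := max δ (8 * R)) rfl] at w2
    have w3 : |TA (max δ (8 * R)) b a f x0| ≤ t := by
      by_contra hh; exact hx0 ⟨_, le_max_left _ _, not_le.mp hh⟩
    have w4 : 3 * t < |TA δ b a f z| := hzT.1
    rw [TA_split hp hf hb hal hδ z x0 (8 * R)] at w4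
    have t1 := abs_sub_abs_le_abs_sub (TA δ b a ({y | 8 * R < |y - x0|}.indicator f) z) (TA (max δ (8 * R)) b a f x0)
    have t2 := abs_add_le (∫ y in Icc (x0 - 8 * R) (x0 + 8 * R), KA δ b a z y * f y) (TA δ b a ({y | 8 * R < |y - x0|}.indicator f) z)
    linarith

lemma iter {φ : ℝ → ℝ} {D θ s p M : ℝ} (hD : 0 ≤ D) (hθ : 0 ≤ θ) (hsp : s ≤ p) (h1 : ∀ t, 0 < t → φ (6 * t) ≤ D * t ^ (-s) + θ * φ t)
    (h2 : ∀ t, 0 < t → φ t ≤ M * t ^ (-p)) (hM : 0 ≤ M) (hθp : θ * 6 ^ p ≤ 1 / 2) {t : ℝ} (ht : 0 < t) : φ t ≤ 2 * 6 ^ s * D * t ^ (-s) := by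
  have hθs : θ * 6 ^ s ≤ 1 / 2 := (mul_le_mul_of_nonneg_left (Real.rpow_le_rpow_of_exponent_le (by norm_num) hsp) hθ).trans hθp
  have key : ∀ n : ℕ, ∀ t, 0 < t → φ t ≤ 2 * 6 ^ s * D * t ^ (-s) + M * (1 / 2) ^ n * t ^ (-p) := by
    intro n
    induction n with
    | zero =>
      intro t ht
      have : 0 ≤ 2 * 6 ^ s * D * t ^ (-s) := by positivity
      have := h2 t ht
      simp only [pow_zero, mul_one]; linarith
    | succ n ih =>
      intro t ht
      have e : ∀ q : ℝ, (t / 6) ^ (-q) = 6 ^ q * t ^ (-q) := fun q => by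
        rw [Real.div_rpow ht.le (by norm_num), Real.rpow_neg (by norm_num : (0 : ℝ) ≤ 6)]; field_simp
      have i1 := h1 (t / 6) (by positivity)
      have i2 := mul_le_mul_of_nonneg_left (ih (t / 6) (by positivity)) hθ
      rw [mul_div_cancel₀ _ (by norm_num : (6 : ℝ) ≠ 0)] at i1
      rw [e, e] at i2
      rw [e] at i1
      have j1 := mul_le_mul_of_nonneg_right hθs (show 0 ≤ 2 * 6 ^ s * D * t ^ (-s) by positivity)
      have j2 := mul_le_mul_of_nonneg_right hθp (show 0 ≤ M * (1 / 2) ^ n * t ^ (-p) by positivity)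
      rw [pow_succ]
      nlinarith
  have hl : Tendsto (fun n : ℕ => 2 * 6 ^ s * D * t ^ (-s) + M * (1 / 2) ^ n * t ^ (-p)) atTop (nhds (2 * 6 ^ s * D * t ^ (-s) + M * 0 * t ^ (-p))) :=
    (((tendsto_pow_atTop_nhds_zero_of_lt_one (by norm_num) (by norm_num)).const_mul M).mul_const _).const_add _
  have := ge_of_tendsto' hl fun n => key n t ht
  simpa using this

/-! ### Weak type estimate for the maximal truncation, compactly supported functions -/

lemma apriori {m : ℕ} {p R0 δ : ℝ} (hp : 1 < p) {f : ℝ → ℝ} (hf : CS p R0 f) {b : ℝ → ℝ} (hb : BM1 b) {r : Fin m → ℝ} (hr : ∀ j, 1 ≤ r j) {a : Fin m → ℝ → ℝ} (ha : ∀ j, HL (r j) (a j))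
    (hδ : 0 < δ) : ∃ M : ℝ, 0 ≤ M ∧ (∀ ε x, δ ≤ ε → |TA ε b a f x| ≤ M * (max |x| (max (2 * R0) 1)) ^ (-(1 / p))) ∧ ∀ ε x, |x| + R0 ≤ ε → TA ε b a f x = 0 := by
  obtain ⟨Cb, hCb, hob⟩ := one_ball hp
  have hal := fun j => (ha j).loc (hr j)
  set R1 := max (2 * R0) 1 with hR1
  set F := ∫ y, |f y| ^ p with hF
  have hF0 : 0 ≤ F := integral_nonneg fun _ => by positivity
  set l : Fin m → ℝ := fun j => 2 + ∫ y, |a j y| ^ r j with hl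
  have hl0 : ∀ j, 0 < l j := fun j => by
    have : 0 ≤ ∫ y, |a j y| ^ r j := integral_nonneg fun _ => by positivity
    simp only [hl]; linarith
  have hL := Finset.prod_pos (s := Finset.univ) fun j _ => hl0 j
  set s := max 2 (R1 / δ) with hs
  have hs0 : 0 < s := lt_of_lt_of_le (by norm_num) (le_max_left _ _)
  refine ⟨2 * s ^ (m + 2) * (∏ j, l j) * (2 * 1 + Cb) * F ^ (1 / p), by positivity, ?_, ?_⟩
  · intro ε x hε
    set R := max |x| R1 with hR
    have h1R : 1 ≤ R := (le_max_right _ _).trans (le_max_right _ _)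
    have hR0 : 0 < R := by linarith
    have h2R : 2 * R0 ≤ R := (le_max_left _ _).trans (le_max_right _ _)
    have hxR : |x| ≤ R := le_max_left _ _
    have hx' := abs_le.mp hxR
    have haR : ∀ j, ∫ t in Icc (0 - R) (0 + R), |a j t| ≤ l j * R := fun j => by
      calc ∫ t in Icc (0 - R) (0 + R), |a j t| ≤ ∫ t in Icc (0 - R) (0 + R), (1 + |a j t| ^ r j) := by
            refine integral_mono ((hal j).integrableOn_isCompact isCompact_Icc).abs ((integrableOn_const (by simp)).add (ha j).2.integrableOn) fun y => ?_
            show |a j y| ≤ 1 + |a j y| ^ r j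
            rcases le_total |a j y| 1 with h1 | h1
            · have : 0 ≤ |a j y| ^ r j := by positivity
              linarith
            · have := Real.rpow_le_rpow_of_exponent_le h1 (hr j)
              rw [Real.rpow_one] at this; linarith
        _ = 2 * R + ∫ t in Icc (0 - R) (0 + R), |a j t| ^ r j := by
            have ic : IntegrableOn (fun _ : ℝ => (1:ℝ)) (Icc (0 - R) (0 + R)) := integrableOn_const (by simp)
            have ia : IntegrableOn (fun t => |a j t| ^ r j) (Icc (0 - R) (0 + R)) := (ha j).2.integrableOn
            rw [integral_add ic ia]
            simp [Real.volume_real_Icc]; rw [max_eq_left (by linarith)]; ring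
        _ ≤ 2 * R + ∫ t, |a j t| ^ r j := by
            have := setIntegral_le_integral (s := Icc (0 - R) (0 + R)) (ha j).2 (Eventually.of_forall fun _ => by positivity)
            linarith
        _ ≤ _ := by
            have : 0 ≤ ∫ y, |a j y| ^ r j := integral_nonneg fun _ => by positivity
            simp only [hl]; nlinarith
    have hfR : ∫ y in Icc (0 - R) (0 + R), |f y| ^ p ≤ ((F / R) ^ (1 / p)) ^ p * R := by
      rw [← Real.rpow_mul (by positivity), one_div_mul_cancel (by linarith), Real.rpow_one, div_mul_cancel₀ _ hR0.ne']
      exact setIntegral_le_integral hf.2.1 (Eventually.of_forall fun _ => by positivity)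
    have key := hob b hb f R0 hf 0 R ((F / R) ^ (1 / p)) (2 * s ^ (m + 2) * (∏ j, l j)) 1 (by positivity) hR0 (by positivity) (by norm_num) hfR
      (fun y => ENNReal.ofReal |KA ε b a x y * f y|) {y | f y ≠ 0} (fun y hy => by
        have : |y| ≤ R0 := by by_contra h; exact hy (hf.2.2 y (not_le.mp h))
        have h2 := abs_le.mp this
        exact ⟨by linarith, by linarith⟩) (fun y hy => by
        have hyR : |y| ≤ R0 := by by_contra h; exact hy (hf.2.2 y (not_le.mp h))
        have h2 := abs_le.mp hyR
        refine ENNReal.ofReal_le_ofReal ?_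
        rw [abs_mul]
        gcongr
        by_cases hq : ε < |x - y|
        · refine KA_size hb hal hR0 hs0 ⟨by linarith, by linarith⟩ ⟨by linarith, by linarith⟩ ?_ haR
          rcases le_total R1 |x| with h3 | h3
          · rw [hR, max_eq_left h3]
            have h4 : 2 * R0 ≤ |x| := (le_max_left _ _).trans h3
            have h5 := abs_sub_abs_le_abs_sub x y
            calc |x| ≤ 2 * |x - y| := by linarith
              _ ≤ _ := by gcongr; exact le_max_left _ _
          · rw [hR, max_eq_right h3]
            have hR1p : 0 < R1 := lt_of_lt_of_le one_pos (le_max_right _ _)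
            calc R1 = R1 / δ * δ := by field_simp
              _ ≤ _ := by gcongr; exacts [le_max_right _ _, by linarith]
        · unfold KA; rw [if_neg hq, abs_zero]; positivity)
    have hinteg := TA_int hp hf hb hal (by linarith : 0 < ε) x
    unfold TA
    refine abs_integral_le_integral_abs.trans ?_
    have hRp : (0 : ℝ) < R ^ (-(1 / p)) := by positivity
    rw [← ENNReal.ofReal_le_ofReal_iff (by positivity), ofReal_integral_eq_lintegral_ofReal hinteg.abs (Eventually.of_forall fun _ => abs_nonneg _)]
    have hms : MeasurableSet {y | f y ≠ 0} := hf.1 (measurableSet_singleton 0).compl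
    calc _ = ∫⁻ y in {y | f y ≠ 0}, ENNReal.ofReal |KA ε b a x y * f y| := by
          rw [← lintegral_indicator hms]
          congr 1; ext y
          by_cases hy : f y = 0
          · rw [indicator_of_notMem (by simpa using hy), hy, mul_zero]; simp
          · rw [indicator_of_mem (by simpa using hy)]
      _ ≤ _ := key
      _ = _ := by
          congr 1; rw [Real.div_rpow hF0 hR0.le, Real.rpow_neg hR0.le]; ring
  · intro ε x hε
    unfold TA
    rw [← integral_zero ℝ ℝ]
    congr 1; ext y
    by_cases hy : R0 < |y|
    · rw [hf.2.2 y hy, mul_zero]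
    · unfold KA; rw [if_neg, zero_mul]
      have := abs_sub x y
      linarith

lemma Om_vol {m : ℕ} {p R0 δ : ℝ} (hp : 1 < p) {f : ℝ → ℝ} (hf : CS p R0 f) {b : ℝ → ℝ} (hb : BM1 b) {r : Fin m → ℝ} (hr : ∀ j, 1 ≤ r j) {a : Fin m → ℝ → ℝ} (ha : ∀ j, HL (r j) (a j))
    (hδ : 0 < δ) : ∃ M : ℝ, 0 ≤ M ∧ (∀ t, 0 < t → volume (Om δ b a f t) ≤ ENNReal.ofReal (M * t ^ (-p))) ∧ ∀ t, 0 < t → ∃ Rm, ∀ ε x, δ ≤ ε → t < |TA ε b a f x| → ε ≤ Rm := by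
  obtain ⟨M, hM, h1, h2⟩ := apriori hp hf hb hr ha hδ
  have key : ∀ t, 0 < t → ∀ ε x, δ ≤ ε → t < |TA ε b a f x| → |x| ≤ M ^ p * t ^ (-p) := by
    intro t ht ε x hε hx
    have h3 := hx.trans_le (h1 ε x hε)
    set R := max |x| (max (2 * R0) 1) with hR
    have hR0 : 0 < R := lt_of_lt_of_le one_pos ((le_max_right _ _).trans (le_max_right _ _))
    refine (le_max_left |x| (max (2 * R0) 1)).trans ?_
    rw [← hR]
    rw [Real.rpow_neg hR0.le, ← div_eq_mul_inv, lt_div_iff₀ (by positivity)] at h3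
    have h4 : R ^ (1 / p) ≤ M / t := by rw [le_div_iff₀ ht]; linarith
    have h5 := Real.rpow_le_rpow (by positivity) h4 (by linarith : 0 ≤ p)
    rw [← Real.rpow_mul hR0.le, one_div_mul_cancel (by linarith), Real.rpow_one, Real.div_rpow hM ht.le] at h5
    rw [Real.rpow_neg ht.le, ← div_eq_mul_inv]; exact h5
  refine ⟨2 * M ^ p, by positivity, ?_, ?_⟩
  · intro t ht
    have hsub : Om δ b a f t ⊆ Icc (-(M ^ p * t ^ (-p))) (M ^ p * t ^ (-p)) := by
      rintro x ⟨ε, hε, hx⟩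
      exact abs_le.mp (key t ht ε x hε hx)
    refine (measure_mono hsub).trans ?_
    rw [Real.volume_Icc]; exact ENNReal.ofReal_le_ofReal (by linarith)
  · intro t ht
    refine ⟨M ^ p * t ^ (-p) + R0, fun ε x hε hx => ?_⟩
    by_contra hh
    have h3 := key t ht ε x hε hx
    rw [h2 ε x (by linarith)] at hx
    simp at hx; linarith

lemma KA_zero {m : ℕ} {ε : ℝ} {b : ℝ → ℝ} {a : Fin m → ℝ → ℝ} {j : Fin m} (h : a j =ᵐ[volume] 0) (x y : ℝ) : KA ε b a x y = 0 := by
  have : ∫ t in y..x, a j t = 0 := by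
    rw [intervalIntegral.integral_congr_ae (g := fun _ => 0)]; simp
    filter_upwards [h] with t ht _ using ht
  unfold KA; rw [Finset.prod_eq_zero (Finset.mem_univ j) this]; simp

lemma int_rpow_zero {r : ℝ} (hr : 0 < r) {g : ℝ → ℝ} (hg : Integrable (fun y => |g y| ^ r)) (h : ∫ y, |g y| ^ r = 0) : g =ᵐ[volume] 0 := by
  rw [integral_eq_zero_iff_of_nonneg (fun _ => by positivity) hg] at h
  filter_upwards [h] with y hy
  have : |g y| ^ r = 0 := hy
  rw [Real.rpow_eq_zero (abs_nonneg _) hr.ne'] at this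
  exact abs_eq_zero.mp this

lemma weakCS (m : ℕ) {p s : ℝ} {r : Fin m → ℝ} (hp : 1 < p) (hr : ∀ j, 1 ≤ r j) (hs : 1 / s = (∑ j, 1 / r j) + 1 / p) : ∃ C : ℝ, 0 < C ∧ ∀ (b : ℝ → ℝ) (a : Fin m → ℝ → ℝ) (f : ℝ → ℝ) (δ R0 t : ℝ), BM1 b → (∀ j, HL (r j) (a j)) →
    CS p R0 f → 0 < δ → 0 < t → volume (Om δ b a f t) ≤ ENNReal.ofReal (C * (((∏ j, (∫ y, |a j y| ^ r j) ^ (1 / r j)) * (∫ y, |f y| ^ p) ^ (1 / p)) / t) ^ s) := by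
  have hp0 : 0 < p := by linarith
  have hr0 : ∀ j, 0 < r j := fun j => by linarith [hr j]
  have hsum : 0 ≤ ∑ j, 1 / r j := Finset.sum_nonneg fun j _ => by have := hr0 j; positivity
  have h1s : 0 < 1 / s := by rw [hs]; positivity
  have hs0 : 0 < s := one_div_pos.mp h1s
  have hsp : s ≤ p := by
    rw [← one_div_le_one_div hp0 hs0, hs]; linarith
  set η : ℝ := (6 : ℝ) ^ (-p) / 800 with hη
  have hη0 : 0 < η := by positivity
  obtain ⟨K1, hK1, hc⟩ := cotlar m hp
  obtain ⟨K2, hK2, hg⟩ := goodlam m hp hη0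
  set K := K1 + K2 with hK
  have hKp : 0 < K := by positivity
  refine ⟨2 * 6 ^ s * (110 * (m + 1) * K ^ s), by positivity, ?_⟩
  intro b a f δ R0 t hb ha hf hδ ht
  set N : Fin m → ℝ := fun j => ∫ y, |a j y| ^ r j with hN
  set F := ∫ y, |f y| ^ p with hF
  by_cases hz : (∃ j, N j = 0) ∨ F = 0
  · have : Om δ b a f t = ∅ := by
      rw [eq_empty_iff_forall_notMem]
      rintro x ⟨ε, hε, hx⟩
      have : TA ε b a f x = 0 := by
        unfold TA
        rcases hz with ⟨j, hj⟩ | hz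
        · have := int_rpow_zero (hr0 j) (ha j).2 hj
          simp [KA_zero this]
        · have := int_rpow_zero hp0 hf.2.1 hz
          rw [integral_eq_zero_of_ae]
          filter_upwards [this] with y hy
          rw [hy]; simp
      rw [this] at hx; simp at hx; linarith
    rw [this]; simp
  rw [not_or, not_exists] at hz
  have hN0 : ∀ j, 0 < N j := fun j => lt_of_le_of_ne (integral_nonneg fun _ => by positivity) (Ne.symm (hz.1 j))
  have hF0 : 0 < F := lt_of_le_of_ne (integral_nonneg fun _ => by positivity) (Ne.symm hz.2)
  set Λ := (∏ j, N j ^ (1 / r j)) * F ^ (1 / p) with hΛ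
  have hΛ0 : 0 < Λ := mul_pos (Finset.prod_pos fun j _ => Real.rpow_pos_of_pos (hN0 j) _) (by positivity)
  obtain ⟨M, hM, hM1, hM2⟩ := Om_vol hp hf hb hr ha hδ
  have hfin : ∀ t, 0 < t → volume (Om δ b a f t) < ⊤ := fun t ht => (hM1 t ht).trans_lt ENNReal.ofReal_lt_top
  have main := iter (φ := fun t => (volume (Om δ b a f t)).toReal) (D := 110 * (m + 1) * (K * Λ) ^ s) (θ := 400 * η) (s := s) (p := p) (M := M) (by positivity) (by positivity) hsp ?_ ?_ hM ?_ ht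
  · rw [← ENNReal.ofReal_toReal (hfin t ht).ne]
    refine ENNReal.ofReal_le_ofReal (main.trans (le_of_eq ?_))
    rw [Real.div_rpow hΛ0.le ht.le, Real.rpow_neg ht.le, Real.mul_rpow hKp.le hΛ0.le]; ring
  · intro t ht
    set V := (K * Λ / t) ^ s with hV
    have hV0 : 0 < V := by positivity
    set lam : Fin m → ℝ := fun j => (N j / V) ^ (1 / r j) with hlam
    set μ := (F / V) ^ (1 / p) with hμ
    have hlam0 : ∀ j, 0 < lam j := fun j => Real.rpow_pos_of_pos (div_pos (hN0 j) hV0) _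
    have hμ0 : 0 < μ := by positivity
    have hlr : ∀ j, lam j ^ r j = N j / V := fun j => by
      simp only [hlam]; rw [← Real.rpow_mul (div_pos (hN0 j) hV0).le, one_div_mul_cancel (hr0 j).ne', Real.rpow_one]
    have hμp : μ ^ p = F / V := by
      rw [hμ, ← Real.rpow_mul (by positivity), one_div_mul_cancel hp0.ne', Real.rpow_one]
    have hprod : K * ((∏ j, lam j) * μ) = t := by
      have e1 : (∏ j, lam j) * μ = Λ / V ^ (1 / s) := by
        have : ∀ j, lam j = N j ^ (1 / r j) / V ^ (1 / r j) := fun j => Real.div_rpow (hN0 j).le hV0.le _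
        simp only [this]
        rw [Finset.prod_div_distrib, hμ, Real.div_rpow hF0.le hV0.le, hs, Real.rpow_add hV0, ← Real.rpow_sum_of_pos hV0, hΛ]
        field_simp
      have e2 : V ^ (1 / s) = K * Λ / t := by
        rw [hV, ← Real.rpow_mul (by positivity), mul_one_div_cancel hs0.ne', Real.rpow_one]
      rw [e1, e2]; field_simp
    have hLpos : 0 < (∏ j, lam j) * μ := mul_pos (Finset.prod_pos fun j _ => hlam0 j) hμ0
    obtain ⟨Rm, hRm⟩ := hM2 (6 * t) (by positivity)
    have c1 := hc r b a f lam μ δ R0 t Rm hb hr ha hf hlam0 hμ0 hδ (by rw [← hprod]; gcongr; rw [hK]; linarith) hRm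
    have c2 := hg r b a f lam μ δ R0 t hb hr ha hf hlam0 hμ0 hδ (by rw [← hprod]; gcongr; rw [hK]; linarith) (hfin t ht)
    have hBad : volume (BadS r p a f lam μ) ≤ ENNReal.ofReal (10 * (m + 1) * V) := by
      have b1 : ∀ j, volume (Bad (fun y => |a j y| ^ r j) (lam j ^ r j)) ≤ ENNReal.ofReal (10 * V) := fun j => by
        refine (Bad_weak (ha j).2 (fun _ => by positivity) (Real.rpow_pos_of_pos (hlam0 j) _)).trans (ENNReal.ofReal_le_ofReal (le_of_eq ?_))
        rw [hlr]; show 10 / (N j / V) * N j = _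
        have := (hN0 j).ne'
        field_simp
      have b2 : volume (Bad (fun y => |f y| ^ p) (μ ^ p)) ≤ ENNReal.ofReal (10 * V) := by
        refine (Bad_weak hf.2.1 (fun _ => by positivity) (by positivity)).trans (ENNReal.ofReal_le_ofReal (le_of_eq ?_))
        rw [hμp]; show 10 / (F / V) * F = _
        field_simp
      calc _ ≤ (∑ j : Fin m, ENNReal.ofReal (10 * V)) + ENNReal.ofReal (10 * V) := by
            refine (measure_union_le _ _).trans (add_le_add ((measure_iUnion_fintype_le _ _).trans (Finset.sum_le_sum fun j _ => b1 j)) b2)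
        _ = _ := by
            rw [Finset.sum_const, Finset.card_univ, Fintype.card_fin, nsmul_eq_mul, ← ENNReal.ofReal_natCast, ← ENNReal.ofReal_mul (by positivity), ← ENNReal.ofReal_add (by positivity) (by positivity)]
            congr 1; ring
    have split : ∀ X : Set ℝ, volume X ≤ volume (X \ BadS r p a f lam μ) + volume (BadS r p a f lam μ) := fun X => by
      refine (measure_mono ?_).trans (measure_union_le _ _)
      intro x hx
      by_cases h : x ∈ BadS r p a f lam μ
      · exact Or.inr h
      · exact Or.inl ⟨hx, h⟩
    have tot : volume (Om δ b a f (6 * t)) ≤ ENNReal.ofReal (110 * (m + 1) * V + 400 * η * (volume (Om δ b a f t)).toReal) := by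
      set w := (volume (Om δ b a f t)).toReal with hw
      have hw0 : 0 ≤ w := ENNReal.toReal_nonneg
      rw [← ENNReal.ofReal_toReal (hfin t ht).ne, ← hw] at c2
      calc _ ≤ 10 * (ENNReal.ofReal (40 * η) * ENNReal.ofReal w + ENNReal.ofReal (10 * (m + 1) * V)) + ENNReal.ofReal (10 * (m + 1) * V) := by
            refine (split _).trans (add_le_add (c1.trans ?_) hBad)
            refine mul_le_mul' le_rfl ((split _).trans (add_le_add c2 hBad))
        _ = _ := by
            rw [← ENNReal.ofReal_mul (by positivity), ← ENNReal.ofReal_add (by positivity) (by positivity), ← ENNReal.ofReal_ofNat, ← ENNReal.ofReal_mul (by norm_num), ← ENNReal.ofReal_add (by positivity) (by positivity)]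
            congr 1; ring
    have := ENNReal.toReal_le_of_le_ofReal (by positivity) tot
    refine this.trans (le_of_eq ?_)
    rw [hV, Real.div_rpow (by positivity) ht.le, Real.rpow_neg ht.le]; ring
  · intro t ht
    exact ENNReal.toReal_le_of_le_ofReal (by positivity) (hM1 t ht)
  · rw [hη, Real.rpow_neg (by norm_num)]
    have : (0 : ℝ) < 6 ^ p := by positivity
    field_simp; norm_num

/-! ### Density of step functions -/

lemma CS.hl {p R0 : ℝ} {f : ℝ → ℝ} (h : CS p R0 f) : HL p f := ⟨h.1, h.2.1⟩

lemma rpow_two_le {r u v : ℝ} (hr : 1 ≤ r) (hu : 0 ≤ u) (hv : 0 ≤ v) : (u + v) ^ r ≤ 2 ^ (r - 1) * (u ^ r + v ^ r) := by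
  lift u to NNReal using hu
  lift v to NNReal using hv
  exact_mod_cast NNReal.rpow_add_le_mul_rpow_add_rpow u v hr

lemma HL.sub {r : ℝ} (hr : 1 ≤ r) {f g : ℝ → ℝ} (hf : HL r f) (hg : HL r g) : HL r (fun y => f y - g y) ∧ ∫ y, |f y - g y| ^ r ≤ 2 ^ (r - 1) * ((∫ y, |f y| ^ r) + ∫ y, |g y| ^ r) := by
  have i1 : Integrable (fun y => 2 ^ (r - 1) * (|f y| ^ r + |g y| ^ r)) := (hf.2.add hg.2).const_mul _
  have hle : ∀ y, |f y - g y| ^ r ≤ 2 ^ (r - 1) * (|f y| ^ r + |g y| ^ r) := fun y =>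
    (Real.rpow_le_rpow (abs_nonneg _) (abs_sub _ _) (by linarith)).trans (rpow_two_le hr (abs_nonneg _) (abs_nonneg _))
  have hm : Measurable (fun y => f y - g y) := hf.1.sub hg.1
  have i2 : Integrable (fun y => |f y - g y| ^ r) := i1.mono' (hm.abs.pow_const r).aestronglyMeasurable (Eventually.of_forall fun y => by
    rw [Real.norm_eq_abs, abs_of_nonneg (by positivity)]; exact hle y)
  refine ⟨⟨hm, i2⟩, ?_⟩
  refine (integral_mono i2 i1 hle).trans (le_of_eq ?_)
  rw [integral_const_mul, integral_add hf.2 hg.2]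

lemma CS.sub {p R0 R1 : ℝ} (hp : 1 ≤ p) {f g : ℝ → ℝ} (hf : CS p R0 f) (hg : CS p R1 g) : CS p (max R0 R1) (fun y => f y - g y) := by
  obtain ⟨h1, h2⟩ := (HL.sub hp hf.hl hg.hl).1
  refine ⟨h1, h2, fun y hy => ?_⟩
  have := max_lt_iff.mp hy
  simp [hf.2.2 y this.1, hg.2.2 y this.2]

def Stp (g : ℝ → ℝ) : Prop := ∀ᵐ x : ℝ, ∃ η > 0, ∀ y, |y - x| < η → g y = g x

lemma floor_close (n : ℕ) (hn : 0 < n) (y : ℝ) : |(⌊n * y⌋ : ℝ) / n - y| ≤ 1 / n := by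
  have hn' : (0:ℝ) < n := by exact_mod_cast hn
  have h1 := Int.floor_le (n * y)
  have h2 := Int.lt_floor_add_one (n * y)
  rw [abs_le]
  constructor
  · rw [neg_le_sub_iff_le_add, ← add_div, le_div_iff₀ hn']; linarith
  · have : (⌊n * y⌋ : ℝ) / n ≤ y := by rw [div_le_iff₀ hn']; linarith
    have : (0:ℝ) ≤ 1 / n := by positivity
    linarith

lemma step_floor (h : ℝ → ℝ) (n : ℕ) (hn : 0 < n) : Stp (fun y => h ((⌊n * y⌋ : ℝ) / n)) := by
  have hn' : (0:ℝ) < n := by exact_mod_cast hn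
  have hc : (range fun k : ℤ => (k : ℝ) / n).Countable := countable_range _
  have := hc.ae_notMem (volume : Measure ℝ)
  filter_upwards [this] with x hx
  have h1 : (⌊n * x⌋ : ℝ) < n * x := by
    refine lt_of_le_of_ne (Int.floor_le _) fun he => hx ⟨⌊n * x⌋, ?_⟩
    simp only; rw [he]; field_simp
  have h2 := Int.lt_floor_add_one (n * x)
  refine ⟨min ((n * x - ⌊n * x⌋) / n) ((⌊n * x⌋ + 1 - n * x) / n), lt_min (div_pos (by linarith) hn') (div_pos (by linarith) hn'), fun y hy => ?_⟩
  obtain ⟨h3, h4⟩ := lt_min_iff.mp hy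
  rw [lt_div_iff₀ hn'] at h3 h4
  have h5 : |y - x| * n = |n * y - n * x| := by rw [← mul_sub, abs_mul, abs_of_pos hn', mul_comm]
  rw [h5] at h3 h4
  have : ⌊n * y⌋ = ⌊n * x⌋ := by
    rw [Int.floor_eq_iff]
    have := abs_lt.mp h3
    have := abs_lt.mp h4
    constructor <;> linarith
  simp only [this]

lemma step_dense {r : ℝ} (hr : 1 ≤ r) {g : ℝ → ℝ} (hg : HL r g) {θ : ℝ} (hθ : 0 < θ) : ∃ g' R1, CS r R1 g' ∧ Stp g' ∧ ∫ y, |g y - g' y| ^ r ≤ θ := by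
  have hr0 : 0 < r := by linarith
  have hM : MemLp g (ENNReal.ofReal r) volume := by
    rw [← integrable_norm_rpow_iff hg.1.aestronglyMeasurable (by simpa using hr0) (by simp), ENNReal.toReal_ofReal hr0.le]
    simpa [Real.norm_eq_abs] using hg.2
  have h2 : (0:ℝ) < 2 ^ (r - 1) := by positivity
  obtain ⟨h, hsupp, hle, hcont, hmem⟩ := hM.exists_hasCompactSupport_integral_rpow_sub_le hr0 (ε := θ / 2 / 2 ^ (r - 1)) (by positivity)
  rw [← integrable_norm_rpow_iff hmem.1 (by simpa using hr0) (by simp), ENNReal.toReal_ofReal hr0.le] at hmem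
  simp only [Real.norm_eq_abs] at hmem hle
  have hh : HL r h := ⟨hcont.measurable, hmem⟩
  obtain ⟨R, hR⟩ : ∃ R, ∀ y, R < |y| → h y = 0 := by
    obtain ⟨R, hR⟩ := hsupp.isCompact.isBounded.subset_closedBall 0
    refine ⟨R, fun y hy => ?_⟩
    by_contra hne
    have := hR (subset_tsupport h (Function.mem_support.mpr hne))
    simp at this; linarith
  obtain ⟨M, hMb⟩ := hsupp.exists_bound_of_continuous hcont
  have hM0 : 0 ≤ M := (norm_nonneg _).trans (hMb 0)
  simp only [Real.norm_eq_abs] at hMb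
  set hn : ℕ → ℝ → ℝ := fun n y => h ((⌊((n + 1 : ℕ) : ℝ) * y⌋ : ℝ) / ((n + 1 : ℕ) : ℝ)) with hhn
  have hnm : ∀ n, Measurable (hn n) := fun n => by
    refine hcont.measurable.comp ?_
    have : Measurable (fun y : ℝ => ⌊((n + 1 : ℕ) : ℝ) * y⌋) := Int.measurable_floor.comp (measurable_const.mul measurable_id)
    exact (measurable_from_top.comp this).div_const _
  have hns : ∀ n y, R + 1 < |y| → hn n y = 0 := fun n y hy => by
    refine hR _ ?_
    have h1 := floor_close (n + 1) n.succ_pos y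
    have h3 : (1:ℝ) / ((n + 1 : ℕ) : ℝ) ≤ 1 := by rw [div_le_one (by positivity)]; push_cast; linarith [(Nat.cast_nonneg n : (0:ℝ) ≤ n)]
    have h4 := abs_sub_abs_le_abs_sub y ((⌊((n + 1 : ℕ) : ℝ) * y⌋ : ℝ) / ((n + 1 : ℕ) : ℝ))
    rw [abs_sub_comm] at h4
    linarith
  have hib : Integrable (fun y : ℝ => (Icc (-(R + 1)) (R + 1)).indicator (fun _ => (2 * M) ^ r) y) := by
    have : IntegrableOn (fun _ : ℝ => (2 * M) ^ r) (Icc (-(R + 1)) (R + 1)) := integrableOn_const (by simp)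
    exact this.integrable_indicator measurableSet_Icc
  have hbd : ∀ n y, |h y - hn n y| ^ r ≤ (Icc (-(R + 1)) (R + 1)).indicator (fun _ => (2 * M) ^ r) y := fun n y => by
    by_cases hy : y ∈ Icc (-(R + 1)) (R + 1)
    · rw [indicator_of_mem hy]
      refine Real.rpow_le_rpow (abs_nonneg _) ((abs_sub _ _).trans ?_) hr0.le
      have := hMb y
      have := hMb ((⌊((n + 1 : ℕ) : ℝ) * y⌋ : ℝ) / ((n + 1 : ℕ) : ℝ))
      simp only [hhn]; linarith
    · rw [indicator_of_notMem hy]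
      have hy' : R + 1 < |y| := by
        by_contra hc
        exact hy (abs_le.mp (not_lt.mp hc))
      rw [hns n y hy', hR y (by linarith)]
      simp [Real.zero_rpow hr0.ne']
  have hlim : Tendsto (fun n => ∫ y, |h y - hn n y| ^ r) atTop (nhds 0) := by
    have := tendsto_integral_of_dominated_convergence (F := fun n y => |h y - hn n y| ^ r) (f := fun _ : ℝ => (0:ℝ)) _
      (fun n => by exact ((hcont.measurable.sub (hnm n)).abs.pow_const r).aestronglyMeasurable) hib (fun n => Eventually.of_forall fun y => by
        rw [Real.norm_eq_abs, abs_of_nonneg (by positivity)]; exact hbd n y) (Eventually.of_forall fun y => by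
        have h1 : Tendsto (fun n : ℕ => (⌊((n + 1 : ℕ) : ℝ) * y⌋ : ℝ) / ((n + 1 : ℕ) : ℝ)) atTop (nhds y) := by
          rw [tendsto_iff_dist_tendsto_zero]
          refine squeeze_zero (fun _ => dist_nonneg) (fun n => ?_) (tendsto_one_div_add_atTop_nhds_zero_nat (𝕜 := ℝ))
          rw [Real.dist_eq]
          exact_mod_cast floor_close (n + 1) n.succ_pos y
        have h2 : Tendsto (fun n => h y - hn n y) atTop (nhds 0) := by
          have := (tendsto_const_nhds (x := h y)).sub ((hcont.tendsto y).comp h1)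
          rw [sub_self] at this; exact this
        have := (h2.abs).rpow_const (p := r) (Or.inr hr0.le)
        simpa [Real.zero_rpow hr0.ne'] using this)
    simpa using this
  obtain ⟨n, hn1⟩ := (hlim.eventually (gt_mem_nhds (show (0:ℝ) < θ / 2 / 2 ^ (r - 1) by positivity))).exists
  have i3 : Integrable (fun y => |h y - hn n y| ^ r) := hib.mono' (((hcont.measurable.sub (hnm n)).abs.pow_const r).aestronglyMeasurable) (Eventually.of_forall fun y => by
        rw [Real.norm_eq_abs, abs_of_nonneg (by positivity)]; exact hbd n y)
  have h1 : HL r (fun y => h y - hn n y) := ⟨hcont.measurable.sub (hnm n), i3⟩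
  have hgn : HL r (hn n) := by
    have := (HL.sub hr hh h1).1
    simpa using this
  refine ⟨hn n, R + 1, ⟨hnm n, hgn.2, hns n⟩, step_floor h (n + 1) n.succ_pos, ?_⟩
  have h3 : HL r (fun y => hn n y - h y) := (HL.sub hr hgn hh).1
  have := (HL.sub hr (HL.sub hr hg hh).1 h3).2
  simp only [sub_sub_sub_cancel_right] at this
  have e : ∀ y, |hn n y - h y| = |h y - hn n y| := fun y => abs_sub_comm _ _
  have e2 : ∀ y, g y - h y - (hn n y - h y) = g y - hn n y := fun y => by ring
  simp only [e, e2] at this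
  refine this.trans ?_
  calc 2 ^ (r - 1) * ((∫ y, |g y - h y| ^ r) + ∫ y, |h y - hn n y| ^ r) ≤ 2 ^ (r - 1) * (θ / 2 / 2 ^ (r - 1) + θ / 2 / 2 ^ (r - 1)) := by gcongr
    _ = θ := by field_simp; ring

/-! ### Existence of principal values -/

def PVex (F : ℝ → ℝ) : Prop := ∃ l : ℝ, Tendsto F (nhdsWithin 0 (Ioi 0)) (nhds l)

lemma PVex_of_cauchy {F : ℝ → ℝ} (h : ∀ k : ℕ, ∃ η > 0, ∀ ε ε', 0 < ε → ε < η → 0 < ε' → ε' < η → |F ε - F ε'| ≤ 1 / ((k : ℝ) + 1)) : PVex F := by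
  have : Cauchy (map F (nhdsWithin 0 (Ioi 0))) := by
    rw [Metric.cauchy_iff]
    refine ⟨inferInstance, fun e he => ?_⟩
    obtain ⟨k, hk⟩ := exists_nat_one_div_lt he
    obtain ⟨η, hη, h1⟩ := h k
    refine ⟨F '' Ioo 0 η, image_mem_map (Ioo_mem_nhdsGT hη), ?_⟩
    rintro _ ⟨ε, h2, rfl⟩ _ ⟨ε', h3, rfl⟩
    rw [Real.dist_eq]
    exact (h1 ε ε' h2.1 h2.2 h3.1 h3.2).trans_lt hk
  exact cauchy_map_iff_exists_tendsto.mp this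

lemma PVex.cauchy {F : ℝ → ℝ} (h : PVex F) {e : ℝ} (he : 0 < e) : ∃ η > 0, ∀ ε ε', 0 < ε → ε < η → 0 < ε' → ε' < η → |F ε - F ε'| ≤ e := by
  obtain ⟨l, hl⟩ := h
  have := hl.eventually (Metric.ball_mem_nhds l (half_pos he))
  obtain ⟨η, hη, h1⟩ := mem_nhdsGT_iff_exists_Ioo_subset.mp this
  refine ⟨η, hη, fun ε ε' h2 h3 h4 h5 => ?_⟩
  have a1 : |F ε - l| < e / 2 := h1 ⟨h2, h3⟩
  have a2 : |F ε' - l| < e / 2 := h1 ⟨h4, h5⟩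
  have := abs_sub_le (F ε) l (F ε')
  rw [abs_sub_comm l] at this
  linarith

lemma pv_lim {F : ℝ → ℝ → ℝ} (h : ∀ t η : ℝ, 0 < t → 0 < η → ∃ G : ℝ → ℝ → ℝ, (∀ᵐ x : ℝ, PVex (fun ε => G ε x)) ∧ volume {x : ℝ | ∃ ε, 0 < ε ∧ t < |F ε x - G ε x|} ≤ ENNReal.ofReal η) :
    ∀ᵐ x : ℝ, PVex (fun ε => F ε x) := by
  have key : ∀ k : ℕ, ∀ᵐ x : ℝ, ∃ η > 0, ∀ ε ε', 0 < ε → ε < η → 0 < ε' → ε' < η → |F ε x - F ε' x| ≤ 1 / ((k : ℝ) + 1) := by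
    intro k
    have hk : (0:ℝ) < 1 / ((k : ℝ) + 1) := by positivity
    rw [ae_iff]
    refine le_antisymm ?_ zero_le
    refine ENNReal.le_of_forall_pos_le_add fun η hη _ => ?_
    rw [zero_add]
    obtain ⟨G, hG, hv⟩ := h (1 / ((k : ℝ) + 1) / 3) η (by positivity) (by exact_mod_cast hη)
    have hv' : volume {x : ℝ | ∃ ε, 0 < ε ∧ 1 / ((k : ℝ) + 1) / 3 < |F ε x - G ε x|} ≤ η := by simpa using hv
    rw [ae_iff] at hG
    refine (measure_mono (t := {x : ℝ | ¬ PVex (fun ε => G ε x)} ∪ {x : ℝ | ∃ ε, 0 < ε ∧ 1 / ((k : ℝ) + 1) / 3 < |F ε x - G ε x|}) ?_).trans ((measure_union_le _ _).trans (by rw [hG, zero_add]; exact hv'))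
    intro x hx
    by_contra hc
    simp only [mem_union, Set.mem_ofPred_eq, not_or, not_not, not_exists, not_and, not_lt] at hc
    obtain ⟨h1, h2⟩ := hc
    apply hx
    obtain ⟨η', hη', h3⟩ := h1.cauchy (e := 1 / ((k : ℝ) + 1) / 3) (by positivity)
    refine ⟨η', hη', fun ε ε' a1 a2 a3 a4 => ?_⟩
    have b1 := h3 ε ε' a1 a2 a3 a4
    have b2 := abs_le.mp (h2 ε a1)
    have b3 := abs_le.mp (h2 ε' a3)
    have b1 := abs_le.mp b1
    rw [abs_le]
    constructor <;> linarith
  filter_upwards [ae_all_iff.mpr key] with x hx using PVex_of_cauchy hx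

/-- the maximal weak type estimate -/
lemma weakHL (m : ℕ) {p s : ℝ} {r : Fin m → ℝ} (hp : 1 < p) (hr : ∀ j, 1 ≤ r j) (hs : 1 / s = (∑ j, 1 / r j) + 1 / p) : ∃ C : ℝ, 0 < C ∧ ∀ (b : ℝ → ℝ) (a : Fin m → ℝ → ℝ) (f : ℝ → ℝ) (t : ℝ), BM1 b → (∀ j, HL (r j) (a j)) →
    HL p f → 0 < t → volume {x : ℝ | ∃ ε, 0 < ε ∧ t < |TA ε b a f x|} ≤ ENNReal.ofReal (C * (((∏ j, (∫ y, |a j y| ^ r j) ^ (1 / r j)) * (∫ y, |f y| ^ p) ^ (1 / p)) / t) ^ s) := by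
  have hsum : 0 ≤ ∑ j, 1 / r j := Finset.sum_nonneg fun j _ => by have := hr j; positivity
  have h1s : 0 < 1 / s := by rw [hs]; positivity
  have hs0 : 0 < s := one_div_pos.mp h1s
  obtain ⟨C, hC, hw⟩ := weakCS m hp hr hs
  refine ⟨C, hC, fun b a f t hb ha hf ht => ?_⟩
  have hp0 : 0 < p := by linarith
  set fn : ℕ → ℝ → ℝ := fun n => (Icc (-(n:ℝ)) n).indicator f with hfn
  have e1 : ∀ n, (fun y => |fn n y| ^ p) = (Icc (-(n:ℝ)) n).indicator (fun y => |f y| ^ p) := fun n => by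
    ext y; by_cases hy : y ∈ Icc (-(n:ℝ)) n <;> simp [hfn, hy, Real.zero_rpow hp0.ne']
  have hcs : ∀ n : ℕ, CS p n (fn n) := fun n => by
    refine ⟨hf.1.indicator measurableSet_Icc, ?_, fun y hy => ?_⟩
    · rw [e1]; exact hf.2.indicator measurableSet_Icc
    · refine indicator_of_notMem (fun hc => ?_) _
      exact absurd (abs_le.mpr hc) (not_le.mpr hy)
  have hle : ∀ n, ∫ y, |fn n y| ^ p ≤ ∫ y, |f y| ^ p := fun n => by
    rw [e1 n, integral_indicator measurableSet_Icc]
    exact setIntegral_le_integral hf.2 (Eventually.of_forall fun _ => by positivity)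
  set S : ℕ → Set ℝ := fun N => ⋂ n ≥ N, Om (1 / ((n:ℝ) + 1)) b a (fn n) t with hS
  have hmono : Monotone S := fun N M hNM => biInter_subset_biInter_left fun n hn => le_trans hNM hn
  have hsub : {x : ℝ | ∃ ε, 0 < ε ∧ t < |TA ε b a f x|} ⊆ ⋃ N, S N := by
    rintro x ⟨ε, hε, hx⟩
    have hinteg : Integrable (fun y => KA ε b a x y * f y) := by
      by_contra hc
      rw [TA, integral_undef hc, abs_zero] at hx; linarith
    have hlim : Tendsto (fun n => TA ε b a (fn n) x) atTop (nhds (TA ε b a f x)) := by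
      refine tendsto_integral_of_dominated_convergence (fun y => |KA ε b a x y * f y|) (fun n => ?_) hinteg.abs (fun n => Eventually.of_forall fun y => ?_) (Eventually.of_forall fun y => ?_)
      · exact (TA_int hp (hcs n) hb (fun j => (ha j).loc (hr j)) hε x).1
      · rw [Real.norm_eq_abs]
        by_cases hy : y ∈ Icc (-(n:ℝ)) n
        · simp [hfn, hy]
        · simp only [hfn, indicator_of_notMem hy, mul_zero, abs_zero]; exact abs_nonneg _
      · refine tendsto_const_nhds.congr' ?_
        obtain ⟨N, hN⟩ := exists_nat_ge |y|
        filter_upwards [eventually_ge_atTop N] with n hn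
        have : y ∈ Icc (-(n:ℝ)) n := abs_le.mp (hN.trans (by exact_mod_cast hn))
        simp [hfn, this]
    have h1 := hlim.abs.eventually (lt_mem_nhds hx)
    have h2 := (tendsto_one_div_add_atTop_nhds_zero_nat (𝕜 := ℝ)).eventually (gt_mem_nhds hε)
    obtain ⟨N, hN⟩ := eventually_atTop.mp (h1.and h2)
    refine mem_iUnion.mpr ⟨N, mem_iInter₂.mpr fun n hn => ⟨ε, (hN n hn).2.le, (hN n hn).1⟩⟩
  refine (measure_mono hsub).trans ?_
  rw [hmono.measure_iUnion]
  refine iSup_le fun N => ?_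
  refine (measure_mono (show S N ⊆ _ from iInter₂_subset N (le_refl N))).trans ((hw b a (fn N) _ N t hb ha (hcs N) (by positivity) ht).trans ?_)
  refine ENNReal.ofReal_le_ofReal ?_
  have := hle N
  have hpr : 0 ≤ ∏ j, (∫ y, |a j y| ^ r j) ^ (1 / r j) := Finset.prod_nonneg fun j _ => by
    have : 0 ≤ ∫ y, |a j y| ^ r j := integral_nonneg fun _ => by positivity
    positivity
  have h0 : 0 ≤ ∫ y, |fn N y| ^ p := integral_nonneg fun _ => by positivity
  gcongr

/-- existence of the principal value at a point where everything is locally constant -/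
lemma pv_nice {m : ℕ} {p R0 : ℝ} (hp : 1 < p) {f : ℝ → ℝ} (hf : CS p R0 f) {A b : ℝ → ℝ} (hA : ∀ x, HasDerivAt A (b x) x) (hb : BM1 b) {a : Fin m → ℝ → ℝ} (ha : ∀ j, LocallyIntegrable (a j) volume)
    {x η : ℝ} (hη : 0 < η) (hfx : ∀ y, |y - x| < η → f y = f x) (hax : ∀ j y, |y - x| < η → a j y = a j x) : PVex (fun ε => TA ε b a f x) := by
  set c := (∏ j, a j x) * f x with hc
  set s : ℝ → ℝ := fun y => (A x - A y) / (x - y) with hs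
  set k : ℝ → ℝ := fun y => c * (Dd b x y / (x - y) ^ 2) with hk
  have hη' : 0 < η / 2 := by positivity
  have hD : ∀ y, Dd b x y = A x - A y - b y * (x - y) := fun y => by
    unfold Dd
    rw [intervalIntegral.integral_eq_sub_of_hasDerivAt (fun t _ => hA t) (li_ii hb.2.1 _ _)]
  have hsd : ∀ y, y ≠ x → HasDerivAt (fun y => c * s y) (k y) y := fun y hy => by
    have hxy : x - y ≠ 0 := sub_ne_zero.mpr hy.symm
    have h1 := ((hA y).const_sub (A x)).div ((hasDerivAt_id y).const_sub x) hxy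
    have := h1.const_mul c
    refine this.congr_deriv ?_
    simp only [hk, hD, id]
    field_simp; ring
  have hprod : ∀ y, |y - x| < η → ∏ j, (∫ t in y..x, a j t) = (∏ j, a j x) * (x - y) ^ m := fun y hy => by
    have : ∀ j, ∫ t in y..x, a j t = a j x * (x - y) := fun j => by
      rw [intervalIntegral.integral_congr (g := fun _ => a j x)]
      · simp; ring
      · intro t ht
        refine hax j t (lt_of_le_of_lt ?_ hy)
        rw [abs_sub_comm t, abs_sub_comm y]
        exact abs_sub_right_of_mem_uIcc ht
    rw [Finset.prod_congr rfl fun j _ => this j, Finset.prod_mul_distrib]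
    simp
  set E : ℝ → Set ℝ := fun ε => Ico (x - η / 2) (x - ε) ∪ Ioc (x + ε) (x + η / 2) with hE
  have hEm : ∀ ε, MeasurableSet (E ε) := fun ε => measurableSet_Ico.union measurableSet_Ioc
  have hmem : ∀ ε y, 0 < ε → ε < η / 2 → (y ∈ E ε ↔ ε < |x - y| ∧ |x - y| ≤ η / 2) := fun ε y h1 h2 => by
    simp only [hE, mem_union, mem_Ico, mem_Ioc]
    constructor
    · rintro (⟨h3, h4⟩ | ⟨h3, h4⟩)
      · rw [abs_of_pos (by linarith)]; constructor <;> linarith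
      · rw [abs_of_neg (by linarith)]; constructor <;> linarith
    · rintro ⟨h3, h4⟩
      rcases le_total 0 (x - y) with h5 | h5
      · rw [abs_of_nonneg h5] at h3 h4; left; constructor <;> linarith
      · rw [abs_of_nonpos h5] at h3 h4; right; constructor <;> linarith
  have hdiff : ∀ ε y, 0 < ε → ε < η / 2 → KA ε b a x y * f y - KA (η / 2) b a x y * f y = (E ε).indicator k y := fun ε y h1 h2 => by
    by_cases hy : y ∈ E ε
    · rw [indicator_of_mem hy]
      obtain ⟨h3, h4⟩ := (hmem ε y h1 h2).mp hy
      unfold KA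
      have h5 : |y - x| < η := by rw [abs_sub_comm]; linarith
      rw [if_pos h3, if_neg (not_lt.mpr h4), hprod y h5, hfx y h5]
      have hxy : x - y ≠ 0 := abs_pos.mp (by linarith)
      simp only [hk, hc]
      field_simp; ring
    · rw [indicator_of_notMem hy]
      rw [hmem ε y h1 h2, not_and, not_le] at hy
      unfold KA
      by_cases h3 : ε < |x - y|
      · rw [if_pos h3, if_pos (hy h3), sub_self]
      · rw [if_neg h3, if_neg (fun h => h3 (h2.trans h)), sub_self]
  have hkey : ∀ ε, 0 < ε → ε < η / 2 → TA ε b a f x = TA (η / 2) b a f x + ((c * s (x - ε) - c * s (x - η / 2)) + (c * s (x + η / 2) - c * s (x + ε))) := fun ε h1 h2 => by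
    have i1 := TA_int hp hf hb ha h1 x
    have i2 := TA_int hp hf hb ha hη' x
    have i3 : Integrable (fun y => KA ε b a x y * f y - KA (η / 2) b a x y * f y) := i1.sub i2
    have e1 : TA ε b a f x - TA (η / 2) b a f x = ∫ y in E ε, k y := by
      rw [TA, TA, ← integral_sub i1 i2, ← integral_indicator (hEm ε)]
      exact integral_congr_ae (Eventually.of_forall fun y => hdiff ε y h1 h2)
    have i4 : IntegrableOn k (E ε) := by
      rw [← integrable_indicator_iff (hEm ε)]
      exact i3.congr (Eventually.of_forall fun y => hdiff ε y h1 h2)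
    have i5 : IntegrableOn k (Ico (x - η / 2) (x - ε)) := i4.mono_set subset_union_left
    have i6 : IntegrableOn k (Ioc (x + ε) (x + η / 2)) := i4.mono_set subset_union_right
    have hdj : Disjoint (Ico (x - η / 2) (x - ε)) (Ioc (x + ε) (x + η / 2)) := by
      rw [Set.disjoint_left]; rintro y ⟨_, h3⟩ ⟨h4, _⟩; linarith
    have i5' : IntegrableOn k (Ioc (x - η / 2) (x - ε)) := by rwa [integrableOn_Ico_iff_integrableOn_Ioo, ← integrableOn_Ioc_iff_integrableOn_Ioo] at i5
    rw [setIntegral_union hdj measurableSet_Ioc i5 i6, integral_Ico_eq_integral_Ioc, ← intervalIntegral.integral_of_le (by linarith), ← intervalIntegral.integral_of_le (by linarith),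
      intervalIntegral.integral_eq_sub_of_hasDerivAt (f := fun y => c * s y) (fun t ht => hsd t ?_) ((intervalIntegrable_iff_integrableOn_Ioc_of_le (by linarith)).mpr i5'),
      intervalIntegral.integral_eq_sub_of_hasDerivAt (f := fun y => c * s y) (fun t ht => hsd t ?_) ((intervalIntegrable_iff_integrableOn_Ioc_of_le (by linarith)).mpr i6)] at e1
    · linarith
    · rw [uIcc_of_le (by linarith)] at ht; exact (by linarith [ht.1] : x < t).ne'
    · rw [uIcc_of_le (by linarith)] at ht; exact (by linarith [ht.2] : t < x).ne
  have hsl : Tendsto s (nhdsWithin x {x}ᶜ) (nhds (b x)) := by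
    refine (hasDerivAt_iff_tendsto_slope.mp (hA x)).congr' ?_
    filter_upwards [self_mem_nhdsWithin] with y hy
    have : x - y ≠ 0 := sub_ne_zero.mpr (Ne.symm hy)
    have : y - x ≠ 0 := sub_ne_zero.mpr hy
    simp only [slope, hs, vsub_eq_sub, smul_eq_mul]
    rw [← neg_sub y x, ← neg_sub (A y), neg_div_neg_eq]; field_simp
  have t1 : Tendsto (fun ε : ℝ => x - ε) (nhdsWithin 0 (Ioi 0)) (nhdsWithin x {x}ᶜ) := by
    refine tendsto_nhdsWithin_iff.mpr ⟨?_, ?_⟩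
    · have : Tendsto (fun ε : ℝ => x - ε) (nhds 0) (nhds (x - 0)) := (continuous_const.sub continuous_id).tendsto 0
      rw [sub_zero] at this
      exact this.mono_left nhdsWithin_le_nhds
    · filter_upwards [self_mem_nhdsWithin] with ε hε
      have : 0 < ε := hε
      exact (by linarith : x - ε < x).ne
  have t2 : Tendsto (fun ε : ℝ => x + ε) (nhdsWithin 0 (Ioi 0)) (nhdsWithin x {x}ᶜ) := by
    refine tendsto_nhdsWithin_iff.mpr ⟨?_, ?_⟩
    · have : Tendsto (fun ε : ℝ => x + ε) (nhds 0) (nhds (x + 0)) := (continuous_const.add continuous_id).tendsto 0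
      rw [add_zero] at this
      exact this.mono_left nhdsWithin_le_nhds
    · filter_upwards [self_mem_nhdsWithin] with ε hε
      have : 0 < ε := hε
      exact (by linarith : x < x + ε).ne'
  refine ⟨TA (η / 2) b a f x + ((c * b x - c * s (x - η / 2)) + (c * s (x + η / 2) - c * b x)), ?_⟩
  have := (((hsl.comp t1).const_mul c).sub_const (c * s (x - η / 2))).add (((hsl.comp t2).const_mul c).const_sub (c * s (x + η / 2))) |>.const_add (TA (η / 2) b a f x)
  refine this.congr' ?_
  filter_upwards [Ioo_mem_nhdsGT hη'] with ε hε
  exact (hkey ε hε.1 hε.2).symm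

/-! ### Almost everywhere existence of principal values -/

lemma TA_sub_f {m : ℕ} {p R0 R1 : ℝ} (hp : 1 < p) {f g : ℝ → ℝ} (hf : CS p R0 f) (hg : CS p R1 g) {b : ℝ → ℝ} (hb : BM1 b) {a : Fin m → ℝ → ℝ} (ha : ∀ j, LocallyIntegrable (a j) volume)
    {ε : ℝ} (hε : 0 < ε) (x : ℝ) : TA ε b a f x - TA ε b a g x = TA ε b a (fun y => f y - g y) x := by
  unfold TA
  rw [← integral_sub (TA_int hp hf hb ha hε x) (TA_int hp hg hb ha hε x)]
  congr 1; ext y; ring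

lemma KA_upd {m : ℕ} (ε : ℝ) (b : ℝ → ℝ) (a : Fin m → ℝ → ℝ) (i : Fin m) (x y : ℝ) : ∃ c : ℝ, ∀ g : ℝ → ℝ, KA ε b (Function.update a i g) x y = (∫ t in y..x, g t) * c := by
  refine ⟨if ε < |x - y| then Dd b x y * (∏ j ∈ Finset.univ \ {i}, ∫ t in y..x, a j t) / (x - y) ^ (m + 2) else 0, fun g => ?_⟩
  have : (fun j => ∫ t in y..x, Function.update a i g j t) = Function.update (fun j => ∫ t in y..x, a j t) i (∫ t in y..x, g t) := by
    ext j; by_cases hj : j = i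
    · subst hj; simp
    · simp [Function.update_of_ne hj]
  unfold KA
  split_ifs
  · rw [this, Finset.prod_update_of_mem (Finset.mem_univ i)]; ring
  · simp

lemma TA_sub_a {m : ℕ} {p R0 : ℝ} (hp : 1 < p) {f g : ℝ → ℝ} (hf : CS p R0 f) {b : ℝ → ℝ} (hb : BM1 b) {a : Fin m → ℝ → ℝ} (ha : ∀ j, LocallyIntegrable (a j) volume)
    (i : Fin m) (hg : LocallyIntegrable g volume) {ε : ℝ} (hε : 0 < ε) (x : ℝ) :
    TA ε b a f x - TA ε b (Function.update a i g) f x = TA ε b (Function.update a i (fun y => a i y - g y)) f x := by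
  have hu : ∀ j, LocallyIntegrable (Function.update a i g j) volume := fun j => by
    by_cases hj : j = i
    · subst hj; simpa using hg
    · simpa [Function.update_of_ne hj] using ha j
  unfold TA
  rw [← integral_sub (TA_int hp hf hb ha hε x) (TA_int hp hf hb hu hε x)]
  congr 1; ext y
  obtain ⟨c, hc⟩ := KA_upd ε b a i x y
  have h1 := hc (a i)
  rw [Function.update_eq_self] at h1
  rw [h1, hc, hc, intervalIntegral.integral_sub (li_ii (ha i) _ _) (li_ii hg _ _)]
  ring

lemma small_bound {C K t s r : ℝ} (hs : 0 < s) (hr : 0 < r) {η : ℝ} (hη : 0 < η) : ∃ θ > 0, C * ((θ ^ (1 / r) * K) / t) ^ s ≤ η := by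
  have h1 : Tendsto (fun θ : ℝ => C * ((θ ^ (1 / r) * K) / t) ^ s) (nhds 0) (nhds (C * (((0:ℝ) ^ (1 / r) * K) / t) ^ s)) := by
    refine ((((tendsto_id.rpow_const (Or.inr (by positivity))).mul_const K).div_const t).rpow_const (Or.inr hs.le)).const_mul C
  rw [Real.zero_rpow (by positivity), zero_mul, zero_div, Real.zero_rpow hs.ne', mul_zero] at h1
  have h2 := (h1.mono_left (nhdsWithin_le_nhds (s := Ioi 0))).eventually (gt_mem_nhds hη)
  obtain ⟨θ, h3, h4⟩ := (h2.and self_mem_nhdsWithin).exists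
  exact ⟨θ, h4, h3.le⟩

lemma pv_ae_CS (m : ℕ) {p s : ℝ} {r : Fin m → ℝ} (hp : 1 < p) (hr : ∀ j, 1 ≤ r j) (hs : 1 / s = (∑ j, 1 / r j) + 1 / p) {A b : ℝ → ℝ} (hA : ∀ x, HasDerivAt A (b x) x) (hb : BM1 b)
    {a : Fin m → ℝ → ℝ} (ha : ∀ j, HL (r j) (a j)) {f : ℝ → ℝ} {R0 : ℝ} (hf : CS p R0 f) : ∀ᵐ x : ℝ, PVex (fun ε => TA ε b a f x) := by
  have hsum : 0 ≤ ∑ j, 1 / r j := Finset.sum_nonneg fun j _ => by have := hr j; positivity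
  have h1s : 0 < 1 / s := by rw [hs]; positivity
  have hs0 : 0 < s := one_div_pos.mp h1s
  have hr0 : ∀ j, 0 < r j := fun j => by linarith [hr j]
  have hp0 : 0 < p := by linarith
  obtain ⟨C, hC, hw⟩ := weakHL m hp hr hs
  have hpn : ∀ (a : Fin m → ℝ → ℝ) (S : Finset (Fin m)), 0 ≤ ∏ j ∈ S, (∫ y, |a j y| ^ r j) ^ (1 / r j) := fun a S => Finset.prod_nonneg fun j _ => by
    have : 0 ≤ ∫ y, |a j y| ^ r j := integral_nonneg fun _ => by positivity
    positivity
  have hfn : ∀ f : ℝ → ℝ, 0 ≤ ∫ y, |f y| ^ p := fun f => integral_nonneg fun _ => by positivity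
  -- step functions
  have base : ∀ (S : Finset (Fin m)) (a : Fin m → ℝ → ℝ) (f : ℝ → ℝ) (R0 : ℝ), (∀ j, HL (r j) (a j)) → (∀ j ∉ S, Stp (a j)) → CS p R0 f → Stp f → ∀ᵐ x : ℝ, PVex (fun ε => TA ε b a f x) := by
    intro S
    induction S using Finset.induction_on with
    | empty =>
      intro a f R0 ha hst hf hsf
      have h1 : ∀ᵐ x : ℝ, ∀ j, ∃ η > 0, ∀ y, |y - x| < η → a j y = a j x := ae_all_iff.mpr fun j => hst j (Finset.notMem_empty j)
      filter_upwards [h1, hsf] with x hx ⟨η0, hη0, hfx⟩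
      choose η hη hax using hx
      obtain ⟨e, he, he2⟩ : ∃ e > 0, ∀ j, e ≤ η j := by
        rcases (Finset.univ : Finset (Fin m)).eq_empty_or_nonempty with h | h
        · exact ⟨1, one_pos, fun j => absurd (Finset.mem_univ j) (by rw [h]; simp)⟩
        · obtain ⟨i, _, hi⟩ := Finset.exists_min_image Finset.univ η h
          exact ⟨η i, hη i, fun j => hi j (Finset.mem_univ j)⟩
      exact pv_nice hp hf hA hb (fun j => (ha j).loc (hr j)) (lt_min hη0 he) (fun y hy => hfx y (hy.trans_le (min_le_left _ _)))
        (fun j y hy => hax j y (hy.trans_le ((min_le_right _ _).trans (he2 j))))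
    | insert i S hi ih =>
      intro a f R0 ha hst hf hsf
      refine pv_lim fun t η ht hη => ?_
      obtain ⟨θ, hθ, hb1⟩ := small_bound (C := C) (K := (∏ j ∈ Finset.univ \ {i}, (∫ y, |a j y| ^ r j) ^ (1 / r j)) * (∫ y, |f y| ^ p) ^ (1 / p)) (t := t) hs0 (hr0 i) hη
      obtain ⟨g, R1, hg, hgs, hgi⟩ := step_dense (hr i) (ha i) hθ
      have hsb := (HL.sub (hr i) (ha i) hg.hl).1
      have hu : ∀ g', HL (r i) g' → ∀ j, HL (r j) (Function.update a i g' j) := fun g' hg' j => by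
        by_cases hj : j = i
        · subst hj; simpa using hg'
        · simpa [Function.update_of_ne hj] using ha j
      refine ⟨fun ε x => TA ε b (Function.update a i g) f x, ih _ f R0 (hu g hg.hl) (fun j hj => ?_) hf hsf, ?_⟩
      · by_cases hj' : j = i
        · subst hj'; simpa using hgs
        · simpa [Function.update_of_ne hj'] using hst j (by simp [hj, hj'])
      · have e : {x : ℝ | ∃ ε, 0 < ε ∧ t < |TA ε b a f x - TA ε b (Function.update a i g) f x|} = {x : ℝ | ∃ ε, 0 < ε ∧ t < |TA ε b (Function.update a i (fun y => a i y - g y)) f x|} := by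
          ext x
          refine exists_congr fun ε => and_congr_right fun hε => ?_
          rw [TA_sub_a hp hf hb (fun j => (ha j).loc (hr j)) i (hg.hl.loc (hr i)) hε]
        rw [e]
        refine (hw b _ f t hb (hu _ hsb) hf.hl ht).trans (ENNReal.ofReal_le_ofReal (le_trans ?_ hb1))
        have e2 : (fun j => (∫ y, |Function.update a i (fun y => a i y - g y) j y| ^ r j) ^ (1 / r j)) = Function.update (fun j => (∫ y, |a j y| ^ r j) ^ (1 / r j)) i ((∫ y, |a i y - g y| ^ r i) ^ (1 / r i)) := by
          ext j; by_cases hj : j = i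
          · subst hj; simp
          · simp [Function.update_of_ne hj]
        rw [e2, Finset.prod_update_of_mem (Finset.mem_univ i), mul_assoc]
        have h0 : 0 ≤ ∫ y, |a i y - g y| ^ r i := integral_nonneg fun _ => by positivity
        have h1 := hpn a (Finset.univ \ {i})
        have h2 := hfn f
        have h3 := hr0 i
        gcongr
  -- general functions
  refine pv_lim fun t η ht hη => ?_
  obtain ⟨θ, hθ, hb1⟩ := small_bound (C := C) (K := (∏ j, (∫ y, |a j y| ^ r j) ^ (1 / r j))) (t := t) hs0 hp0 hη
  obtain ⟨g, R1, hg, hgs, hgi⟩ := step_dense hp.le hf.hl hθ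
  refine ⟨fun ε x => TA ε b a g x, base Finset.univ a g R1 ha (fun j hj => absurd (Finset.mem_univ j) hj) hg hgs, ?_⟩
  have e : {x : ℝ | ∃ ε, 0 < ε ∧ t < |TA ε b a f x - TA ε b a g x|} = {x : ℝ | ∃ ε, 0 < ε ∧ t < |TA ε b a (fun y => f y - g y) x|} := by
    ext x
    refine exists_congr fun ε => and_congr_right fun hε => ?_
    rw [TA_sub_f hp hf hg hb (fun j => (ha j).loc (hr j)) hε]
  rw [e]
  refine (hw b a _ t hb ha (CS.sub hp.le hf hg).hl ht).trans (ENNReal.ofReal_le_ofReal (le_trans ?_ hb1))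
  rw [mul_comm (∏ j, (∫ y, |a j y| ^ r j) ^ (1 / r j))]
  have h0 : 0 ≤ ∫ y, |f y - g y| ^ p := integral_nonneg fun _ => by positivity
  have h1 := hpn a Finset.univ
  gcongr

lemma pv_ae (m : ℕ) {p s : ℝ} {r : Fin m → ℝ} (hp : 1 < p) (hr : ∀ j, 1 ≤ r j) (hs : 1 / s = (∑ j, 1 / r j) + 1 / p) {A b : ℝ → ℝ} (hA : ∀ x, HasDerivAt A (b x) x) (hb : BM1 b)
    {a : Fin m → ℝ → ℝ} (ha : ∀ j, HL (r j) (a j)) {f : ℝ → ℝ} (hf : HL p f) : ∀ᵐ x : ℝ, PVex (fun ε => TA ε b a f x) := by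
  have hp0 : 0 < p := by linarith
  set fn : ℕ → ℝ → ℝ := fun n => (Icc (-(n:ℝ)) n).indicator f with hfn
  have e1 : ∀ n, (fun y => |fn n y| ^ p) = (Icc (-(n:ℝ)) n).indicator (fun y => |f y| ^ p) := fun n => by
    ext y; by_cases hy : y ∈ Icc (-(n:ℝ)) n <;> simp [hfn, hy, Real.zero_rpow hp0.ne']
  have hcs : ∀ n : ℕ, CS p n (fn n) := fun n => by
    refine ⟨hf.1.indicator measurableSet_Icc, ?_, fun y hy => ?_⟩
    · rw [e1]; exact hf.2.indicator measurableSet_Icc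
    · refine indicator_of_notMem (fun hc => ?_) _
      exact absurd (abs_le.mpr hc) (not_le.mpr hy)
  have hall : ∀ᵐ x : ℝ, ∀ n, PVex (fun ε => TA ε b a (fn n) x) := ae_all_iff.mpr fun n => pv_ae_CS m hp hr hs hA hb ha (hcs n)
  filter_upwards [hall] with x hx
  obtain ⟨n, hn⟩ := exists_nat_ge (|x| + 1)
  obtain ⟨l, hl⟩ := hx n
  have hal := fun j => (ha j).loc (hr j)
  -- the tail does not depend on the truncation
  set tl : ℝ → ℝ := fun y => KA 1 b a x y * (f y - fn n y) with htl
  have htail : ∀ ε, 0 < ε → ε ≤ 1 → ∀ y, KA ε b a x y * f y = KA ε b a x y * fn n y + tl y := fun ε h1 h2 y => by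
    by_cases hy : y ∈ Icc (-(n:ℝ)) n
    · simp [htl, hfn, hy]
    · have h3 : 1 < |x - y| := by
        have : (n:ℝ) < |y| := by
          by_contra hc; exact hy (abs_le.mp (not_lt.mp hc))
        have h4 := abs_sub_abs_le_abs_sub y x
        rw [abs_sub_comm] at h4; linarith
      simp only [htl, hfn, indicator_of_notMem hy, mul_zero, zero_add, sub_zero]
      unfold KA
      rw [if_pos h3, if_pos (by linarith)]
  by_cases hi : Integrable tl
  · refine ⟨l + ∫ y, tl y, (hl.add_const _).congr' ?_⟩
    filter_upwards [Ioo_mem_nhdsGT one_pos] with ε hε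
    unfold TA
    rw [← integral_add (TA_int hp (hcs n) hb hal hε.1 x) hi]
    exact integral_congr_ae (Eventually.of_forall fun y => (htail ε hε.1 hε.2.le y).symm)
  · refine ⟨0, tendsto_const_nhds.congr' ?_⟩
    filter_upwards [Ioo_mem_nhdsGT one_pos] with ε hε
    symm
    refine integral_undef fun hc => hi ?_
    have := hc.sub (TA_int hp (hcs n) hb hal hε.1 x)
    refine this.congr (Eventually.of_forall fun y => ?_)
    simp only [Pi.sub_apply]
    rw [htail ε hε.1 hε.2.le y]; ring

/-! ### Passing to arbitrary functions -/

noncomputable def TL {m : ℕ} (b : ℝ → ℝ) (a : Fin m → ℝ → ℝ) (f : ℝ → ℝ) (x : ℝ) : ℝ := limUnder (nhdsWithin 0 (Ioi 0)) (fun ε => TA ε b a f x)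

noncomputable def Lq (p : ℝ) (g : ℝ → ℝ) : ℝ≥0∞ := (∫⁻ x, ENNReal.ofReal (|g x| ^ p)) ^ (1 / p)

lemma TL_zero {m : ℕ} {b : ℝ → ℝ} {a : Fin m → ℝ → ℝ} {f : ℝ → ℝ} {x η : ℝ} (hη : 0 < η) (h : ∀ ε, 0 < ε → ε < η → TA ε b a f x = 0) : TL b a f x = 0 := by
  refine Tendsto.limUnder_eq (tendsto_const_nhds.congr' ?_)
  filter_upwards [Ioo_mem_nhdsGT hη] with ε hε
  exact (h ε hε.1 hε.2).symm

lemma main_meas (m : ℕ) {p s : ℝ} {r : Fin m → ℝ} (hp : 1 < p) (hr : ∀ j, 1 ≤ r j) (hs : 1 / s = (∑ j, 1 / r j) + 1 / p) {A b : ℝ → ℝ} (hA : ∀ x, HasDerivAt A (b x) x) (hb : BM1 b) :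
    ∃ C : ℝ, 0 < C ∧ ∀ (a : Fin m → ℝ → ℝ) (f : ℝ → ℝ) (t : ℝ), (∀ j, HL (r j) (a j)) → HL p f → 0 < t →
      volume {x : ℝ | t < |TL b a f x|} ≤ ENNReal.ofReal (C * (((∏ j, (∫ y, |a j y| ^ r j) ^ (1 / r j)) * (∫ y, |f y| ^ p) ^ (1 / p)) / t) ^ s) := by
  obtain ⟨C, hC, hw⟩ := weakHL m hp hr hs
  refine ⟨C, hC, fun a f t ha hf ht => ?_⟩
  refine le_trans ?_ (hw b a f t hb ha hf ht)
  refine measure_mono_ae ?_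
  filter_upwards [pv_ae m hp hr hs hA hb ha hf] with x hx hxt
  obtain ⟨l, hl⟩ := hx
  have e : TL b a f x = l := hl.limUnder_eq
  have hxt' : t < |TL b a f x| := hxt
  rw [e] at hxt'
  have := (hl.abs.eventually (lt_mem_nhds hxt')).and self_mem_nhdsWithin
  obtain ⟨ε, h1, h2⟩ := this.exists
  exact ⟨ε, h2, h1⟩

lemma Lq_ofReal {r : ℝ} (hr : 0 < r) {g : ℝ → ℝ} (h : HL r g) : Lq r g = ENNReal.ofReal ((∫ y, |g y| ^ r) ^ (1 / r)) := by
  rw [Lq, ← ofReal_integral_eq_lintegral_ofReal h.2 (Eventually.of_forall fun _ => by positivity), ENNReal.ofReal_rpow_of_nonneg (integral_nonneg fun _ => by positivity) (by positivity)]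

lemma Lq_congr {r : ℝ} {g g' : ℝ → ℝ} (h : g =ᵐ[volume] g') : Lq r g = Lq r g' := by
  unfold Lq
  rw [lintegral_congr_ae]
  filter_upwards [h] with x hx
  rw [hx]

lemma Lq_zero {r : ℝ} (hr : 0 < r) {g : ℝ → ℝ} (hg : Measurable g) (h : Lq r g = 0) : g =ᵐ[volume] 0 := by
  unfold Lq at h
  rw [ENNReal.rpow_eq_zero_iff_of_pos (by positivity), lintegral_eq_zero_iff (hg.abs.pow_const r).ennreal_ofReal] at h
  filter_upwards [h] with x hx
  have h1 : |g x| ^ r ≤ 0 := ENNReal.ofReal_eq_zero.mp hx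
  have h2 : |g x| ^ r = 0 := le_antisymm h1 (by positivity)
  rw [Real.rpow_eq_zero (abs_nonneg _) hr.ne'] at h2
  exact abs_eq_zero.mp h2

lemma Lq_fin {r : ℝ} (hr : 0 < r) {g : ℝ → ℝ} (hg : Measurable g) (h : Lq r g ≠ ∞) : HL r g := by
  refine ⟨hg, ⟨(hg.abs.pow_const r).aestronglyMeasurable, ?_⟩⟩
  rw [hasFiniteIntegral_iff_ofReal (Eventually.of_forall fun _ => by positivity)]
  by_contra hc
  apply h
  unfold Lq
  rw [not_lt_top_iff.mp hc, ENNReal.top_rpow_of_pos (by positivity)]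

lemma KA_congr {m : ℕ} {ε : ℝ} {b : ℝ → ℝ} {a a' : Fin m → ℝ → ℝ} (h : ∀ j, a j =ᵐ[volume] a' j) (x y : ℝ) : KA ε b a x y = KA ε b a' x y := by
  unfold KA
  have : ∀ j, ∫ t in y..x, a j t = ∫ t in y..x, a' j t := fun j => by
    refine intervalIntegral.integral_congr_ae ?_
    filter_upwards [h j] with t ht _ using ht
  simp only [this]

lemma prim_meas {g : ℝ → ℝ} (hg : Measurable g) (x : ℝ) : Measurable (fun y => ∫ t in y..x, g t) := by
  have h1 : ∀ S : Set (ℝ × ℝ), MeasurableSet S → Measurable (fun y => ∫ t, S.indicator (fun z : ℝ × ℝ => g z.2) (y, t)) := fun S hS => by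
    have : StronglyMeasurable (S.indicator (fun z : ℝ × ℝ => g z.2)) := ((hg.comp measurable_snd).indicator hS).stronglyMeasurable
    exact (StronglyMeasurable.integral_prod_right (f := fun y t => S.indicator (fun z : ℝ × ℝ => g z.2) (y, t)) this).measurable
  have e : (fun y => ∫ t in y..x, g t) = fun y => (∫ t, {z : ℝ × ℝ | z.1 < z.2 ∧ z.2 ≤ x}.indicator (fun z : ℝ × ℝ => g z.2) (y, t)) - ∫ t, {z : ℝ × ℝ | x < z.2 ∧ z.2 ≤ z.1}.indicator (fun z : ℝ × ℝ => g z.2) (y, t) := by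
    ext y
    rw [intervalIntegral, ← integral_indicator measurableSet_Ioc, ← integral_indicator measurableSet_Ioc]
    rfl
  rw [e]
  exact (h1 _ ((measurableSet_lt measurable_fst measurable_snd).inter (measurableSet_le measurable_snd measurable_const))).sub
    (h1 _ ((measurableSet_lt measurable_const measurable_snd).inter (measurableSet_le measurable_snd measurable_fst)))

lemma KA_meas2 {m : ℕ} {ε : ℝ} {b : ℝ → ℝ} {a : Fin m → ℝ → ℝ} (hb : Measurable b) (ha : ∀ j, Measurable (a j)) (x : ℝ) : Measurable (fun y => KA ε b a x y) := by
  unfold KA Dd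
  refine Measurable.ite (measurableSet_lt measurable_const (by fun_prop)) ?_ measurable_const
  refine Measurable.div (Measurable.mul ((prim_meas hb x).sub (hb.mul (by fun_prop))) ?_) (by fun_prop)
  exact Finset.measurable_prod _ fun j _ => prim_meas (ha j) x

/-- maximal set on which a function is measurable -/
lemma max_meas (f : ℝ → ℝ) : ∃ E : Set ℝ, MeasurableSet E ∧ AEMeasurable f (volume.restrict E) ∧ ∀ F : Set ℝ, MeasurableSet F → AEMeasurable f (volume.restrict F) → volume (F \ E) = 0 := by
  set ν : Measure ℝ := (volume : Measure ℝ).toFinite with hν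
  set 𝒮 : Set ℝ≥0∞ := {c | ∃ F : Set ℝ, MeasurableSet F ∧ AEMeasurable f (volume.restrict F) ∧ c = ν F} with h𝒮
  have hne : 𝒮.Nonempty := ⟨0, ∅, MeasurableSet.empty, by simp, by simp⟩
  obtain ⟨u, _, hu, hmem⟩ := exists_seq_tendsto_sSup hne (OrderTop.bddAbove _)
  choose F hF hFm hFu using hmem
  have hEm : AEMeasurable f (volume.restrict (⋃ n, F n)) := aemeasurable_iUnion_iff.mpr hFm
  have hE : MeasurableSet (⋃ n, F n) := MeasurableSet.iUnion hF
  refine ⟨⋃ n, F n, hE, hEm, fun G hG hGm => ?_⟩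
  have h1 : sSup 𝒮 ≤ ν (⋃ n, F n) := le_of_tendsto' hu fun n => by rw [hFu n]; exact measure_mono (subset_iUnion F n)
  have h2 : ν ((⋃ n, F n) ∪ G) ≤ sSup 𝒮 := le_sSup ⟨_, hE.union hG, aemeasurable_union_iff.mpr ⟨hEm, hGm⟩, rfl⟩
  have h3 : ν (G \ ⋃ n, F n) = 0 := by
    have h4 : ν ((⋃ n, F n) ∪ G) = ν (⋃ n, F n) + ν (G \ ⋃ n, F n) := by
      rw [← measure_union disjoint_sdiff_right (hG.diff hE), union_sdiff_self]
    have h5 := h2.trans h1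
    rw [h4] at h5
    have h6 : ν (⋃ n, F n) + ν (G \ ⋃ n, F n) ≤ ν (⋃ n, F n) + 0 := by simpa using h5
    exact le_antisymm ((ENNReal.add_le_add_iff_left (measure_ne_top _ _)).mp h6) zero_le
  exact absolutelyContinuous_toFinite volume h3

lemma TL_env {m : ℕ} {b : ℝ → ℝ} {a : Fin m → ℝ → ℝ} (hb : Measurable b) (ha : ∀ j, Measurable (a j)) (f : ℝ → ℝ) :
    ∃ f' : ℝ → ℝ, Measurable f' ∧ (∀ p, 0 < p → Lq p f' ≤ Lq p f) ∧ ∀ x, |TL b a f x| ≤ |TL b a f' x| := by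
  obtain ⟨E, hE, hEm, hmax⟩ := max_meas f
  have hi : AEMeasurable (E.indicator f) volume := (aemeasurable_indicator_iff hE).mpr hEm
  refine ⟨hi.mk _, hi.measurable_mk, fun p hp => ?_, fun x => ?_⟩
  · rw [← Lq_congr hi.ae_eq_mk]
    unfold Lq
    refine ENNReal.rpow_le_rpow (lintegral_mono fun y => ENNReal.ofReal_le_ofReal ?_) (by positivity)
    by_cases hy : y ∈ E
    · simp [hy]
    · simp [hy, Real.zero_rpow hp.ne']; positivity
  · have hinteg : ∀ ε, Integrable (fun y => KA ε b a x y * f y) → TA ε b a f x = TA ε b a (hi.mk _) x := fun ε hI => by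
      have hK := KA_meas2 (ε := ε) hb ha x
      have hF : MeasurableSet {y | KA ε b a x y ≠ 0} := hK (measurableSet_singleton 0).compl
      have hfF : AEMeasurable f (volume.restrict {y | KA ε b a x y ≠ 0}) := by
        have h1 : AEMeasurable (fun y => KA ε b a x y * f y / KA ε b a x y) volume := hI.1.aemeasurable.div hK.aemeasurable
        refine h1.restrict.congr ?_
        refine (ae_restrict_iff' hF).mpr (Eventually.of_forall fun y hy => ?_)
        have : KA ε b a x y ≠ 0 := hy
        simp only; field_simp
      have h0 := hmax _ hF hfF
      unfold TA
      refine integral_congr_ae ?_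
      filter_upwards [measure_eq_zero_iff_ae_notMem.mp h0, hi.ae_eq_mk] with y h1 h2
      rw [← h2]
      by_cases hy : y ∈ E
      · rw [indicator_of_mem hy]
      · have : KA ε b a x y = 0 := by
          by_contra hc; exact h1 ⟨hc, hy⟩
        rw [this, zero_mul, zero_mul]
    by_cases hall : ∀ ε, 0 < ε → Integrable (fun y => KA ε b a x y * f y)
    · have : TL b a f x = TL b a (hi.mk _) x := by
        unfold TL limUnder
        congr 1
        refine Filter.map_congr ?_
        filter_upwards [self_mem_nhdsWithin] with ε hε
        exact hinteg ε (hall ε hε)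
      rw [this]
    · push Not at hall
      obtain ⟨ε0, h0, hn⟩ := hall
      rw [TL_zero (a := a) (f := f) h0 fun ε h1 h2 => ?_, abs_zero]
      · exact abs_nonneg _
      · refine integral_undef fun hc => hn ?_
        have hm : MeasurableSet {y : ℝ | ε0 < |x - y|} := measurableSet_lt measurable_const (by fun_prop)
        refine (hc.indicator hm).congr (Eventually.of_forall fun y => ?_)
        by_cases hy : ε0 < |x - y|
        · rw [indicator_of_mem (show y ∈ {y : ℝ | ε0 < |x - y|} from hy)]
          unfold KA
          beta_reduce
          rw [if_pos hy, if_pos (h2.trans hy)]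
        · rw [indicator_of_notMem (show y ∉ {y : ℝ | ε0 < |x - y|} from hy)]
          unfold KA
          beta_reduce
          rw [if_neg hy, zero_mul]

lemma main_ae (m : ℕ) {p s : ℝ} {r : Fin m → ℝ} (hp : 1 < p) (hr : ∀ j, 1 ≤ r j) (hs : 1 / s = (∑ j, 1 / r j) + 1 / p) {A b : ℝ → ℝ} (hA : ∀ x, HasDerivAt A (b x) x) (hb : BM1 b) :
    ∃ C : ℝ, 0 < C ∧ ∀ (a : Fin m → ℝ → ℝ) (f : ℝ → ℝ) (t : ℝ), (∀ j, AEMeasurable (a j) volume) → 0 < t →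
      volume {x : ℝ | t < |TL b a f x|} ≤ ENNReal.ofReal C * (((∏ j, Lq (r j) (a j)) * Lq p f) / ENNReal.ofReal t) ^ s := by
  have hsum : 0 ≤ ∑ j, 1 / r j := Finset.sum_nonneg fun j _ => by have := hr j; positivity
  have h1s : 0 < 1 / s := by rw [hs]; positivity
  have hs0 : 0 < s := one_div_pos.mp h1s
  have hr0 : ∀ j, 0 < r j := fun j => by linarith [hr j]
  have hp0 : 0 < p := by linarith
  obtain ⟨C, hC, hw⟩ := main_meas m hp hr hs hA hb
  refine ⟨C, hC, ?_⟩
  -- measurable case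
  have hmc : ∀ (a : Fin m → ℝ → ℝ) (f : ℝ → ℝ) (t : ℝ), (∀ j, Measurable (a j)) → Measurable f → 0 < t →
      volume {x : ℝ | t < |TL b a f x|} ≤ ENNReal.ofReal C * (((∏ j, Lq (r j) (a j)) * Lq p f) / ENNReal.ofReal t) ^ s := by
    intro a f t ha hf ht
    have hz : (∀ ε x, TA ε b a f x = 0) → volume {x : ℝ | t < |TL b a f x|} ≤ ENNReal.ofReal C * (((∏ j, Lq (r j) (a j)) * Lq p f) / ENNReal.ofReal t) ^ s := fun h => by
      have : {x : ℝ | t < |TL b a f x|} = ∅ := by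
        ext x
        simp only [Set.mem_ofPred_eq, mem_empty_iff_false, iff_false, not_lt]
        rw [TL_zero one_pos fun ε _ _ => h ε x, abs_zero]; exact ht.le
      rw [this]; simp
    by_cases h1 : ∃ j, Lq (r j) (a j) = 0
    · obtain ⟨j, hj⟩ := h1
      refine hz fun ε x => ?_
      unfold TA
      simp only [KA_zero (Lq_zero (hr0 j) (ha j) hj), zero_mul, integral_zero]
    push Not at h1
    by_cases h2 : Lq p f = 0
    · refine hz fun ε x => ?_
      unfold TA
      refine integral_eq_zero_of_ae ?_
      filter_upwards [Lq_zero hp0 hf h2] with y hy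
      rw [hy]; simp
    have hpne : ∏ j, Lq (r j) (a j) ≠ 0 := Finset.prod_ne_zero_iff.mpr fun j _ => h1 j
    by_cases h3 : (∏ j, Lq (r j) (a j)) * Lq p f = ∞
    · rw [h3, ENNReal.top_div_of_ne_top ENNReal.ofReal_ne_top, ENNReal.top_rpow_of_pos hs0, ENNReal.mul_top (by simpa using hC)]
      exact le_top
    have h4 : Lq p f ≠ ∞ := fun h => h3 (by rw [h, ENNReal.mul_top hpne])
    have h5 : ∏ j, Lq (r j) (a j) ≠ ∞ := fun h => h3 (by rw [h, ENNReal.top_mul h2])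
    have h6 : ∀ j, Lq (r j) (a j) ≠ ∞ := fun j h => h5 (by
      rw [← Finset.mul_prod_erase _ _ (Finset.mem_univ j), h, ENNReal.top_mul (Finset.prod_ne_zero_iff.mpr fun i _ => h1 i)])
    have hfl := Lq_fin hp0 hf h4
    have hal := fun j => Lq_fin (hr0 j) (ha j) (h6 j)
    refine (hw a f t hal hfl ht).trans (le_of_eq ?_)
    have hpn : ∀ j, 0 ≤ (∫ y, |a j y| ^ r j) ^ (1 / r j) := fun j => by
      have : 0 ≤ ∫ y, |a j y| ^ r j := integral_nonneg fun _ => by positivity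
      positivity
    have hfn : 0 ≤ (∫ y, |f y| ^ p) ^ (1 / p) := by
      have : 0 ≤ ∫ y, |f y| ^ p := integral_nonneg fun _ => by positivity
      positivity
    have hpp := Finset.prod_nonneg (s := Finset.univ) fun j _ => hpn j
    rw [Lq_ofReal hp0 hfl, Finset.prod_congr rfl fun j _ => Lq_ofReal (hr0 j) (hal j), ← ENNReal.ofReal_prod_of_nonneg fun j _ => hpn j, ← ENNReal.ofReal_mul hpp,
      ← ENNReal.ofReal_div_of_pos ht, ENNReal.ofReal_rpow_of_nonneg (by positivity) hs0.le, ← ENNReal.ofReal_mul hC.le]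
  intro a f t ha ht
  have e1 : ∀ g x, TL b a g x = TL b (fun j => (ha j).mk (a j)) g x := fun g x => by
    unfold TL TA
    simp only [KA_congr fun j => (ha j).ae_eq_mk]
  obtain ⟨f', hf', hle, hTL⟩ := TL_env hb.1 (fun j => (ha j).measurable_mk) f
  have hsub : {x : ℝ | t < |TL b a f x|} ⊆ {x : ℝ | t < |TL b (fun j => (ha j).mk (a j)) f' x|} := fun x hx => by
    have hx' : t < |TL b a f x| := hx
    rw [e1] at hx'
    exact hx'.trans_le (hTL x)
  refine (measure_mono hsub).trans ((hmc _ f' t (fun j => (ha j).measurable_mk) hf' ht).trans ?_)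
  have e2 : ∀ j, Lq (r j) ((ha j).mk (a j)) = Lq (r j) (a j) := fun j => (Lq_congr (ha j).ae_eq_mk).symm
  simp only [e2]
  have := hle p hp0
  gcongr

/-! ### Arbitrary coefficient functions -/

def Vc {m : ℕ} (a : Fin m → ℝ → ℝ) (x : ℝ) : Set ℝ := {y | ∀ j, IntervalIntegrable (a j) volume x y}

lemma Vc_self {m : ℕ} (a : Fin m → ℝ → ℝ) (x : ℝ) : x ∈ Vc a x := fun _ => IntervalIntegrable.refl

lemma Vc_eq {m : ℕ} {a : Fin m → ℝ → ℝ} {x y : ℝ} (h : y ∈ Vc a x) : Vc a y = Vc a x := by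
  ext z
  exact ⟨fun hz j => (h j).trans (hz j), fun hz j => (h j).symm.trans (hz j)⟩

lemma Vc_ii {m : ℕ} {a : Fin m → ℝ → ℝ} {x y z : ℝ} (hy : y ∈ Vc a x) (hz : z ∈ Vc a x) (j : Fin m) : IntervalIntegrable (a j) volume y z := (hy j).symm.trans (hz j)

lemma Vc_ord {m : ℕ} (a : Fin m → ℝ → ℝ) (x : ℝ) : OrdConnected (Vc a x) := by
  refine ⟨fun y hy z hz w hw j => (hy j).trans ?_⟩
  exact (Vc_ii hy hz j).mono_set (uIcc_subset_uIcc left_mem_uIcc (Icc_subset_uIcc hw))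

lemma Vc_meas {m : ℕ} (a : Fin m → ℝ → ℝ) (x : ℝ) : MeasurableSet (Vc a x) := (Vc_ord a x).measurableSet

lemma Vc_aem {m : ℕ} (a : Fin m → ℝ → ℝ) (x : ℝ) (j : Fin m) : AEMeasurable ((Vc a x).indicator (a j)) volume := by
  rw [aemeasurable_indicator_iff (Vc_meas a x)]
  set U : Set ℝ := ⋃ q : {q : ℚ // (q : ℝ) ∈ Vc a x}, uIoc x q.1 with hU
  have h1 : AEMeasurable (a j) (volume.restrict U) := by
    refine aemeasurable_iUnion_iff.mpr fun q => ?_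
    have := intervalIntegrable_iff.mp (q.2 j)
    exact this.1.aemeasurable
  set Z : Set ℝ := {x} ∪ ({y | IsGreatest (Vc a x) y} ∪ {y | IsLeast (Vc a x) y}) with hZ
  have hZ0 : volume Z = 0 := by
    refine measure_union_null (by simp) (measure_union_null ?_ ?_)
    · exact (Set.Subsingleton.measure_zero fun y hy z hz => IsGreatest.unique hy hz) _
    · exact (Set.Subsingleton.measure_zero fun y hy z hz => IsLeast.unique hy hz) _
  have h2 : AEMeasurable (a j) (volume.restrict (U ∪ Z)) := by
    refine aemeasurable_union_iff.mpr ⟨h1, ?_⟩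
    rw [Measure.restrict_eq_zero.mpr hZ0]; exact aemeasurable_zero_measure
  refine h2.mono_measure (Measure.restrict_mono (fun y hy => ?_) le_rfl)
  by_contra hc
  simp only [hU, hZ, mem_union, mem_iUnion, not_or, not_exists, mem_singleton_iff, Set.mem_ofPred_eq] at hc
  obtain ⟨c1, c2, c3, c4⟩ := hc
  rcases lt_or_gt_of_ne c2 with h | h
  · refine c4 ⟨hy, fun z hz => ?_⟩
    by_contra hzy
    obtain ⟨q, hq1, hq2⟩ := exists_rat_btwn (not_le.mp hzy)
    refine c1 ⟨q, (Vc_ord a x).out hz hy ⟨hq1.le, hq2.le⟩⟩ ?_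
    rw [uIoc_of_ge (by linarith)]; exact ⟨hq2, h.le⟩
  · refine c3 ⟨hy, fun z hz => ?_⟩
    by_contra hzy
    obtain ⟨q, hq1, hq2⟩ := exists_rat_btwn (not_le.mp hzy)
    refine c1 ⟨q, (Vc_ord a x).out hy hz ⟨hq1.le, hq2.le⟩⟩ ?_
    rw [uIoc_of_le (by linarith)]; exact ⟨h, hq1.le⟩

lemma KA_not {m : ℕ} {a : Fin m → ℝ → ℝ} {x y ε : ℝ} {b : ℝ → ℝ} (h : y ∉ Vc a x) : KA ε b a x y = 0 := by
  have : ∃ j, ¬ IntervalIntegrable (a j) volume x y := by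
    by_contra hc; push Not at hc; exact h hc
  obtain ⟨j, hj⟩ := this
  unfold KA
  rw [Finset.prod_eq_zero (Finset.mem_univ j) (intervalIntegral.integral_undef fun hc => hj hc.symm)]
  simp

lemma TL_loc {m : ℕ} {a : Fin m → ℝ → ℝ} {b f : ℝ → ℝ} {x x0 : ℝ} (hx : x ∈ Vc a x0) : TL b a f x = TL b (fun j => (Vc a x0).indicator (a j)) ((Vc a x0).indicator f) x := by
  unfold TL TA
  congr 1; ext ε; congr 1; ext y
  by_cases hy : y ∈ Vc a x0
  · rw [indicator_of_mem hy]
    have : ∀ j, ∫ t in y..x, a j t = ∫ t in y..x, (Vc a x0).indicator (a j) t := fun j => by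
      refine intervalIntegral.integral_congr fun t ht => ?_
      rw [indicator_of_mem]
      exact (Vc_ord a x0).uIcc_subset hy hx ht
    unfold KA
    simp only [this]
  · rw [indicator_of_notMem hy, KA_not (by rwa [Vc_eq hx])]; simp

lemma TL_triv {m : ℕ} {a : Fin m → ℝ → ℝ} {b f : ℝ → ℝ} {x : ℝ} (h : TL b a f x ≠ 0) : ∃ q : ℚ, x ∈ Vc a q := by
  obtain ⟨y, hy, hyx⟩ : ∃ y ∈ Vc a x, y ≠ x := by
    by_contra hc
    push Not at hc
    refine h (TL_zero one_pos fun ε h1 _ => ?_)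
    unfold TA
    have : ∀ y, KA ε b a x y = 0 := fun y => by
      by_cases hy : y ∈ Vc a x
      · rw [hc y hy]; unfold KA; rw [if_neg (by simpa using h1.le)]
      · exact KA_not hy
    simp [this]
  have key : ∀ q : ℚ, (q : ℝ) ∈ Vc a x → ∃ q : ℚ, x ∈ Vc a q := fun q hq => ⟨q, by rw [Vc_eq hq]; exact Vc_self a x⟩
  rcases lt_or_gt_of_ne hyx with h1 | h1
  · obtain ⟨q, hq1, hq2⟩ := exists_rat_btwn h1
    exact key q ((Vc_ord a x).out hy (Vc_self a x) ⟨hq1.le, hq2.le⟩)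
  · obtain ⟨q, hq1, hq2⟩ := exists_rat_btwn h1
    exact key q ((Vc_ord a x).out (Vc_self a x) hy ⟨hq1.le, hq2.le⟩)

lemma Lq_ind {r : ℝ} (hr : 0 < r) (g : ℝ → ℝ) {V : Set ℝ} (hV : MeasurableSet V) : Lq r (V.indicator g) = (∫⁻ x in V, ENNReal.ofReal (|g x| ^ r)) ^ (1 / r) := by
  unfold Lq
  rw [← lintegral_indicator hV]
  congr 2; ext y
  by_cases hy : y ∈ V <;> simp [hy, Real.zero_rpow hr.ne']

lemma main_all (m : ℕ) {p s : ℝ} {r : Fin m → ℝ} (hp : 1 < p) (hr : ∀ j, 1 ≤ r j) (hs : 1 / s = (∑ j, 1 / r j) + 1 / p) {A b : ℝ → ℝ} (hA : ∀ x, HasDerivAt A (b x) x) (hb : BM1 b) :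
    ∃ C : ℝ, 0 < C ∧ ∀ (a : Fin m → ℝ → ℝ) (f : ℝ → ℝ) (t : ℝ), 0 < t →
      volume {x : ℝ | t < |TL b a f x|} ≤ ENNReal.ofReal C * (((∏ j, Lq (r j) (a j)) * Lq p f) / ENNReal.ofReal t) ^ s := by
  have hsum : 0 ≤ ∑ j, 1 / r j := Finset.sum_nonneg fun j _ => by have := hr j; positivity
  have h1s : 0 < 1 / s := by rw [hs]; positivity
  have hs0 : 0 < s := one_div_pos.mp h1s
  have hr0 : ∀ j, 0 < r j := fun j => by linarith [hr j]
  have hp0 : 0 < p := by linarith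
  obtain ⟨C, hC, hw⟩ := main_ae m hp hr hs hA hb
  refine ⟨C, hC, fun a f t ht => ?_⟩
  set ι := range (fun q : ℚ => Vc a q) with hι
  haveI : Countable ι := (countable_range _).to_subtype
  have hVm : ∀ V : ι, MeasurableSet V.1 := fun V => by
    obtain ⟨q, hq⟩ := V.2
    rw [← hq]; exact Vc_meas a q
  have hdisj : Pairwise (Function.onFun Disjoint fun V : ι => V.1) := fun V W hVW => by
    obtain ⟨q, hq⟩ := V.2
    obtain ⟨q', hq'⟩ := W.2
    refine Set.disjoint_left.mpr fun x hx hx' => hVW (Subtype.ext ?_)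
    have hx1 : x ∈ V.1 := hx
    have hx2 : x ∈ W.1 := hx'
    rw [← hq] at hx1; rw [← hq'] at hx2
    rw [← hq, ← hq']
    exact (Vc_eq hx1).symm.trans (Vc_eq hx2)
  have hcov : {x : ℝ | t < |TL b a f x|} ⊆ ⋃ V : ι, {x : ℝ | t < |TL b (fun j => V.1.indicator (a j)) (V.1.indicator f) x|} := fun x hx => by
    have hx' : t < |TL b a f x| := hx
    obtain ⟨q, hq⟩ := TL_triv (a := a) (b := b) (f := f) (x := x) (fun h => by rw [h, abs_zero] at hx'; linarith)
    refine mem_iUnion.mpr ⟨⟨Vc a q, q, rfl⟩, ?_⟩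
    rw [TL_loc hq] at hx'
    exact hx'
  set α : Fin m → ι → ℝ≥0∞ := fun j V => ∫⁻ x in V.1, ENNReal.ofReal (|a j x| ^ r j) with hα
  set β : ι → ℝ≥0∞ := fun V => ∫⁻ x in V.1, ENNReal.ofReal (|f x| ^ p) with hβ
  have hlin : ∀ g : ℝ → ℝ≥0∞, ∑' V : ι, ∫⁻ x in V.1, g x ≤ ∫⁻ x, g x := fun g => by
    rw [← lintegral_iUnion hVm hdisj]
    exact lintegral_mono' Measure.restrict_le_self le_rfl
  set T : ℝ≥0∞ := ((ENNReal.ofReal t)⁻¹) ^ s with hT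
  have hpow : ∀ (X : Fin m → ℝ≥0∞) (Y : ℝ≥0∞), (((∏ j, (X j) ^ (1 / r j)) * Y ^ (1 / p)) / ENNReal.ofReal t) ^ s = T * (Y ^ (s / p) * ∏ j, X j ^ (s / r j)) := fun X Y => by
    rw [div_eq_mul_inv, ENNReal.mul_rpow_of_nonneg _ _ hs0.le, ENNReal.mul_rpow_of_nonneg _ _ hs0.le, ← ENNReal.prod_rpow_of_nonneg hs0.le, ← ENNReal.rpow_mul]
    have : ∀ j, (X j ^ (1 / r j)) ^ s = X j ^ (s / r j) := fun j => by rw [← ENNReal.rpow_mul]; congr 1; ring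
    simp only [this]
    rw [show 1 / p * s = s / p by ring]
    ring
  have hV : ∀ V : ι, volume {x : ℝ | t < |TL b (fun j => V.1.indicator (a j)) (V.1.indicator f) x|} ≤ ENNReal.ofReal C * T * (β V ^ (s / p) * ∏ j, α j V ^ (s / r j)) := fun V => by
    have h1 := hw (fun j => V.1.indicator (a j)) (V.1.indicator f) t (fun j => by
      obtain ⟨q, hq⟩ := V.2
      rw [← hq]; exact Vc_aem a q j) ht
    refine h1.trans (le_of_eq ?_)
    rw [Lq_ind hp0 f (hVm V), Finset.prod_congr rfl fun j _ => Lq_ind (hr0 j) (a j) (hVm V), hpow, mul_assoc]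
  have hhol : ∑' V : ι, (β V ^ (s / p) * ∏ j, α j V ^ (s / r j)) ≤ (∑' V, β V) ^ (s / p) * ∏ j, (∑' V, α j V) ^ (s / r j) := by
    letI : MeasurableSpace ι := ⊤
    have := ENNReal.lintegral_mul_prod_norm_pow_le (μ := (Measure.count : Measure ι)) Finset.univ (g := β) (f := α) (measurable_from_top.aemeasurable) (fun j _ => measurable_from_top.aemeasurable) (s / p) (p := fun j => s / r j)
      (by
        have : s / p + ∑ j, s / r j = s * (1 / s) := by rw [hs, mul_add, Finset.mul_sum, add_comm]; simp only [mul_one_div]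
        rw [this]; field_simp) (by positivity) (fun j _ => by have := hr0 j; positivity)
    simpa only [lintegral_count] using this
  refine (measure_mono hcov).trans ((measure_iUnion_le _).trans ((ENNReal.tsum_le_tsum hV).trans ?_))
  rw [ENNReal.tsum_mul_left]
  have hfin := hpow (fun j => ∫⁻ x, ENNReal.ofReal (|a j x| ^ r j)) (∫⁻ x, ENNReal.ofReal (|f x| ^ p))
  unfold Lq
  rw [hfin, mul_assoc]
  refine mul_le_mul' le_rfl (mul_le_mul' le_rfl (hhol.trans (mul_le_mul' ?_ (Finset.prod_le_prod' fun j _ => ?_))))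
  · exact ENNReal.rpow_le_rpow (hlin _) (by positivity)
  · exact ENNReal.rpow_le_rpow (hlin _) (by have := hr0 j; positivity)

lemma osc_int {A b : ℝ → ℝ} (hA : ∀ x, HasDerivAt A (b x) x)
    (ho : ∀ u v : ℝ, u < v → (v - u)⁻¹ * ∫ y in Ioc u v, |b y - (v - u)⁻¹ * ∫ z in Ioc u v, b z| ≤ 1)
    {u v : ℝ} (huv : u < v) (hi : IntegrableOn b (Icc u v)) :
    ∫ y in Icc u v, |b y| ≤ (v - u) + |A v - A u| := by
  have hl : 0 < v - u := sub_pos.mpr huv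
  rw [integral_Icc_eq_integral_Ioc]
  have hi' : IntegrableOn b (Ioc u v) := hi.mono_set Ioc_subset_Icc_self
  have hII : IntervalIntegrable b volume u v := (intervalIntegrable_iff_integrableOn_Ioc_of_le huv.le).mpr hi'
  have hF : ∫ z in Ioc u v, b z = A v - A u := by
    rw [← intervalIntegral.integral_of_le huv.le]
    exact intervalIntegral.integral_eq_sub_of_hasDerivAt (fun x _ => hA x) hII
  have h1 := ho u v huv
  rw [hF] at h1
  set c := (v - u)⁻¹ * (A v - A u) with hc
  have h2 : ∫ y in Ioc u v, |b y - c| ≤ v - u := by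
    rw [inv_mul_le_iff₀ hl, mul_one] at h1; exact h1
  have hic : IntegrableOn (fun _ : ℝ => c) (Ioc u v) := integrableOn_const (by simp)
  have hd : IntegrableOn (fun y => |b y - c|) (Ioc u v) := (hi'.sub hic).abs
  have hcc : IntegrableOn (fun _ : ℝ => |c|) (Ioc u v) := integrableOn_const (by simp)
  calc ∫ y in Ioc u v, |b y| ≤ ∫ y in Ioc u v, (|b y - c| + |c|) := by
        refine integral_mono hi'.abs (hd.add hcc) fun y => ?_
        have := abs_add_le (b y - c) c
        simpa using this
    _ = (∫ y in Ioc u v, |b y - c|) + ∫ y in Ioc u v, |c| := integral_add hd hcc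
    _ ≤ (v - u) + |A v - A u| := by
        refine add_le_add h2 (le_of_eq ?_)
        rw [setIntegral_const, Measure.real, Real.volume_Ioc, ENNReal.toReal_ofReal hl.le, hc, abs_mul, abs_of_pos (inv_pos.mpr hl), smul_eq_mul]
        field_simp

lemma baire_li {A b : ℝ → ℝ} (hA : ∀ x, HasDerivAt A (b x) x)
    (ho : ∀ u v : ℝ, u < v → (v - u)⁻¹ * ∫ y in Ioc u v, |b y - (v - u)⁻¹ * ∫ z in Ioc u v, b z| ≤ 1)
    (hbm : Measurable b) : LocallyIntegrable b volume := by
  have hAc : Continuous A := continuous_iff_continuousAt.mpr fun x => (hA x).continuousAt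
  set F : Set ℝ := {x | ¬ IntegrableAtFilter b (nhds x) volume} with hF
  have hFo : IsOpen Fᶜ := by
    rw [isOpen_iff_mem_nhds]
    intro x hx
    have hx' : IntegrableAtFilter b (nhds x) volume := not_not.mp hx
    obtain ⟨s, hs, hsi⟩ := hx'
    filter_upwards [eventually_mem_nhds_iff.mpr hs] with y hy
    exact fun h => h ⟨s, hy, hsi⟩
  have hFc : IsClosed F := isOpen_compl_iff.mp hFo
  by_contra hnl
  have hne : F.Nonempty := by
    by_contra he
    rw [Set.not_nonempty_iff_eq_empty] at he
    refine hnl fun x => ?_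
    by_contra hx
    have : x ∈ F := hx
    rw [he] at this
    exact this
  set G : ℕ → Set ℝ := fun n => {x | ∀ y, |y - x| < 1 / ((n : ℝ) + 1) → |A y - A x| ≤ ((n : ℝ) + 1) * |y - x|} with hG
  have hGc : ∀ n, IsClosed (G n) := fun n => by
    have : G n = ⋂ y, ({x | 1 / ((n : ℝ) + 1) ≤ |y - x|} ∪ {x | |A y - A x| ≤ ((n : ℝ) + 1) * |y - x|}) := by
      ext x
      constructor
      · intro h
        refine mem_iInter.mpr fun y => ?_
        rcases lt_or_ge (|y - x|) (1 / ((n : ℝ) + 1)) with h1 | h1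
        · exact Or.inr (h y h1)
        · exact Or.inl h1
      · intro h y hy
        rcases mem_iInter.mp h y with h1 | h1
        · exact absurd h1 (not_le.mpr hy)
        · exact h1
    rw [this]
    refine isClosed_iInter fun y => IsClosed.union ?_ ?_
    · exact isClosed_le continuous_const (by fun_prop)
    · exact isClosed_le (by fun_prop) (by fun_prop)
  have hGu : ∀ x, ∃ n, x ∈ G n := fun x => by
    obtain ⟨c, hc⟩ := (hA x).isBigO_sub.bound
    obtain ⟨ε, hε, hb⟩ := Metric.eventually_nhds_iff.mp hc
    obtain ⟨n, hn⟩ := exists_nat_gt (max c (1 / ε))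
    have hn1 : c ≤ n := (le_max_left _ _).trans hn.le
    have hn2 : 1 / ε ≤ (n : ℝ) + 1 := by linarith [le_max_right c (1 / ε)]
    refine ⟨n, fun y hy => ?_⟩
    have h1 : 1 / ((n : ℝ) + 1) ≤ ε := by
      rw [div_le_iff₀ hε] at hn2
      rw [div_le_iff₀ (by positivity)]; linarith
    have h2 := hb (y := y) (by rw [Real.dist_eq]; linarith)
    rw [Real.norm_eq_abs, Real.norm_eq_abs] at h2
    exact h2.trans (mul_le_mul_of_nonneg_right (by linarith) (abs_nonneg _))
  haveI : CompleteSpace F := hFc.completeSpace_coe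
  haveI : Nonempty F := hne.to_subtype
  obtain ⟨n, x0, hx0⟩ := nonempty_interior_of_iUnion_of_closed (X := F) (f := fun n => (Subtype.val ⁻¹' G n : Set F)) (fun n => (hGc n).preimage continuous_subtype_val) (by
    refine eq_univ_of_forall fun x => ?_
    obtain ⟨n, hn⟩ := hGu x.1
    exact mem_iUnion.mpr ⟨n, hn⟩)
  obtain ⟨η0, hη0, hball⟩ := Metric.mem_nhds_iff.mp (mem_interior_iff_mem_nhds.mp hx0)
  have hN : (0 : ℝ) < (n : ℝ) + 1 := by positivity
  set N : ℝ := (n : ℝ) + 1 with hNd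
  set η := min η0 (1 / N) with hη
  have hηp : 0 < η := lt_min hη0 (by positivity)
  have hηN : η ≤ 1 / N := min_le_right _ _
  have hz : ∀ z ∈ F, |z - x0.1| < η → z ∈ G n := fun z hzF hzd =>
    hball (show (⟨z, hzF⟩ : F) ∈ Metric.ball x0 η0 from by
      rw [Metric.mem_ball, Subtype.dist_eq, Real.dist_eq]
      exact hzd.trans_le (min_le_left _ _))
  set κ : Measure ℝ := volume.withDensity (fun y => ‖b y‖ₑ) with hκ
  set S : Set ℝ := Metric.ball x0.1 (η / 4) \ F with hS
  have hSm : MeasurableSet S := Metric.isOpen_ball.measurableSet.diff hFc.measurableSet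
  have hρ : ∀ y ∈ S, 0 < Metric.infDist y F ∧ Metric.infDist y F < η / 4 := fun y hy => by
    refine ⟨(hFc.notMem_iff_infDist_pos hne).mp hy.2, ?_⟩
    exact (Metric.infDist_le_dist_of_mem x0.2).trans_lt hy.1
  have hv := vit_measure (S := S) (T := univ) (r := fun y => Metric.infDist y F / 10) (R := η) κ (volume.restrict (Metric.ball x0.1 η)) (ENNReal.ofReal (5 * (1 + 3 * N))) (fun y hy => by
    obtain ⟨h1, h2⟩ := hρ y hy
    constructor
    · positivity
    · show Metric.infDist y F / 10 ≤ η
      linarith) (fun y hy => by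
    obtain ⟨h1, h2⟩ := hρ y hy
    obtain ⟨z, hzF, hzd⟩ := hFc.exists_infDist_eq_dist hne y
    beta_reduce
    set ρ := Metric.infDist y F with hρd
    rw [Real.dist_eq] at hzd
    have hy1 : |y - x0.1| < η / 4 := by have := hy.1; rwa [Metric.mem_ball, Real.dist_eq] at this
    have hzG : z ∈ G n := hz z hzF (by
      have := abs_sub_le z y x0.1
      rw [abs_sub_comm z y] at this
      linarith)
    have hzy := abs_le.mp hzd.symm.le
    have hyy := abs_lt.mp hy1
    have e1 : |A (y + ρ / 2) - A z| ≤ N * (3 * ρ / 2) := by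
      have h3 : |y + ρ / 2 - z| ≤ 3 * ρ / 2 := abs_le.mpr ⟨by linarith, by linarith⟩
      exact (hzG (y + ρ / 2) (by linarith)).trans (mul_le_mul_of_nonneg_left h3 hN.le)
    have e2 : |A (y - ρ / 2) - A z| ≤ N * (3 * ρ / 2) := by
      have h3 : |y - ρ / 2 - z| ≤ 3 * ρ / 2 := abs_le.mpr ⟨by linarith, by linarith⟩
      exact (hzG (y - ρ / 2) (by linarith)).trans (mul_le_mul_of_nonneg_left h3 hN.le)
    have e3 : |A (y + ρ / 2) - A (y - ρ / 2)| ≤ 3 * N * ρ := by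
      have := abs_sub_le (A (y + ρ / 2)) (A z) (A (y - ρ / 2))
      rw [abs_sub_comm (A z)] at this
      linarith
    have hsub : Icc (y - ρ / 2) (y + ρ / 2) ⊆ Fᶜ := fun w hw hwF => by
      have h4 : ρ ≤ |y - w| := by
        have := Metric.infDist_le_dist_of_mem (x := y) hwF
        rwa [Real.dist_eq] at this
      have h5 : |y - w| ≤ ρ / 2 := abs_le.mpr ⟨by linarith [hw.2], by linarith [hw.1]⟩
      linarith
    have hinteg : IntegrableOn b (Icc (y - ρ / 2) (y + ρ / 2)) := by
      refine LocallyIntegrableOn.integrableOn_isCompact (fun w hw => ?_) isCompact_Icc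
      exact (not_not.mp (hsub hw)).filter_mono nhdsWithin_le_nhds
    have h6 := osc_int hA ho (show y - ρ / 2 < y + ρ / 2 by linarith) hinteg
    have h7 : κ (Icc (y - ρ / 2) (y + ρ / 2)) = ENNReal.ofReal (∫ w in Icc (y - ρ / 2) (y + ρ / 2), |b w|) := by
      rw [hκ, withDensity_apply _ measurableSet_Icc]
      rw [ofReal_integral_eq_lintegral_ofReal hinteg.abs (Eventually.of_forall fun w => abs_nonneg _)]
      refine lintegral_congr fun w => ?_
      exact Real.enorm_eq_ofReal_abs _
    rw [univ_inter, show 5 * (ρ / 10) = ρ / 2 by ring, h7, Measure.restrict_apply measurableSet_Icc, inter_eq_left.mpr, Real.volume_Icc, ← ENNReal.ofReal_mul (by positivity)]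
    · refine ENNReal.ofReal_le_ofReal ?_
      nlinarith
    · intro w hw
      rw [Metric.mem_ball, Real.dist_eq]
      exact abs_lt.mpr ⟨by linarith [hw.1], by linarith [hw.2]⟩)
  have hSfin : ∫⁻ y in S, ‖b y‖ₑ < ∞ := by
    rw [← withDensity_apply _ hSm]
    rw [univ_inter, Measure.restrict_apply_univ] at hv
    refine hv.trans_lt (ENNReal.mul_lt_top ENNReal.ofReal_lt_top ?_)
    exact measure_ball_lt_top
  have hFfin : ∫⁻ y in Metric.ball x0.1 (η / 4) ∩ F, ‖b y‖ₑ < ∞ := by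
    have hle : ∫⁻ y in Metric.ball x0.1 (η / 4) ∩ F, ‖b y‖ₑ ≤ ∫⁻ y in Metric.ball x0.1 (η / 4) ∩ F, ENNReal.ofReal N := by
      refine setLIntegral_mono' (Metric.isOpen_ball.measurableSet.inter hFc.measurableSet) fun y hy => ?_
      rw [Real.enorm_eq_ofReal_abs]
      refine ENNReal.ofReal_le_ofReal ?_
      have hyG : y ∈ G n := hz y hy.2 (by
        have := hy.1
        rw [Metric.mem_ball, Real.dist_eq] at this
        linarith)
      have := (hA y).le_of_lip' hN.le (by
        have h8 : Metric.ball y (1 / N) ∈ nhds y := Metric.ball_mem_nhds _ (by positivity)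
        filter_upwards [h8] with w hw
        rw [Metric.mem_ball, Real.dist_eq] at hw
        exact hyG w hw)
      exact this
    refine hle.trans_lt ?_
    rw [setLIntegral_const]
    exact ENNReal.mul_lt_top ENNReal.ofReal_lt_top ((measure_mono inter_subset_left).trans_lt measure_ball_lt_top)
  refine x0.2 ⟨Metric.ball x0.1 (η / 4), Metric.ball_mem_nhds _ (by positivity), hbm.aestronglyMeasurable, ?_⟩
  show ∫⁻ y in Metric.ball x0.1 (η / 4), ‖b y‖ₑ < ∞
  rw [← lintegral_inter_add_sdiff _ _ hFc.measurableSet]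
  exact ENNReal.add_lt_top.mpr ⟨hFfin, hSfin⟩

lemma BM1_of {A b : ℝ → ℝ} (hA : ∀ x, HasDerivAt A (b x) x)
    (ho : ∀ u v : ℝ, u < v → (v - u)⁻¹ * ∫ y in Ioc u v, |b y - (v - u)⁻¹ * ∫ z in Ioc u v, b z| ≤ 1) : BM1 b := by
  have hbm : Measurable b := by
    have : b = deriv A := funext fun x => (hA x).deriv.symm
    rw [this]; exact measurable_deriv A
  refine ⟨hbm, baire_li hA ho hbm, fun c r hr => ?_⟩
  have h := ho (c - r) (c + r) (by linarith)
  unfold av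
  rw [integral_Icc_eq_integral_Ioc, integral_Icc_eq_integral_Ioc]
  rw [show c + r - (c - r) = 2 * r by ring] at h
  rwa [inv_mul_le_iff₀ (by positivity), mul_one] at h

lemma CcommA_eq {m : ℕ} {A A' : ℝ → ℝ} (hA : ∀ x, HasDerivAt A (A' x) x) (hb : BM1 A')
    (a : Fin m → ℝ → ℝ) (f : ℝ → ℝ) (x : ℝ) : CcommA m A A' a f x = TL A' a f x := by
  unfold CcommA TL
  congr 1
  ext ε
  unfold TA
  have hms : MeasurableSet {y : ℝ | ε < |x - y|} := measurableSet_lt measurable_const (by fun_prop)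
  rw [← integral_indicator hms]
  congr 1
  ext y
  have hD : P2 A A' x y = Dd A' x y := by
    unfold P2 Dd
    rw [intervalIntegral.integral_eq_sub_of_hasDerivAt (fun t _ => hA t) (li_ii hb.2.1 y x)]
  by_cases hy : ε < |x - y|
  · rw [indicator_of_mem (by exact hy), hD, KA, if_pos hy]
    rfl
  · rw [indicator_of_notMem (by exact hy), KA, if_neg hy, zero_mul]

lemma wk_of_dist {s C : ℝ} (hs : 0 < s) (hC : 0 < C) {g : ℝ → ℝ} {X : ℝ≥0∞}
    (h : ∀ t : ℝ, 0 < t → volume {x : ℝ | t < |g x|} ≤ ENNReal.ofReal C * (X / ENNReal.ofReal t) ^ s) :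
    wkNorm s g ≤ ENNReal.ofReal (C ^ (1 / s)) * X := by
  unfold wkNorm
  refine iSup_le fun t => iSup_le fun ht => ?_
  have h0 : ENNReal.ofReal t ≠ 0 := by simpa using ht
  calc ENNReal.ofReal t * (volume {x : ℝ | t < |g x|}) ^ (1 / s)
      ≤ ENNReal.ofReal t * (ENNReal.ofReal C * (X / ENNReal.ofReal t) ^ s) ^ (1 / s) :=
        mul_le_mul' le_rfl (ENNReal.rpow_le_rpow (h t ht) (by positivity))
    _ = ENNReal.ofReal t * (ENNReal.ofReal (C ^ (1 / s)) * (X / ENNReal.ofReal t)) := by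
        rw [ENNReal.mul_rpow_of_nonneg _ _ (by positivity), ← ENNReal.rpow_mul, mul_one_div_cancel hs.ne', ENNReal.rpow_one, ENNReal.ofReal_rpow_of_pos hC]
    _ = ENNReal.ofReal (C ^ (1 / s)) * (ENNReal.ofReal t * (X / ENNReal.ofReal t)) := by ring
    _ = ENNReal.ofReal (C ^ (1 / s)) * X := by
        rw [ENNReal.mul_div_cancel h0 ENNReal.ofReal_ne_top]

lemma osc_of_bmo {b : ℝ → ℝ} (hbmo : bmoNorm b = 1) :
    ∀ u v : ℝ, u < v → (v - u)⁻¹ * ∫ y in Ioc u v, |b y - (v - u)⁻¹ * ∫ z in Ioc u v, b z| ≤ 1 := by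
  intro u v huv
  unfold bmoNorm at hbmo
  rw [← hbmo]
  refine le_csSup ?_ ⟨u, v, huv, rfl⟩
  by_contra hn
  rw [Real.sSup_of_not_bddAbove hn] at hbmo
  exact zero_ne_one hbmo

lemma wk_main (m : ℕ) {A A' : ℝ → ℝ} (hA : ∀ x, HasDerivAt A (A' x) x) (hbmo : bmoNorm A' = 1)
    {p s : ℝ} {r : Fin m → ℝ} (hp : 1 < p) (hr : ∀ j, 1 ≤ r j) (hs : 1 / s = (∑ j, 1 / r j) + 1 / p) :
    ∃ C : ℝ, 0 < C ∧ ∀ (a : Fin m → ℝ → ℝ) (f : ℝ → ℝ),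
      wkNorm s (CcommA m A A' a f) ≤ ENNReal.ofReal C * ((∏ j : Fin m, LpNorm (r j) (a j)) * LpNorm p f) := by
  have hb : BM1 A' := BM1_of hA (osc_of_bmo hbmo)
  have hsum : 0 ≤ ∑ j, 1 / r j := Finset.sum_nonneg fun j _ => by have := hr j; positivity
  have h1s : 0 < 1 / s := by rw [hs]; positivity
  have hs0 : 0 < s := one_div_pos.mp h1s
  obtain ⟨C, hC, hw⟩ := main_all m hp hr hs hA hb
  refine ⟨C ^ (1 / s), by positivity, fun a f => ?_⟩
  refine wk_of_dist hs0 hC fun t ht => ?_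
  rw [show CcommA m A A' a f = TL A' a f from funext fun x => CcommA_eq hA hb a f x]
  exact hw a f t ht

/-- (2.16) and the subsequent extension: weak type bounds for the
generalized Calderón commutator. -/
theorem weak_type_bounds_CcommA (m : ℕ) (A A' : ℝ → ℝ)
    (hA : ∀ x, HasDerivAt A (A' x) x) (hbmo : bmoNorm A' = 1) :
    (∀ q : Fin (m + 1) → ℝ, (∀ i, 1 < q i) →
      ∀ qt : ℝ, 1 / qt = ∑ i, 1 / q i → 1 < qt →
        ∃ C : ℝ, 0 < C ∧
          ∀ (a : Fin m → ℝ → ℝ) (f : ℝ → ℝ),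
            wkNorm qt (CcommA m A A' a f) ≤
              ENNReal.ofReal C *
                ((∏ j : Fin m, LpNorm (q j.castSucc) (a j)) *
                  LpNorm (q (Fin.last m)) f)) ∧
    (∀ q : Fin (m + 1) → ℝ, (∀ i, 1 < q i) →
      ∀ r : Fin m → ℝ, (∀ j, 1 ≤ r j ∧ r j < q j.castSucc) →
        ∀ rt : ℝ, 1 / rt = (∑ j, 1 / r j) + 1 / q (Fin.last m) →
          ∃ C : ℝ, 0 < C ∧
            ∀ (a : Fin m → ℝ → ℝ) (f : ℝ → ℝ),
              wkNorm rt (CcommA m A A' a f) ≤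
                ENNReal.ofReal C *
                  ((∏ j : Fin m, LpNorm (r j) (a j)) * LpNorm (q (Fin.last m)) f)) := by
  refine ⟨fun q hq qt hqt _ => ?_, fun q hq r hr rt hrt => ?_⟩
  · refine wk_main m hA hbmo (r := fun j => q j.castSucc) (hq (Fin.last m)) (fun j => (hq _).le) ?_
    rw [hqt, Fin.sum_univ_castSucc]
  · exact wk_main m hA hbmo (hq (Fin.last m)) (fun j => (hr j).1) hrt
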